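/- Suppose that 1 < α ≤ 3 and β > (3−α)/2. Then there exist p = p(α, β, γ) with 1 < p ≤ 2 and a constant C = C(α, β, γ) such that: for every Borel measure μ on the unit ball B₃(0,1) ⊆ ℝ³ with c_α(μ) < ∞ and every Borel measure λ on I with c_β(λ) < ∞, one has ∫_I ‖ρ_{θ♯}μ‖_{L^p(H¹)}^p dλ(θ) ≤ C · c_α(μ)^{p−1} · μ(ℝ³) · λ(ℝ)^{(2−p)/2} · c_β(λ)^{p/2}, where ‖ρ_{θ♯}μ‖_{L^p(H¹)} denotes the L^p norm (with respect to H¹ on the line spanned by γ(θ)) of the Radon–Nikodym density of ρ_{θ♯}μ when ρ_{θ♯}μ is absolutely continuous with respect to H¹, and is +∞ otherwise. -/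

import Mathlib

/-!
STATEMENT 1 (Theorem 1.2 / `Lptheorem`):
For `1 < α ≤ 3` and `β > (3-α)/2` there exist `1 < p ≤ 2` and `C = C(α, β, γ)`
such that for all Borel measures `μ` on `B₃(0,1)` with `c_α(μ) < ∞` and all Borel
measures `λ` on `I` with `c_β(λ) < ∞`,
`∫_I ‖ρ_{θ♯}μ‖_{L^p(H¹)}^p dλ(θ) ≤ C c_α(μ)^{p-1} μ(ℝ³) λ(ℝ)^{(2-p)/2} c_β(λ)^{p/2}`,
where `‖ρ_{θ♯}μ‖_{L^p(H¹)}` is the `L^p` norm of the Radon–Nikodym density of the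
pushforward with respect to `H¹` on the line spanned by `γ θ` when the pushforward
is absolutely continuous, and `+∞` otherwise.
-/

open MeasureTheory Metric Set
open scoped ENNReal NNReal RealInnerProductSpace Classical

noncomputable section

abbrev E3 : Type := EuclideanSpace ℝ (Fin 3)

/-- `c_α(μ) = sup_{x, r>0} μ(B(x,r)) / r^α`. -/
def frostmanConst {X : Type*} [PseudoMetricSpace X] [MeasurableSpace X]
    (μ : Measure X) (α : ℝ) : ℝ≥0∞ :=
  ⨆ (x : X) (r : ℝ) (_ : 0 < r), μ (Metric.ball x r) / ENNReal.ofReal (r ^ α)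

/-- Orthogonal projection onto the line spanned by `γ θ`:  `ρ_θ x = ⟨x, γ θ⟩ γ θ`. -/
def lineProj (γ : ℝ → E3) (θ : ℝ) (x : E3) : E3 := ⟪x, γ θ⟫ • γ θ

/-- `‖ν‖_{L^p(H)}^p`: the `p`-th power of the `L^p(H)` norm of the Radon–Nikodym
density of `ν` with respect to `H` if `ν ≪ H`, and `+∞` otherwise. -/
def LpPowNorm {X : Type*} [MeasurableSpace X] (ν H : Measure X) (p : ℝ) : ℝ≥0∞ :=
  if ν ≪ H then ∫⁻ y, ν.rnDeriv H y ^ p ∂H else ∞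

/-- A bounded measurable complex-valued function. -/
def IsBddMeas {X : Type} [MeasurableSpace X] (f : X → ℂ) : Prop :=
  Measurable f ∧ ∃ B : ℝ, ∀ x, ‖f x‖ ≤ B

namespace IsBddMeas

variable {X : Type} [MeasurableSpace X] {f g : X → ℂ}

lemma mul (hf : IsBddMeas f) (hg : IsBddMeas g) : IsBddMeas (fun x => f x * g x) := by
  obtain ⟨hf, B, hB⟩ := hf
  obtain ⟨hg, B', hB'⟩ := hg
  refine ⟨hf.mul hg, B * B', fun x => ?_⟩
  rw [norm_mul]
  exact mul_le_mul (hB x) (hB' x) (norm_nonneg _) ((norm_nonneg _).trans (hB x))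

lemma sum {κ : Type} {F : κ → X → ℂ} (s : Finset κ) (h : ∀ i, IsBddMeas (F i)) :
    IsBddMeas (fun x => ∑ i ∈ s, F i x) := by
  choose hm B hB using h
  refine ⟨Finset.measurable_sum _ fun i _ => hm i, ∑ i ∈ s, B i, fun x => ?_⟩
  exact (norm_sum_le _ _).trans (Finset.sum_le_sum fun i _ => hB i x)

lemma conj (hf : IsBddMeas f) : IsBddMeas (fun x => (starRingEnd ℂ) (f x)) := by
  obtain ⟨hf, B, hB⟩ := hf
  exact ⟨Complex.continuous_conj.measurable.comp hf, B, fun x => by simpa using hB x⟩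

lemma integrable (hf : IsBddMeas f) (m : Measure X) [IsFiniteMeasure m] : Integrable f m := by
  obtain ⟨hf, B, hB⟩ := hf
  exact Integrable.of_bound hf.aestronglyMeasurable B (Filter.Eventually.of_forall hB)

lemma integrable_norm_pow_mul (hf : IsBddMeas f) (hg : IsBddMeas g) (m : Measure X)
    [IsFiniteMeasure m] (a b : ℕ) : Integrable (fun x => ‖f x‖ ^ a * ‖g x‖ ^ b) m := by
  obtain ⟨hf, B, hB⟩ := hf
  obtain ⟨hg, B', hB'⟩ := hg
  refine Integrable.of_bound ((hf.norm.pow_const a).mul (hg.norm.pow_const b)).aestronglyMeasurable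
    (B ^ a * B' ^ b) (Filter.Eventually.of_forall fun x => ?_)
  rw [Real.norm_of_nonneg (by positivity)]
  have := (norm_nonneg _).trans (hB x)
  exact mul_le_mul (pow_le_pow_left₀ (norm_nonneg _) (hB x) _)
    (pow_le_pow_left₀ (norm_nonneg _) (hB' x) _) (by positivity) (by positivity)

lemma integrable_norm_pow (hf : IsBddMeas f) (m : Measure X)
    [IsFiniteMeasure m] (a : ℕ) : Integrable (fun x => ‖f x‖ ^ a) m := by
  simpa using hf.integrable_norm_pow_mul hf m a 0

end IsBddMeas

section Holder

variable {X : Type} [MeasurableSpace X] (m : Measure X)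

/-- Cauchy–Schwarz for nonnegative products of square integrable functions. -/
lemma sq_integral_mul_le {u v : X → ℝ} (hu : Integrable (fun x => u x ^ 2) m)
    (hv : Integrable (fun x => v x ^ 2) m) (huv : Integrable (fun x => u x * v x) m) :
    (∫ x, u x * v x ∂m) ^ 2 ≤ (∫ x, u x ^ 2 ∂m) * ∫ x, v x ^ 2 ∂m := by
  have key : ∀ t : ℝ, 0 ≤ (∫ x, v x ^ 2 ∂m) * (t * t) + (2 * ∫ x, u x * v x ∂m) * t
      + ∫ x, u x ^ 2 ∂m := by
    intro t
    have h1 : ∫ x, (u x + t * v x) ^ 2 ∂m = (∫ x, v x ^ 2 ∂m) * (t * t)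
        + (2 * ∫ x, u x * v x ∂m) * t + ∫ x, u x ^ 2 ∂m := by
      have : (fun x => (u x + t * v x) ^ 2)
          = fun x => (v x ^ 2 * (t * t) + (2 * t) * (u x * v x)) + u x ^ 2 := by
        funext x; ring
      have hI : Integrable (fun x => v x ^ 2 * (t * t) + (2 * t) * (u x * v x)) m :=
        (hv.mul_const _).add (huv.const_mul _)
      rw [this, integral_add hI hu,
        integral_add (hv.mul_const _) (huv.const_mul _), integral_mul_const, integral_const_mul]
      ring
    rw [← h1]
    exact integral_nonneg fun x => sq_nonneg _
  have := discrim_le_zero key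
  rw [discrim] at this
  nlinarith

variable [IsFiniteMeasure m]

lemma sq_integral_sq_mul_pow_four_le {f g : X → ℂ} (hf : IsBddMeas f) (hg : IsBddMeas g) :
    (∫ x, ‖f x‖ ^ 2 * ‖g x‖ ^ 4 ∂m) ^ 2
      ≤ (∫ x, ‖g x‖ ^ 2 * ‖f x‖ ^ 4 ∂m) * ∫ x, ‖g x‖ ^ 6 ∂m := by
  have h := sq_integral_mul_le m (u := fun x => ‖f x‖ ^ 2 * ‖g x‖) (v := fun x => ‖g x‖ ^ 3)
    (by simpa [mul_pow, ← pow_mul] using hf.integrable_norm_pow_mul hg m 4 2)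
    (by simpa [← pow_mul] using hg.integrable_norm_pow m 6)
    (by convert hf.integrable_norm_pow_mul hg m 2 4 using 2; ring)
  convert h using 2
  · congr 1; funext x; ring
  · congr 1; funext x; ring
  · congr 1; funext x; ring

lemma sq_integral_pow_three_mul_le {f g : X → ℂ} (hf : IsBddMeas f) (hg : IsBddMeas g) :
    (∫ x, ‖f x‖ ^ 3 * ‖g x‖ ^ 3 ∂m) ^ 2
      ≤ (∫ x, ‖f x‖ ^ 2 * ‖g x‖ ^ 4 ∂m) * ∫ x, ‖g x‖ ^ 2 * ‖f x‖ ^ 4 ∂m := by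
  have h := sq_integral_mul_le m (u := fun x => ‖f x‖ * ‖g x‖ ^ 2) (v := fun x => ‖g x‖ * ‖f x‖ ^ 2)
    (by simpa [mul_pow, ← pow_mul] using hf.integrable_norm_pow_mul hg m 2 4)
    (by simpa [mul_pow, ← pow_mul] using hg.integrable_norm_pow_mul hf m 2 4)
    (by convert hf.integrable_norm_pow_mul hg m 3 3 using 2; ring)
  convert h using 2
  · congr 1; funext x; ring
  · congr 1; funext x; ring
  · congr 1; funext x; ring

lemma integral_sq_mul_pow_four_cube_le {f g : X → ℂ} (hf : IsBddMeas f) (hg : IsBddMeas g) :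
    (∫ x, ‖f x‖ ^ 2 * ‖g x‖ ^ 4 ∂m) ^ 3 ≤ (∫ x, ‖f x‖ ^ 6 ∂m) * (∫ x, ‖g x‖ ^ 6 ∂m) ^ 2 := by
  have h1 := sq_integral_sq_mul_pow_four_le m hf hg
  have h2 := sq_integral_sq_mul_pow_four_le m hg hf
  have nn : ∀ (u v : X → ℂ) (a b : ℕ), 0 ≤ ∫ x, ‖u x‖ ^ a * ‖v x‖ ^ b ∂m := fun u v a b =>
    integral_nonneg fun x => by positivity
  have nn' : ∀ (u : X → ℂ), 0 ≤ ∫ x, ‖u x‖ ^ 6 ∂m := fun u =>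
    integral_nonneg fun x => by positivity
  set p := ∫ x, ‖f x‖ ^ 2 * ‖g x‖ ^ 4 ∂m
  set q := ∫ x, ‖g x‖ ^ 2 * ‖f x‖ ^ 4 ∂m
  set a := ∫ x, ‖f x‖ ^ 6 ∂m
  set b := ∫ x, ‖g x‖ ^ 6 ∂m
  have hp : 0 ≤ p := nn _ _ _ _
  have hq : 0 ≤ q := nn _ _ _ _
  have ha : 0 ≤ a := nn' _
  have hb : 0 ≤ b := nn' _
  rcases hp.eq_or_lt with h0 | h0
  · have : 0 ≤ a * b ^ 2 := by positivity
    rw [← h0]; simpa using this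
  have h3 : p * p ^ 3 ≤ p * (a * b ^ 2) := by
    calc p * p ^ 3 = (p ^ 2) ^ 2 := by ring
      _ ≤ (q * b) ^ 2 := pow_le_pow_left₀ (by positivity) h1 2
      _ = q ^ 2 * b ^ 2 := by ring
      _ ≤ (p * a) * b ^ 2 := mul_le_mul_of_nonneg_right h2 (by positivity)
      _ = _ := by ring
  exact le_of_mul_le_mul_left h3 h0

end Holder

/-- Schur test for a band matrix indexed by integers. -/
lemma sum_sum_near_le (L : ℕ) (Q : Finset ℤ) (a : ℤ → ℝ) (ha0 : ∀ q, 0 ≤ a q) :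
    (∑ q ∈ Q, ∑ q' ∈ Q, if |q - q'| ≤ (L : ℤ) then (a q + a q') / 2 else 0)
      ≤ (2 * L + 1) * ∑ q ∈ Q, a q := by
  have cnt : ∀ q, ((Q.filter fun q' => |q - q'| ≤ (L : ℤ)).card : ℝ) ≤ 2 * L + 1 := by
    intro q
    have : (Q.filter fun q' => |q - q'| ≤ (L : ℤ)) ⊆ Finset.Icc (q - L) (q + L) := by
      intro q' h'
      rw [Finset.mem_filter, abs_le] at h'
      rw [Finset.mem_Icc]; constructor <;> linarith [h'.2.1, h'.2.2]
    have h2 := Finset.card_le_card this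
    rw [Int.card_Icc] at h2
    have : (q + L + 1 - (q - L)).toNat = 2 * L + 1 := by
      have : q + L + 1 - (q - L) = ((2 * L + 1 : ℕ) : ℤ) := by push_cast; ring
      rw [this, Int.toNat_natCast]
    rw [this] at h2
    exact_mod_cast h2
  calc (∑ q ∈ Q, ∑ q' ∈ Q, if |q - q'| ≤ (L : ℤ) then (a q + a q') / 2 else 0)
      = (∑ q ∈ Q, ∑ q' ∈ Q, if |q - q'| ≤ L then a q / 2 else 0)
        + ∑ q ∈ Q, ∑ q' ∈ Q, if |q - q'| ≤ L then a q' / 2 else 0 := by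
        rw [← Finset.sum_add_distrib]
        refine Finset.sum_congr rfl fun q _ => ?_
        rw [← Finset.sum_add_distrib]
        refine Finset.sum_congr rfl fun q' _ => ?_
        split_ifs <;> ring
    _ = 2 * ∑ q ∈ Q, ∑ q' ∈ Q, if |q - q'| ≤ L then a q / 2 else 0 := by
        rw [two_mul]; congr 1
        rw [Finset.sum_comm]
        refine Finset.sum_congr rfl fun q _ => Finset.sum_congr rfl fun q' _ => ?_
        rw [abs_sub_comm]
    _ ≤ 2 * ∑ q ∈ Q, (2 * L + 1) * (a q / 2) := by
        gcongr with q hq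
        rw [← Finset.sum_filter, Finset.sum_const, nsmul_eq_mul]
        exact mul_le_mul_of_nonneg_right (cnt q) (by linarith [ha0 q])
    _ = _ := by
        rw [Finset.mul_sum, Finset.mul_sum]
        refine Finset.sum_congr rfl fun q _ => ?_
        ring

/-- Almost orthogonality: if `G q` and `G q'` are orthogonal whenever `L < |q - q'|`, then the
square norm of the sum is at most `2 L + 1` times the sum of the square norms. -/
lemma integral_norm_sum_sq_le {X : Type} [MeasurableSpace X] (m : Measure X) [IsFiniteMeasure m]
    (L : ℕ) (Q : Finset ℤ) (G : ℤ → X → ℂ) (hG : ∀ q, IsBddMeas (G q))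
    (h0 : ∀ q ∈ Q, ∀ q' ∈ Q, (L : ℤ) < |q - q'| →
      ∫ x, G q x * (starRingEnd ℂ) (G q' x) ∂m = 0) :
    ∫ x, ‖∑ q ∈ Q, G q x‖ ^ 2 ∂m ≤ (2 * L + 1) * ∑ q ∈ Q, ∫ x, ‖G q x‖ ^ 2 ∂m := by
  have e1 : ((∫ x, ‖∑ q ∈ Q, G q x‖ ^ 2 ∂m : ℝ) : ℂ)
      = ∑ q ∈ Q, ∑ q' ∈ Q, ∫ x, G q x * (starRingEnd ℂ) (G q' x) ∂m := by
    rw [← integral_complex_ofReal]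
    have : (fun x => ((‖∑ q ∈ Q, G q x‖ ^ 2 : ℝ) : ℂ))
        = fun x => ∑ q ∈ Q, ∑ q' ∈ Q, G q x * (starRingEnd ℂ) (G q' x) := by
      funext x
      rw [← Finset.sum_mul_sum, ← map_sum, Complex.mul_conj']
      push_cast; rfl
    rw [this, integral_finsetSum _ fun q _ => ?_]
    · refine Finset.sum_congr rfl fun q _ => ?_
      rw [integral_finsetSum _ fun q' _ => ?_]
      exact ((hG q).mul (hG q').conj).integrable m
    · exact integrable_finsetSum _ fun q' _ => ((hG q).mul (hG q').conj).integrable m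
  have e2 : ∫ x, ‖∑ q ∈ Q, G q x‖ ^ 2 ∂m
      ≤ ∑ q ∈ Q, ∑ q' ∈ Q, ‖∫ x, G q x * (starRingEnd ℂ) (G q' x) ∂m‖ := by
    have : ∫ x, ‖∑ q ∈ Q, G q x‖ ^ 2 ∂m = ‖((∫ x, ‖∑ q ∈ Q, G q x‖ ^ 2 ∂m : ℝ) : ℂ)‖ := by
      rw [Complex.norm_real, Real.norm_of_nonneg (integral_nonneg fun x => by positivity)]
    rw [this, e1]
    exact (norm_sum_le _ _).trans (Finset.sum_le_sum fun q _ => norm_sum_le _ _)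
  set a : ℤ → ℝ := fun q => ∫ x, ‖G q x‖ ^ 2 ∂m with ha
  have ha0 : ∀ q, 0 ≤ a q := fun q => integral_nonneg fun x => by positivity
  have e3 : ∀ q ∈ Q, ∀ q' ∈ Q, ‖∫ x, G q x * (starRingEnd ℂ) (G q' x) ∂m‖
      ≤ if |q - q'| ≤ L then (a q + a q') / 2 else 0 := by
    intro q hq q' hq'
    split_ifs with hh
    · refine (norm_integral_le_integral_norm _).trans ?_
      rw [ha]; dsimp only
      rw [← integral_add ((hG q).integrable_norm_pow m 2) ((hG q').integrable_norm_pow m 2),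
        ← integral_div]
      refine integral_mono (((hG q).mul (hG q').conj).integrable m).norm
        ((((hG q).integrable_norm_pow m 2).add ((hG q').integrable_norm_pow m 2)).div_const _)
        fun x => ?_
      simp only [norm_mul, RCLike.norm_conj]
      nlinarith [sq_nonneg (‖G q x‖ - ‖G q' x‖)]
    · rw [h0 q hq q' hq' (not_le.1 hh), norm_zero]
  exact (e2.trans (Finset.sum_le_sum fun q hq => Finset.sum_le_sum fun q' hq' =>
    e3 q hq q' hq')).trans (sum_sum_near_le L Q a ha0)

/-! ### Abstract `ℓ²` decoupling in `L⁶` -/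

section Decoupling

variable {X : Type} [MeasurableSpace X] {ι : Type}

/-- The dyadic cell of height `h` containing the integer position of `i`. -/
def cell (z : ι → ℤ) (h : ℕ) (i : ι) : ℤ := z i / 2 ^ h

lemma cell_zero (z : ι → ℤ) (i : ι) : cell z 0 i = z i := by simp [cell]

lemma cell_add (z : ι → ℤ) (h k : ℕ) (i : ι) : cell z (h + k) i = cell z h i / 2 ^ k := by
  rw [cell, cell, Int.ediv_ediv_of_nonneg (by positivity), pow_add]

/-- The partial sum over `S` of a family of functions. -/
def famSum (e : ι → X → ℂ) (S : Finset ι) (x : X) : ℂ := ∑ i ∈ S, e i x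

/-- The square of the `L⁶` norm of the partial sum over `S`. -/
def sixNormSq (m : Measure X) (e : ι → X → ℂ) (S : Finset ι) : ℝ :=
  (∫ x, ‖famSum e S x‖ ^ 6 ∂m) ^ (3⁻¹ : ℝ)

/-- The sum over positions of the squared `L⁶` norms. -/
def sixNormSqSum (m : Measure X) (e : ι → X → ℂ) (z : ι → ℤ) (S : Finset ι) : ℝ :=
  ∑ ζ ∈ S.image z, sixNormSq m e (S.filter (z · = ζ))

lemma famSum_isBddMeas {e : ι → X → ℂ} (he : ∀ i, IsBddMeas (e i)) (S : Finset ι) :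
    IsBddMeas (famSum e S) := IsBddMeas.sum S he

lemma sixNormSq_nonneg (m : Measure X) (e : ι → X → ℂ) (S : Finset ι) : 0 ≤ sixNormSq m e S :=
  Real.rpow_nonneg (integral_nonneg fun _ => by positivity) _

lemma sixNormSq_pow_three (m : Measure X) (e : ι → X → ℂ) (S : Finset ι) :
    sixNormSq m e S ^ 3 = ∫ x, ‖famSum e S x‖ ^ 6 ∂m := by
  rw [sixNormSq, ← Real.rpow_natCast, ← Real.rpow_mul (integral_nonneg fun _ => by positivity)]
  norm_num

lemma sixNormSqSum_nonneg (m : Measure X) (e : ι → X → ℂ) (z : ι → ℤ) (S : Finset ι) :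
    0 ≤ sixNormSqSum m e z S := Finset.sum_nonneg fun _ _ => sixNormSq_nonneg _ _ _

lemma famSum_eq_sum_filter (e : ι → X → ℂ) (S : Finset ι) (c : ι → ℤ) (x : X) :
    famSum e S x = ∑ q ∈ S.image c, famSum e (S.filter (c · = q)) x :=
  (Finset.sum_fiberwise_of_maps_to (fun _ hi => Finset.mem_image_of_mem c hi) _).symm

/-- Additivity of `sixNormSqSum` over a partition by a function of the position. -/
lemma sixNormSqSum_eq_sum (m : Measure X) (e : ι → X → ℂ) (z : ι → ℤ) (S : Finset ι)
    (c : ι → ℤ) (φ : ℤ → ℤ) (hc : ∀ i, c i = φ (z i)) :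
    sixNormSqSum m e z S = ∑ q ∈ S.image c, sixNormSqSum m e z (S.filter (c · = q)) := by
  unfold sixNormSqSum
  rw [← Finset.sum_fiberwise_of_maps_to (s := S.image z) (t := S.image c) (g := φ)]
  · refine Finset.sum_congr rfl fun q hq => ?_
    have : (S.filter (c · = q)).image z = (S.image z).filter (φ · = q) := by
      ext ζ
      simp only [Finset.mem_image, Finset.mem_filter]
      constructor
      · rintro ⟨i, ⟨hi, rfl⟩, rfl⟩; exact ⟨⟨i, hi, rfl⟩, (hc i).symm⟩
      · rintro ⟨⟨i, hi, rfl⟩, rfl⟩; exact ⟨i, ⟨hi, hc i⟩, rfl⟩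
    rw [this]
    refine Finset.sum_congr rfl fun ζ hζ => ?_
    rw [Finset.mem_filter] at hζ
    congr 1
    ext i
    simp only [Finset.mem_filter]
    constructor
    · rintro ⟨hi, rfl⟩; exact ⟨⟨hi, (hc i).trans hζ.2⟩, rfl⟩
    · rintro ⟨⟨hi, _⟩, h⟩; exact ⟨hi, h⟩
  · intro ζ hζ
    rw [Finset.mem_image] at hζ ⊢
    obtain ⟨i, hi, rfl⟩ := hζ
    exact ⟨i, hi, hc i⟩

lemma sixNormSqSum_eq_sum_cell (m : Measure X) (e : ι → X → ℂ) (z : ι → ℤ) (S : Finset ι)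
    (h : ℕ) : sixNormSqSum m e z S
      = ∑ q ∈ S.image (cell z h), sixNormSqSum m e z (S.filter (cell z h · = q)) :=
  sixNormSqSum_eq_sum m e z S _ (· / 2 ^ h) fun _ => rfl

lemma norm_famSum_pow_le (e : ι → X → ℂ) (S : Finset ι) (c : ι → ℤ) {K : ℝ}
    (hK : ((S.image c).card : ℝ) ≤ K) (k : ℕ) (x : X) :
    ‖famSum e S x‖ ^ (k + 1)
      ≤ K ^ k * ∑ q ∈ S.image c, ‖famSum e (S.filter (c · = q)) x‖ ^ (k + 1) := by
  rw [famSum_eq_sum_filter e S c x]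
  calc _ ≤ (∑ q ∈ S.image c, ‖famSum e (S.filter (c · = q)) x‖) ^ (k + 1) := by
        gcongr; exact norm_sum_le _ _
    _ ≤ _ := pow_sum_le_card_mul_sum_pow (fun _ _ => norm_nonneg _) k
    _ ≤ _ := by gcongr

lemma sum_pow_three_le {κ : Type} (s : Finset κ) (a : κ → ℝ) (ha : ∀ q, 0 ≤ a q) :
    ∑ q ∈ s, a q ^ 3 ≤ (∑ q ∈ s, a q) ^ 3 := by
  calc ∑ q ∈ s, a q ^ 3 = ∑ q ∈ s, a q * a q ^ 2 := by congr 1; funext q; ring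
    _ ≤ ∑ q ∈ s, a q * (∑ q ∈ s, a q) ^ 2 := by
        refine Finset.sum_le_sum fun q hq => mul_le_mul_of_nonneg_left ?_ (ha q)
        exact pow_le_pow_left₀ (ha q) (Finset.single_le_sum (fun q _ => ha q) hq) 2
    _ = _ := by rw [← Finset.sum_mul]; ring

/-- Elementary (lossy) decoupling into `K` pieces. -/
lemma sixNormSq_le_card_sq_mul (m : Measure X) [IsFiniteMeasure m] {e : ι → X → ℂ}
    (he : ∀ i, IsBddMeas (e i)) (S : Finset ι) (c : ι → ℤ) {K : ℝ}
    (hK1 : 1 ≤ K) (hK : ((S.image c).card : ℝ) ≤ K) :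
    sixNormSq m e S ≤ K ^ 2 * ∑ q ∈ S.image c, sixNormSq m e (S.filter (c · = q)) := by
  have hb := fun T => famSum_isBddMeas he T
  have hs : 0 ≤ ∑ q ∈ S.image c, sixNormSq m e (S.filter (c · = q)) :=
    Finset.sum_nonneg fun _ _ => sixNormSq_nonneg _ _ _
  refine le_of_pow_le_pow_left₀ (n := 3) (by norm_num) (by positivity) ?_
  rw [sixNormSq_pow_three]
  calc ∫ x, ‖famSum e S x‖ ^ 6 ∂m
      ≤ ∫ x, K ^ 5 * ∑ q ∈ S.image c, ‖famSum e (S.filter (c · = q)) x‖ ^ 6 ∂m := by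
        refine integral_mono ((hb S).integrable_norm_pow m 6)
          ((integrable_finsetSum _ fun q _ => (hb _).integrable_norm_pow m 6).const_mul _)
          fun x => norm_famSum_pow_le e S c hK 5 x
    _ = K ^ 5 * ∑ q ∈ S.image c, sixNormSq m e (S.filter (c · = q)) ^ 3 := by
        rw [integral_const_mul, integral_finsetSum _ fun q _ => (hb _).integrable_norm_pow m 6]
        simp_rw [sixNormSq_pow_three]
    _ ≤ K ^ 5 * (∑ q ∈ S.image c, sixNormSq m e (S.filter (c · = q))) ^ 3 := by
        gcongr
        exact sum_pow_three_le _ _ fun _ => sixNormSq_nonneg _ _ _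
    _ ≤ K ^ 6 * (∑ q ∈ S.image c, sixNormSq m e (S.filter (c · = q))) ^ 3 := by
        gcongr
        norm_num
    _ = _ := by ring

/-- The separation hypothesis: vanishing of the sixfold correlations forced by the geometry. -/
def Separated (m : Measure X) (e : ι → X → ℂ) (z : ι → ℤ) (L n : ℕ) : Prop :=
  ∀ g h h' : ℕ, g ≤ n → h ≤ g → 2 * h ≤ g + h' → ∀ i i' j₁ j₂ j₃ j₄ : ι,
    (∀ j ∈ ({i', j₁, j₂, j₃, j₄} : Set ι), cell z n j = cell z n i) →
    (∀ j ∈ ({j₂, j₃, j₄} : Set ι), cell z h j = cell z h j₁) →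
    cell z g i' = cell z g i → 2 ≤ |cell z g i - cell z g j₁| →
    |cell z g i - cell z g j₁| ≤ 3 → (L : ℤ) < |cell z h' i - cell z h' i'| →
    ∫ x, (e i x * (e j₁ x * e j₂ x)) * (starRingEnd ℂ) (e i' x * (e j₃ x * e j₄ x)) ∂m = 0

lemma cell_eq_of_le {z : ι → ℤ} {h k : ℕ} (hk : h ≤ k) {i j : ι} (hij : cell z h i = cell z h j) :
    cell z k i = cell z k j := by
  obtain ⟨d, rfl⟩ := Nat.exists_eq_add_of_le hk
  rw [cell_add, cell_add, hij]

lemma Separated.mono {m : Measure X} {e : ι → X → ℂ} {z : ι → ℤ} {L n n' : ℕ}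
    (hs : Separated m e z L n) (hn : n' ≤ n) : Separated m e z L n' := by
  intro g h h' hg hh hh' i i' j₁ j₂ j₃ j₄ hc
  exact hs g h h' (hg.trans hn) hh hh' i i' j₁ j₂ j₃ j₄ fun j hj => cell_eq_of_le hn (hc j hj)

/-- All members of `S` lie in one cell of height `h`. -/
def InCell (z : ι → ℤ) (h : ℕ) (S : Finset ι) (q : ℤ) : Prop := ∀ i ∈ S, cell z h i = q

lemma InCell.filter {z : ι → ℤ} {h : ℕ} {S : Finset ι} {q : ℤ} (hS : InCell z h S q)
    (P : ι → Prop) [DecidablePred P] : InCell z h (S.filter P) q := fun i hi => hS i (Finset.mem_filter.1 hi).1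

lemma InCell.add {z : ι → ℤ} {h : ℕ} {S : Finset ι} {q : ℤ} (hS : InCell z h S q) (k : ℕ) :
    InCell z (h + k) S (q / 2 ^ k) := fun i hi => by rw [cell_add, hS i hi]

lemma inCell_filter (z : ι → ℤ) (h : ℕ) (S : Finset ι) (q : ℤ) :
    InCell z h (S.filter (cell z h · = q)) q := fun _ hi => (Finset.mem_filter.1 hi).2

lemma InCell.card_image_le {z : ι → ℤ} {h k : ℕ} {S : Finset ι} {q : ℤ}
    (hS : InCell z (h + k) S q) : ((S.image (cell z h)).card : ℝ) ≤ 2 ^ k := by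
  have : S.image (cell z h) ⊆ Finset.Ico (q * 2 ^ k) (q * 2 ^ k + 2 ^ k) := by
    intro c hc
    obtain ⟨i, hi, rfl⟩ := Finset.mem_image.1 hc
    have := hS i hi
    rw [cell_add] at this
    have h2 : (0 : ℤ) < 2 ^ k := by positivity
    have h3 := Int.emod_nonneg (cell z h i) h2.ne'
    have h4 := Int.emod_lt_of_pos (cell z h i) h2
    have h5 := Int.mul_ediv_add_emod (cell z h i) (2 ^ k)
    rw [this] at h5
    rw [Finset.mem_Ico]
    constructor <;> nlinarith
  have h2 := Finset.card_le_card this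
  rw [Int.card_Ico] at h2
  have h3 : (q * 2 ^ k + 2 ^ k - q * 2 ^ k : ℤ).toNat = 2 ^ k := by
    have : (q * 2 ^ k + 2 ^ k - q * 2 ^ k : ℤ) = ((2 ^ k : ℕ) : ℤ) := by push_cast; ring
    rw [this, Int.toNat_natCast]
  rw [h3] at h2
  exact_mod_cast h2

/-- The two-scale almost orthogonality estimate driving the iteration. -/
lemma Separated.integral_le {m : Measure X} [IsFiniteMeasure m] {e : ι → X → ℂ} {z : ι → ℤ}
    {L n : ℕ} (he : ∀ i, IsBddMeas (e i)) (hs : Separated m e z L n) {g h h' : ℕ} (hg : g ≤ n)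
    (hh : h ≤ g) (hh' : 2 * h ≤ g + h') {I J : Finset ι} {q q' p r : ℤ}
    (hIn : InCell z n I p) (hJn : InCell z n J p) (hI : InCell z g I q) (hJ : InCell z g J q')
    (h2 : 2 ≤ |q - q'|) (h3 : |q - q'| ≤ 3) (hJh : InCell z h J r) :
    ∫ x, ‖famSum e I x‖ ^ 2 * ‖famSum e J x‖ ^ 4 ∂m
      ≤ (2 * L + 1) * ∑ c ∈ I.image (cell z h'),
        ∫ x, ‖famSum e (I.filter (cell z h' · = c)) x‖ ^ 2 * ‖famSum e J x‖ ^ 4 ∂m := by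
  have hb := fun T => famSum_isBddMeas he T
  set G : ℤ → X → ℂ := fun c x => famSum e (I.filter (cell z h' · = c)) x
    * (famSum e J x * famSum e J x) with hG
  have hGb : ∀ c, IsBddMeas (G c) := fun c => (hb _).mul ((hb _).mul (hb _))
  have key := integral_norm_sum_sq_le m L (I.image (cell z h')) G hGb ?_
  · convert key using 2
    · funext x
      rw [hG]; dsimp only
      rw [← Finset.sum_mul, ← famSum_eq_sum_filter, norm_mul, norm_mul]; ring
    · refine Finset.sum_congr rfl fun c _ => ?_
      congr 1; funext x
      rw [hG]; dsimp only
      rw [norm_mul, norm_mul]; ring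
  · intro c _ c' _ hcc
    have hexp : (fun x => G c x * (starRingEnd ℂ) (G c' x)) = fun x =>
        ∑ i ∈ I.filter (cell z h' · = c), ∑ j₁ ∈ J, ∑ j₂ ∈ J,
          ∑ i' ∈ I.filter (cell z h' · = c'), ∑ j₃ ∈ J, ∑ j₄ ∈ J,
          (e i x * (e j₁ x * e j₂ x)) * (starRingEnd ℂ) (e i' x * (e j₃ x * e j₄ x)) := by
      funext x
      simp only [hG, famSum, ← Finset.mul_sum, ← Finset.sum_mul, map_mul, map_sum]
    have hInt : ∀ i j₁ j₂ i' j₃ j₄ : ι, IsBddMeas (fun x =>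
        (e i x * (e j₁ x * e j₂ x)) * (starRingEnd ℂ) (e i' x * (e j₃ x * e j₄ x))) :=
      fun i j₁ j₂ i' j₃ j₄ => ((he i).mul ((he j₁).mul (he j₂))).mul
        ((he i').mul ((he j₃).mul (he j₄))).conj
    rw [hexp]
    rw [integral_finsetSum _ fun i _ => IsBddMeas.integrable (IsBddMeas.sum _ fun _ =>
      IsBddMeas.sum _ fun _ => IsBddMeas.sum _ fun _ => IsBddMeas.sum _ fun _ =>
      IsBddMeas.sum _ fun _ => hInt _ _ _ _ _ _) m]
    refine Finset.sum_eq_zero fun i hi => ?_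
    rw [integral_finsetSum _ fun i _ => IsBddMeas.integrable (IsBddMeas.sum _ fun _ =>
      IsBddMeas.sum _ fun _ => IsBddMeas.sum _ fun _ => IsBddMeas.sum _ fun _ =>
      hInt _ _ _ _ _ _) m]
    refine Finset.sum_eq_zero fun j₁ hj₁ => ?_
    rw [integral_finsetSum _ fun i _ => IsBddMeas.integrable (IsBddMeas.sum _ fun _ =>
      IsBddMeas.sum _ fun _ => IsBddMeas.sum _ fun _ => hInt _ _ _ _ _ _) m]
    refine Finset.sum_eq_zero fun j₂ hj₂ => ?_
    rw [integral_finsetSum _ fun i _ => IsBddMeas.integrable (IsBddMeas.sum _ fun _ =>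
      IsBddMeas.sum _ fun _ => hInt _ _ _ _ _ _) m]
    refine Finset.sum_eq_zero fun i' hi' => ?_
    rw [integral_finsetSum _ fun i _ => IsBddMeas.integrable (IsBddMeas.sum _ fun _ =>
      hInt _ _ _ _ _ _) m]
    refine Finset.sum_eq_zero fun j₃ hj₃ => ?_
    rw [integral_finsetSum _ fun i _ => IsBddMeas.integrable (hInt _ _ _ _ _ _) m]
    refine Finset.sum_eq_zero fun j₄ hj₄ => ?_
    rw [Finset.mem_filter] at hi hi'
    refine hs g h h' hg hh hh' i i' j₁ j₂ j₃ j₄ ?_ ?_ ?_ ?_ ?_ ?_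
    · rintro j (rfl | rfl | rfl | rfl | rfl)
      · rw [hIn _ hi'.1, hIn _ hi.1]
      all_goals rw [hJn _ ‹_›, hIn _ hi.1]
    · rintro j (rfl | rfl | rfl) <;> rw [hJh _ ‹_›, hJh _ hj₁]
    · rw [hI _ hi'.1, hI _ hi.1]
    · rwa [hI _ hi.1, hJ _ hj₁]
    · rwa [hI _ hi.1, hJ _ hj₁]
    · rwa [hi.2, hi'.2]

end Decoupling

section Bilinear

variable {X : Type} [MeasurableSpace X] {ι : Type} {m : Measure X} [IsFiniteMeasure m]
  {e : ι → X → ℂ} {z : ι → ℤ} {L n : ℕ} {C η : ℝ}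

/-- `ℓ²` decoupling with constant `C 2 ^ (η h)` at all heights `h ≤ n`. -/
def DecouplesBelow (m : Measure X) (e : ι → X → ℂ) (z : ι → ℤ) (C η : ℝ) (n : ℕ) : Prop :=
  ∀ h ≤ n, ∀ (S : Finset ι) (q : ℤ), InCell z h S q →
    sixNormSq m e S ≤ C * 2 ^ (η * h) * sixNormSqSum m e z S

/-- Iterated bilinear estimate: the larger `N` the smaller the bilinear constant. -/
lemma integral_sq_mul_pow_four_le (he : ∀ i, IsBddMeas (e i)) (hs : Separated m e z L n)
    (hC : 0 ≤ C) (hD : DecouplesBelow m e z C η n) (N : ℕ) :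
    ∀ (g b : ℕ), 2 ^ N * b ≤ g → g ≤ n → ∀ (I J : Finset ι) (p q q' r : ℤ),
    InCell z n I p → InCell z n J p → InCell z g I q → InCell z g J q' → 2 ≤ |q - q'| →
    |q - q'| ≤ 3 → InCell z (g - b) J r →
    ∫ x, ‖famSum e I x‖ ^ 2 * ‖famSum e J x‖ ^ 4 ∂m
      ≤ (2 * L + 1) ^ 2 * C ^ 3 * 2 ^ (η * (3 * g - 3 * N / 2 * b))
        * (sixNormSqSum m e z I * sixNormSqSum m e z J ^ 2) := by
  have hb := fun T => famSum_isBddMeas he T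
  have hA := sixNormSqSum_nonneg m e z
  have hN0 := sixNormSq_nonneg m e
  induction N with
  | zero =>
    intro g b hbg hg I J p q q' r hIp hJp hI hJ _ _ hJr
    have h1 := integral_sq_mul_pow_four_cube_le m (hb I) (hb J)
    rw [← sixNormSq_pow_three, ← sixNormSq_pow_three] at h1
    have h2 : ∫ x, ‖famSum e I x‖ ^ 2 * ‖famSum e J x‖ ^ 4 ∂m
        ≤ sixNormSq m e I * sixNormSq m e J ^ 2 := by
      refine le_of_pow_le_pow_left₀ (n := 3) (by norm_num)
        (mul_nonneg (hN0 _) (pow_nonneg (hN0 _) _)) (h1.trans (le_of_eq (by ring)))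
    have hL : (1 : ℝ) ≤ (2 * L + 1) ^ 2 := by
      have : (0 : ℝ) ≤ L := L.cast_nonneg
      nlinarith
    have e1 : (2 : ℝ) ^ (η * (3 * g - 3 * (0 : ℕ) / 2 * b)) = (2 ^ (η * g)) ^ 3 := by
      rw [← Real.rpow_natCast, ← Real.rpow_mul (by norm_num)]; congr 1; push_cast; ring
    rw [e1]
    have h4 := hA I
    have h5 := hA J
    calc _ ≤ _ := h2
      _ ≤ (C * 2 ^ (η * g) * sixNormSqSum m e z I) * (C * 2 ^ (η * g) * sixNormSqSum m e z J) ^ 2 :=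
          mul_le_mul (hD g hg I q hI) (pow_le_pow_left₀ (hN0 _) (hD g hg J q' hJ) 2)
            (pow_nonneg (hN0 _) _) (by positivity)
      _ = 1 * (C ^ 3 * (2 ^ (η * g)) ^ 3
        * (sixNormSqSum m e z I * sixNormSqSum m e z J ^ 2)) := by ring
      _ ≤ (2 * L + 1) ^ 2 * (C ^ 3 * (2 ^ (η * g)) ^ 3
        * (sixNormSqSum m e z I * sixNormSqSum m e z J ^ 2)) :=
          mul_le_mul_of_nonneg_right hL (by positivity)
      _ = _ := by ring
  | succ N ih =>
    intro g b hbg hg I J p q q' r hIp hJp hI hJ hq2 hq3 hJr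
    have hbg2 : 2 ^ N * (2 * b) ≤ g := by rw [← mul_assoc, ← pow_succ]; exact hbg
    have h2b : 2 * b ≤ g := le_trans (Nat.le_mul_of_pos_left _ (by positivity)) hbg2
    have key := hs.integral_le he hg (Nat.sub_le g b) (h' := g - 2 * b) (by omega) hIp hJp hI hJ
      hq2 hq3 hJr
    refine key.trans ?_
    have hIsum := sixNormSqSum_eq_sum_cell m e z I (g - 2 * b)
    set K : ℝ := (2 * L + 1) * C ^ 3 * 2 ^ (η * (3 * g - 3 * (N + 1 : ℕ) / 2 * b)) with hK
    have hJ0 := hA J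
    have each : ∀ c ∈ I.image (cell z (g - 2 * b)),
        ∫ x, ‖famSum e (I.filter (cell z (g - 2 * b) · = c)) x‖ ^ 2 * ‖famSum e J x‖ ^ 4 ∂m
        ≤ K * (sixNormSqSum m e z (I.filter (cell z (g - 2 * b) · = c))
          * sixNormSqSum m e z J ^ 2) := by
      intro c _
      set I' := I.filter (cell z (g - 2 * b) · = c)
      have h1 := sq_integral_sq_mul_pow_four_le m (hb I') (hb J)
      have h2 := ih g (2 * b) hbg2 hg J I' p q' q c hJp (hIp.filter _) hJ (hI.filter _)
        (by rwa [abs_sub_comm]) (by rwa [abs_sub_comm]) (inCell_filter _ _ _ _)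
      have h3 := hD (g - b) ((Nat.sub_le g b).trans hg) J r hJr
      rw [← sixNormSq_pow_three] at h1
      have hI0 := hA I'
      refine le_of_pow_le_pow_left₀ (n := 2) (by norm_num) (by positivity) ?_
      refine h1.trans ?_
      refine (mul_le_mul h2 (pow_le_pow_left₀ (hN0 _) h3 3) (pow_nonneg (hN0 _) _)
        (by positivity)).trans (le_of_eq ?_)
      have e2 : ((2 : ℝ) ^ (η * (3 * g - 3 * (N + 1 : ℕ) / 2 * b))) ^ 2
          = 2 ^ (η * (3 * g - 3 * N / 2 * (2 * b : ℕ))) * (2 ^ (η * (g - b : ℕ))) ^ 3 := by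
        rw [← Real.rpow_natCast, ← Real.rpow_natCast, ← Real.rpow_mul (by norm_num),
          ← Real.rpow_mul (by norm_num), ← Real.rpow_add (by norm_num)]
        congr 1
        rw [Nat.cast_sub (by omega)]
        push_cast; ring
      rw [hK]
      linear_combination (-(2 * (L : ℝ) + 1) ^ 2 * C ^ 6 * sixNormSqSum m e z J ^ 4
        * sixNormSqSum m e z I' ^ 2) * e2
    calc _ ≤ (2 * (L : ℝ) + 1) * ∑ c ∈ I.image (cell z (g - 2 * b)),
          K * (sixNormSqSum m e z (I.filter (cell z (g - 2 * b) · = c))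
          * sixNormSqSum m e z J ^ 2) := by
            gcongr with c hc; exact each c hc
      _ = _ := by
        rw [← Finset.mul_sum, ← Finset.sum_mul, ← hIsum, hK]; ring

/-- Bilinear estimate for two cells at distance comparable to their size. -/
lemma integral_pow_three_mul_pow_three_le (he : ∀ i, IsBddMeas (e i))
    (hs : Separated m e z L n) (hC : 0 ≤ C) (hD : DecouplesBelow m e z C η n)
    {N g b : ℕ} (hbg : 2 ^ N * b ≤ g) (hg : g ≤ n) {I J : Finset ι} {p q q' : ℤ}
    (hIp : InCell z n I p) (hJp : InCell z n J p) (hI : InCell z g I q) (hJ : InCell z g J q')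
    (hq2 : 2 ≤ |q - q'|) (hq3 : |q - q'| ≤ 3) :
    (∫ x, ‖famSum e I x‖ ^ 3 * ‖famSum e J x‖ ^ 3 ∂m) ^ 2
      ≤ (((2 * L + 1) * C * 2 ^ b * 2 ^ (η * (g - N / 2 * b))) ^ 3) ^ 2
        * (sixNormSqSum m e z I * sixNormSqSum m e z J) ^ 3 := by
  have hb := fun T => famSum_isBddMeas he T
  have hA := sixNormSqSum_nonneg m e z
  have hL0 : (0 : ℝ) ≤ L := L.cast_nonneg
  have hb' : b ≤ g := le_trans (Nat.le_mul_of_pos_left _ (by positivity)) hbg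
  set Y : ℝ := ((2 * L + 1) * C * 2 ^ b * 2 ^ (η * (g - N / 2 * b))) ^ 3 with hY
  have hY0 : 0 ≤ Y := by positivity
  have half : ∀ (I J : Finset ι) (q q' : ℤ), InCell z n I p → InCell z n J p → InCell z g I q →
      InCell z g J q' → 2 ≤ |q - q'| → |q - q'| ≤ 3 →
      ∫ x, ‖famSum e I x‖ ^ 2 * ‖famSum e J x‖ ^ 4 ∂m
        ≤ Y * (sixNormSqSum m e z I * sixNormSqSum m e z J ^ 2) := by
    intro I J q q' hIp hJp hI hJ hq2 hq3
    have hJ' : InCell z (g - b + b) J q' := by rwa [Nat.sub_add_cancel hb']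
    have hI0 := hA I
    set K : ℝ := (2 * L + 1) ^ 2 * C ^ 3 * 2 ^ (η * (3 * g - 3 * N / 2 * b)) with hK
    set J' : ℤ → Finset ι := fun c => J.filter (cell z (g - b) · = c) with hJ'd
    calc ∫ x, ‖famSum e I x‖ ^ 2 * ‖famSum e J x‖ ^ 4 ∂m
        ≤ ∫ x, (2 ^ b) ^ 3 * ∑ c ∈ J.image (cell z (g - b)),
            ‖famSum e I x‖ ^ 2 * ‖famSum e (J' c) x‖ ^ 4 ∂m := by
          refine integral_mono ((hb I).integrable_norm_pow_mul (hb J) m 2 4)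
            ((integrable_finsetSum _ fun c _ =>
              (hb I).integrable_norm_pow_mul (hb (J' c)) m 2 4).const_mul _) fun x => ?_
          dsimp only
          rw [← Finset.mul_sum, mul_left_comm]
          exact mul_le_mul_of_nonneg_left (norm_famSum_pow_le e J _ hJ'.card_image_le 3 x)
            (by positivity)
      _ = (2 ^ b) ^ 3 * ∑ c ∈ J.image (cell z (g - b)),
            ∫ x, ‖famSum e I x‖ ^ 2 * ‖famSum e (J' c) x‖ ^ 4 ∂m := by
          rw [integral_const_mul, integral_finsetSum _ fun c _ =>
              (hb I).integrable_norm_pow_mul (hb (J' c)) m 2 4]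
      _ ≤ (2 ^ b) ^ 3 * ∑ c ∈ J.image (cell z (g - b)),
            K * (sixNormSqSum m e z I * sixNormSqSum m e z (J' c) ^ 2) := by
          gcongr with c hc
          exact integral_sq_mul_pow_four_le he hs hC hD N g b hbg hg I (J' c) p q q' c hIp
            (hJp.filter _) hI (hJ.filter _) hq2 hq3 (inCell_filter _ _ _ _)
      _ = (2 ^ b) ^ 3 * (K * (sixNormSqSum m e z I
            * ∑ c ∈ J.image (cell z (g - b)), sixNormSqSum m e z (J' c) ^ 2)) := by
          rw [← Finset.mul_sum, ← Finset.mul_sum]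
      _ ≤ (2 ^ b) ^ 3 * (K * (sixNormSqSum m e z I * sixNormSqSum m e z J ^ 2)) := by
          have : ∑ c ∈ J.image (cell z (g - b)), sixNormSqSum m e z (J' c) ^ 2
              ≤ sixNormSqSum m e z J ^ 2 := by
            rw [sixNormSqSum_eq_sum_cell m e z J (g - b)]
            rw [sq, Finset.sum_mul]
            refine Finset.sum_le_sum fun c hc => ?_
            rw [sq]
            exact mul_le_mul_of_nonneg_left
              (Finset.single_le_sum (f := fun c => sixNormSqSum m e z (J' c))
                (fun c _ => hA _) hc) (hA _)
          gcongr
      _ = ((2 ^ b) ^ 3 * K) * (sixNormSqSum m e z I * sixNormSqSum m e z J ^ 2) := by ring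
      _ ≤ _ := by
          have hJ0 := hA J
          refine mul_le_mul_of_nonneg_right ?_ (by positivity)
          have e1 : (2 : ℝ) ^ (η * (3 * g - 3 * N / 2 * b)) = (2 ^ (η * (g - N / 2 * b))) ^ 3 := by
            rw [← Real.rpow_natCast, ← Real.rpow_mul (by norm_num)]; congr 1; push_cast; ring
          have : (2 * (L : ℝ) + 1) ^ 2 ≤ (2 * L + 1) ^ 3 :=
            pow_le_pow_right₀ (by linarith) (by norm_num)
          calc (2 ^ b : ℝ) ^ 3 * K
              = (2 * L + 1) ^ 2 * ((2 ^ b) ^ 3 * C ^ 3 * (2 ^ (η * (g - N / 2 * b))) ^ 3) := by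
                rw [hK, e1]; ring
            _ ≤ (2 * L + 1) ^ 3 * ((2 ^ b) ^ 3 * C ^ 3 * (2 ^ (η * (g - N / 2 * b))) ^ 3) :=
                mul_le_mul_of_nonneg_right this (by positivity)
            _ = Y := by rw [hY]; ring
  have h1 := half I J q q' hIp hJp hI hJ hq2 hq3
  have h2 := half J I q' q hJp hIp hJ hI (by rwa [abs_sub_comm]) (by rwa [abs_sub_comm])
  have hI0 := hA I
  have hJ0 := hA J
  calc _ ≤ _ := sq_integral_pow_three_mul_le m (hb I) (hb J)
    _ ≤ (Y * (sixNormSqSum m e z I * sixNormSqSum m e z J ^ 2))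
        * (Y * (sixNormSqSum m e z J * sixNormSqSum m e z I ^ 2)) :=
        mul_le_mul h1 h2 (integral_nonneg fun x => by positivity) (by positivity)
    _ = _ := by ring

end Bilinear

section Whitney

variable {X : Type} [MeasurableSpace X] {ι : Type} {m : Measure X} [IsFiniteMeasure m]
  {e : ι → X → ℂ} {z : ι → ℤ} {L n : ℕ} {C η : ℝ}

lemma isBddMeas_zero : IsBddMeas (fun _ : X => (0 : ℂ)) := ⟨measurable_const, 0, by simp⟩

lemma IsBddMeas.memLp {f : X → ℂ} (hf : IsBddMeas f) (p : ℝ≥0∞) : MemLp f p m := by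
  obtain ⟨hf, B, hB⟩ := hf
  exact MemLp.of_bound hf.aestronglyMeasurable B (Filter.Eventually.of_forall hB)

lemma IsBddMeas.lpNorm_three_pow {f : X → ℂ} (hf : IsBddMeas f) :
    lpNorm f 3 m ^ 3 = ∫ x, ‖f x‖ ^ 3 ∂m := by
  rw [lpNorm_eq_integral_norm_rpow_toReal (by norm_num) (by norm_num) hf.1.aestronglyMeasurable,
    ← Real.rpow_natCast, ← Real.rpow_mul (integral_nonneg fun _ => by positivity)]
  norm_num

/-- `L³` bound for the part of `F ^ 2` coming from pairs of cells satisfying a relation `R`. -/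
lemma lpNorm_three_pairs_le (he : ∀ i, IsBddMeas (e i)) (S : Finset ι) (c : ι → ℤ)
    (R : ℤ → ℤ → Prop) [∀ q q', Decidable (R q q')] (k : ℕ) (hR : ∀ q q', R q q' → |q - q'| ≤ (k : ℤ)) (a : ℤ → ℝ)
    (ha : ∀ q, 0 ≤ a q) (Y : ℝ) (hY : 0 ≤ Y)
    (hq : ∀ q ∈ S.image c, ∀ q' ∈ S.image c, R q q' →
      (∫ x, ‖famSum e (S.filter (c · = q)) x‖ ^ 3 * ‖famSum e (S.filter (c · = q')) x‖ ^ 3 ∂m) ^ 2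
        ≤ (Y ^ 3) ^ 2 * (a q * a q') ^ 3) :
    lpNorm (fun x => ∑ i ∈ S, ∑ j ∈ S, if R (c i) (c j) then e i x * e j x else 0) 3 m
      ≤ (2 * k + 1) * Y * ∑ q ∈ S.image c, a q := by
  have hb := fun T => famSum_isBddMeas he T
  set G : ℤ → ℤ → X → ℂ := fun q q' x => if R q q' then
    famSum e (S.filter (c · = q)) x * famSum e (S.filter (c · = q')) x else 0 with hG
  have hGb : ∀ q q', IsBddMeas (G q q') := by
    intro q q'
    by_cases h : R q q'
    · simpa [hG, h] using (hb _).mul (hb _)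
    · simpa [hG, h] using isBddMeas_zero
  have e1 : (fun x => ∑ i ∈ S, ∑ j ∈ S, if R (c i) (c j) then e i x * e j x else 0)
      = ∑ q ∈ S.image c, ∑ q' ∈ S.image c, G q q' := by
    funext x
    rw [Finset.sum_apply]
    rw [← Finset.sum_fiberwise_of_maps_to
      (g := c) (t := S.image c) (fun _ hi => Finset.mem_image_of_mem c hi)]
    refine Finset.sum_congr rfl fun q _ => ?_
    rw [Finset.sum_apply, Finset.sum_congr rfl fun i _ => (Finset.sum_fiberwise_of_maps_to
      (g := c) (t := S.image c) (s := S) (fun _ hi => Finset.mem_image_of_mem c hi) _).symm,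
      Finset.sum_comm]
    refine Finset.sum_congr rfl fun q' _ => ?_
    rw [hG]; dsimp only
    split_ifs with h
    · rw [famSum, famSum, Finset.sum_mul_sum]
      refine Finset.sum_congr rfl fun i hi => Finset.sum_congr rfl fun j hj => ?_
      rw [(Finset.mem_filter.1 hi).2, (Finset.mem_filter.1 hj).2, if_pos h]
    · refine Finset.sum_eq_zero fun i hi => Finset.sum_eq_zero fun j hj => ?_
      rw [(Finset.mem_filter.1 hi).2, (Finset.mem_filter.1 hj).2, if_neg h]
  have each : ∀ q ∈ S.image c, ∀ q' ∈ S.image c,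
      lpNorm (G q q') 3 m ≤ Y * if |q - q'| ≤ (k : ℤ) then (a q + a q') / 2 else 0 := by
    intro q hq1 q' hq1'
    have hn : 0 ≤ Y * if |q - q'| ≤ (k : ℤ) then (a q + a q') / 2 else 0 := by
      have := ha q; have := ha q'
      split_ifs <;> positivity
    by_cases h : R q q'
    · rw [if_pos (hR _ _ h)] at hn ⊢
      refine le_of_pow_le_pow_left₀ (n := 6) (by norm_num) hn ?_
      have h1 : lpNorm (G q q') 3 m ^ 6 = (∫ x, ‖famSum e (S.filter (c · = q)) x‖ ^ 3
          * ‖famSum e (S.filter (c · = q')) x‖ ^ 3 ∂m) ^ 2 := by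
        rw [show lpNorm (G q q') 3 m ^ 6 = (lpNorm (G q q') 3 m ^ 3) ^ 2 by ring,
          (hGb q q').lpNorm_three_pow]
        congr 2; funext x
        simp [hG, h, mul_pow]
      rw [h1]
      refine (hq q hq1 q' hq1' h).trans ?_
      have h2 : a q * a q' ≤ ((a q + a q') / 2) ^ 2 := by nlinarith [sq_nonneg (a q - a q')]
      calc (Y ^ 3) ^ 2 * (a q * a q') ^ 3 ≤ (Y ^ 3) ^ 2 * (((a q + a q') / 2) ^ 2) ^ 3 :=
            mul_le_mul_of_nonneg_left (pow_le_pow_left₀ (mul_nonneg (ha _) (ha _)) h2 3)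
              (by positivity)
        _ = _ := by ring
    · refine le_trans (le_of_eq ?_) hn
      have : G q q' = 0 := by funext x; simp [hG, h]
      rw [this, lpNorm_zero]
  rw [e1]
  have hmem : ∀ q q', MemLp (G q q') 3 m := fun q q' => (hGb q q').memLp 3
  calc _ ≤ ∑ q ∈ S.image c, lpNorm (∑ q' ∈ S.image c, G q q') 3 m :=
        lpNorm_sum_le (fun q _ => memLp_finsetSum' _ fun q' _ => hmem q q') (by norm_num)
    _ ≤ ∑ q ∈ S.image c, ∑ q' ∈ S.image c, lpNorm (G q q') 3 m :=
        Finset.sum_le_sum fun q _ => lpNorm_sum_le (fun q' _ => hmem q q') (by norm_num)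
    _ ≤ ∑ q ∈ S.image c, ∑ q' ∈ S.image c,
          Y * if |q - q'| ≤ (k : ℤ) then (a q + a q') / 2 else 0 :=
        Finset.sum_le_sum fun q hq => Finset.sum_le_sum fun q' hq' => each q hq q' hq'
    _ = Y * ∑ q ∈ S.image c, ∑ q' ∈ S.image c,
          if |q - q'| ≤ (k : ℤ) then (a q + a q') / 2 else 0 := by
        simp_rw [Finset.mul_sum]
    _ ≤ Y * ((2 * k + 1) * ∑ q ∈ S.image c, a q) :=
        mul_le_mul_of_nonneg_left (sum_sum_near_le k _ a ha) hY
    _ = _ := by ring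

/-- The part of `F ^ 2` coming from pairs whose cells of height `h` are equal or adjacent. -/
def nearPairs (e : ι → X → ℂ) (z : ι → ℤ) (S : Finset ι) (h : ℕ) (x : X) : ℂ :=
  ∑ i ∈ S, ∑ j ∈ S, if |cell z h i - cell z h j| ≤ 1 then e i x * e j x else 0

/-- The part of `F ^ 2` coming from pairs whose cells of height `h` are not adjacent, but whose
parents are. -/
def whitneyPairs (e : ι → X → ℂ) (z : ι → ℤ) (S : Finset ι) (h : ℕ) (x : X) : ℂ :=
  ∑ i ∈ S, ∑ j ∈ S, if |cell z h i / 2 - cell z h j / 2| ≤ 1 ∧ 2 ≤ |cell z h i - cell z h j|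
    then e i x * e j x else 0

lemma nearPairs_succ (e : ι → X → ℂ) (z : ι → ℤ) (S : Finset ι) (h : ℕ) :
    nearPairs e z S (h + 1) = nearPairs e z S h + whitneyPairs e z S h := by
  funext x
  simp only [nearPairs, whitneyPairs, Pi.add_apply, ← Finset.sum_add_distrib]
  refine Finset.sum_congr rfl fun i _ => Finset.sum_congr rfl fun j _ => ?_
  rw [cell_add, cell_add, pow_one]
  generalize cell z h i = u
  generalize cell z h j = v
  have h1 : |u - v| ≤ 1 → |u / 2 - v / 2| ≤ 1 := by intro h; rw [abs_le] at *; omega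
  by_cases h2 : |u - v| ≤ 1
  · rw [if_pos (h1 h2), if_pos h2, if_neg (by omega), add_zero]
  · rw [if_neg h2, zero_add]
    congr 1
    simp only [eq_iff_iff]
    exact ⟨fun h => ⟨h, by omega⟩, fun h => h.1⟩

/-- One step of the bootstrap. -/
lemma sixNormSq_le_of_decouplesBelow (he : ∀ i, IsBddMeas (e i)) (hs : Separated m e z L n)
    (hC : 0 ≤ C) (hD : DecouplesBelow m e z C η n) (N : ℕ) (b : ℕ → ℕ)
    (hbg : ∀ g, 2 ^ N * b g ≤ g) {S : Finset ι} {p : ℤ} (hS : InCell z n S p) :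
    sixNormSq m e S ≤ (3 + 7 * ∑ g ∈ Finset.range n,
      (2 * L + 1) * C * 2 ^ b g * 2 ^ (η * (g - N / 2 * b g))) * sixNormSqSum m e z S := by
  have hb := fun T => famSum_isBddMeas he T
  have hA := sixNormSqSum_nonneg m e z
  have hnear0 : lpNorm (nearPairs e z S 0) 3 m ≤ 3 * sixNormSqSum m e z S := by
    have := lpNorm_three_pairs_le (m := m) he S (cell z 0) (fun q q' => |q - q'| ≤ 1) 1
      (fun q q' h => by exact_mod_cast h) (fun q => sixNormSq m e (S.filter (cell z 0 · = q)))
      (fun q => sixNormSq_nonneg _ _ _) 1 (by norm_num) ?_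
    · refine this.trans (le_of_eq ?_)
      norm_num [sixNormSqSum, show cell z 0 = z from funext (cell_zero z)]
    · intro q _ q' _ _
      set I := S.filter (cell z 0 · = q)
      set J := S.filter (cell z 0 · = q')
      rw [mul_pow, sixNormSq_pow_three, sixNormSq_pow_three]
      have := sq_integral_mul_le m (u := fun x => ‖famSum e I x‖ ^ 3)
        (v := fun x => ‖famSum e J x‖ ^ 3)
        (by simpa [← pow_mul] using (hb I).integrable_norm_pow m 6)
        (by simpa [← pow_mul] using (hb J).integrable_norm_pow m 6)
        ((hb I).integrable_norm_pow_mul (hb J) m 3 3)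
      simpa [← pow_mul] using this
  have hwhit : ∀ g < n, lpNorm (whitneyPairs e z S g) 3 m
      ≤ 7 * ((2 * L + 1) * C * 2 ^ b g * 2 ^ (η * (g - N / 2 * b g))) * sixNormSqSum m e z S := by
    intro g hg
    have := lpNorm_three_pairs_le (m := m) he S (cell z g)
      (fun q q' => |q / 2 - q' / 2| ≤ 1 ∧ 2 ≤ |q - q'|) 3
      (fun q q' h => by have := h.1; rw [abs_le] at *; push_cast; omega)
      (fun q => sixNormSqSum m e z (S.filter (cell z g · = q)))
      (fun q => hA _) ((2 * L + 1) * C * 2 ^ b g * 2 ^ (η * (g - N / 2 * b g)))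
      (by positivity) ?_
    · refine this.trans (le_of_eq ?_)
      rw [← sixNormSqSum_eq_sum_cell]
      push_cast; ring
    · intro q _ q' _ h
      refine integral_pow_three_mul_pow_three_le he hs hC hD (hbg g) hg.le (hS.filter _)
        (hS.filter _) (inCell_filter _ _ _ _) (inCell_filter _ _ _ _) h.2 ?_
      have := h.1; rw [abs_le] at *; omega
  have hnearb : ∀ h, IsBddMeas (nearPairs e z S h) := fun h => by
    refine IsBddMeas.sum S fun i => IsBddMeas.sum S fun j => ?_
    by_cases hh : |cell z h i - cell z h j| ≤ 1
    · simpa [hh] using (he i).mul (he j)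
    · simpa [hh] using isBddMeas_zero
  have hnear : ∀ h ≤ n, lpNorm (nearPairs e z S h) 3 m ≤ (3 + 7 * ∑ g ∈ Finset.range h,
      (2 * L + 1) * C * 2 ^ b g * 2 ^ (η * (g - N / 2 * b g))) * sixNormSqSum m e z S := by
    intro h
    induction h with
    | zero => intro _; simpa using hnear0
    | succ h ih =>
      intro hh
      rw [nearPairs_succ, Finset.sum_range_succ]
      refine (lpNorm_add_le ((hnearb h).memLp 3) (by norm_num)).trans ?_
      have h1 := ih (by omega)
      have h2 := hwhit h (by omega)
      linarith
  have hF : nearPairs e z S n = fun x => famSum e S x * famSum e S x := by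
    funext x
    rw [nearPairs, famSum, Finset.sum_mul_sum]
    refine Finset.sum_congr rfl fun i hi => Finset.sum_congr rfl fun j hj => ?_
    rw [hS i hi, hS j hj, if_pos (by simp)]
  have hN : lpNorm (nearPairs e z S n) 3 m = sixNormSq m e S := by
    refine (pow_left_inj₀ lpNorm_nonneg (sixNormSq_nonneg _ _ _) three_ne_zero).1 ?_
    rw [(hnearb n).lpNorm_three_pow, sixNormSq_pow_three, hF]
    congr 1; funext x
    rw [norm_mul]; ring
  rw [← hN]
  exact hnear n le_rfl

end Whitney

/-- Uniform `ℓ²` decoupling for all separated systems. -/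
def DecouplingBound (L : ℕ) (C η : ℝ) : Prop :=
  ∀ (X : Type) [MeasurableSpace X] (m : Measure X) [IsFiniteMeasure m] (ι : Type)
    (e : ι → X → ℂ) (z : ι → ℤ), (∀ i, IsBddMeas (e i)) → ∀ n, Separated m e z L n →
    DecouplesBelow m e z C η n

lemma DecouplingBound.mono {L : ℕ} {C η η' : ℝ} (h : DecouplingBound L C η) (hC : 0 ≤ C)
    (hη : η ≤ η') : DecouplingBound L C η' := by
  intro X _ m _ ι e z he n hs k hk S q hS
  refine (h X m ι e z he n hs k hk S q hS).trans ?_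
  refine mul_le_mul_of_nonneg_right ?_ (sixNormSqSum_nonneg _ _ _ _)
  gcongr
  norm_num

lemma decouplingBound_two (L : ℕ) : DecouplingBound L 1 2 := by
  intro X _ m _ ι e z he n hs k hk S q hS
  have h1 : ((S.image z).card : ℝ) ≤ 2 ^ k := by
    have : InCell z (0 + k) S q := by rwa [zero_add]
    simpa [show cell z 0 = z from funext (cell_zero z)] using this.card_image_le
  have := sixNormSq_le_card_sq_mul m he S z (one_le_pow₀ (by norm_num)) h1
  refine this.trans (le_of_eq ?_)
  rw [sixNormSqSum, one_mul, ← pow_mul]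
  congr 1
  rw [← Real.rpow_natCast]; push_cast; congr 1; ring

lemma natCast_le_mul_two_rpow {δ : ℝ} (hδ : 0 < δ) (n : ℕ) :
    (n : ℝ) ≤ (δ * Real.log 2)⁻¹ * 2 ^ (δ * n) := by
  have h2 : 0 < Real.log 2 := Real.log_pos (by norm_num)
  rw [Real.rpow_def_of_pos (by norm_num), ← div_eq_inv_mul, le_div_iff₀ (by positivity)]
  have := Real.add_one_le_exp (Real.log 2 * (δ * n))
  nlinarith

lemma DecouplingBound.improve {L : ℕ} {C η : ℝ} (h : DecouplingBound L C η) (hC : 0 ≤ C)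
    {N : ℕ} (hη : 4 ≤ η * N) (hη' : (1 / 2) ^ N ≤ η) :
    ∃ C', 0 ≤ C' ∧ DecouplingBound L C' (η - (1 / 2) ^ N / 2) := by
  set δ : ℝ := (1 / 2) ^ N with hδ
  have hδ0 : 0 < δ := by positivity
  set M : ℝ := 14 * (2 * L + 1) * C * (δ / 2 * Real.log 2)⁻¹ with hM
  have hl2 : 0 < Real.log 2 := Real.log_pos (by norm_num)
  have hM0 : 0 ≤ M := by positivity
  refine ⟨3 + M, by positivity, ?_⟩
  intro X _ m _ ι e z he n₀ hs₀ n hn S q hS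
  have hs := hs₀.mono hn
  have key := sixNormSq_le_of_decouplesBelow he hs hC (h X m ι e z he n hs) N
    (fun g => g / 2 ^ N) (fun g => Nat.mul_div_le _ _) hS
  refine key.trans (mul_le_mul_of_nonneg_right ?_ (sixNormSqSum_nonneg _ _ _ _))
  have hterm : ∀ g ∈ Finset.range n, (2 * (L : ℝ) + 1) * C * 2 ^ (g / 2 ^ N)
      * 2 ^ (η * (g - N / 2 * (g / 2 ^ N : ℕ))) ≤ (2 * L + 1) * C * (2 * 2 ^ ((η - δ) * n)) := by
    intro g hg
    have hgn : g < n := Finset.mem_range.1 hg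
    rw [mul_assoc]
    refine mul_le_mul_of_nonneg_left ?_ (by positivity)
    have hb : (g : ℝ) * δ ≤ (g / 2 ^ N : ℕ) + 1 := by
      have : g < 2 ^ N * (g / 2 ^ N + 1) := Nat.lt_mul_div_succ g (by positivity)
      have h2 : (g : ℝ) ≤ 2 ^ N * ((g / 2 ^ N : ℕ) + 1) := by exact_mod_cast this.le
      rw [hδ, one_div, inv_pow, ← div_eq_mul_inv, div_le_iff₀ (by positivity)]
      linarith
    set b := g / 2 ^ N
    have hb0 : (0 : ℝ) ≤ b := b.cast_nonneg
    have hgn' : (g : ℝ) ≤ n := by exact_mod_cast hgn.le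
    calc (2 : ℝ) ^ b * 2 ^ (η * (g - N / 2 * b))
        = 2 ^ ((b : ℝ) + η * (g - N / 2 * b)) := by
          rw [← Real.rpow_natCast, ← Real.rpow_add (by norm_num)]
      _ ≤ 2 ^ (1 + (η - δ) * n) := by
          refine Real.rpow_le_rpow_of_exponent_le (by norm_num) ?_
          have : (η - δ) * g ≤ (η - δ) * n := mul_le_mul_of_nonneg_left hgn' (by linarith)
          nlinarith
      _ = _ := by rw [Real.rpow_add (by norm_num), Real.rpow_one]
  have hsum := Finset.sum_le_sum hterm
  rw [Finset.sum_const, Finset.card_range, nsmul_eq_mul] at hsum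
  have hn2 := natCast_le_mul_two_rpow (half_pos hδ0) n
  have hpow : (2 : ℝ) ^ (δ / 2 * n) * 2 ^ ((η - δ) * n) = 2 ^ ((η - δ / 2) * n) := by
    rw [← Real.rpow_add (by norm_num)]; congr 1; ring
  have h1 : (1 : ℝ) ≤ 2 ^ ((η - δ / 2) * n) :=
    Real.one_le_rpow (by norm_num) (mul_nonneg (by linarith) n.cast_nonneg)
  calc _ ≤ 3 + 7 * (n * ((2 * L + 1) * C * (2 * 2 ^ ((η - δ) * n)))) := by gcongr
    _ ≤ 3 + 7 * (((δ / 2 * Real.log 2)⁻¹ * 2 ^ (δ / 2 * n))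
          * ((2 * L + 1) * C * (2 * 2 ^ ((η - δ) * n)))) := by gcongr
    _ = 3 * 1 + M * (2 ^ (δ / 2 * n) * 2 ^ ((η - δ) * n)) := by rw [hM]; ring
    _ ≤ 3 * 2 ^ ((η - δ / 2) * n) + M * 2 ^ ((η - δ / 2) * n) := by
        rw [hpow]; gcongr
    _ = _ := by ring

/-- `ℓ²` decoupling with arbitrarily small power loss. -/
theorem exists_decouplingBound (L : ℕ) {ε : ℝ} (hε : 0 < ε) :
    ∃ C, 0 ≤ C ∧ DecouplingBound L C ε := by
  obtain ⟨N, hN⟩ := exists_nat_gt (4 / ε)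
  have hN4 : 4 ≤ ε * N := by rw [div_lt_iff₀ hε] at hN; linarith
  have hNε : (1 / 2 : ℝ) ^ N ≤ ε := by
    have h1 : (N : ℝ) < 2 ^ N := by exact_mod_cast N.lt_two_pow_self
    rw [one_div, inv_pow, inv_le_comm₀ (by positivity) hε]
    have : ε⁻¹ ≤ 4 / ε := by rw [div_eq_mul_inv]; nlinarith [inv_pos.2 hε]
    linarith
  set δ : ℝ := (1 / 2) ^ N / 2 with hδ
  have hδ0 : 0 < δ := by positivity
  have step : ∀ k : ℕ, ∃ C, 0 ≤ C ∧ DecouplingBound L C (max ε (2 - k * δ)) := by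
    intro k
    induction k with
    | zero => exact ⟨1, zero_le_one, (decouplingBound_two L).mono zero_le_one (by simp)⟩
    | succ k ih =>
      obtain ⟨C, hC, h⟩ := ih
      have hle : ε ≤ max ε (2 - k * δ) := le_max_left _ _
      obtain ⟨C', hC', h'⟩ := h.improve hC (N := N)
        (hN4.trans (mul_le_mul_of_nonneg_right hle N.cast_nonneg)) (hNε.trans hle)
      refine ⟨C', hC', h'.mono hC' ?_⟩
      rw [← hδ, sub_le_iff_le_add]
      refine max_le ?_ ?_
      · linarith [le_max_left ε (2 - (k + 1 : ℕ) * δ)]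
      · have := le_max_right ε (2 - (k + 1 : ℕ) * δ)
        push_cast at *; linarith
  obtain ⟨k, hk⟩ := exists_nat_gt (2 / δ)
  obtain ⟨C, hC, h⟩ := step k
  refine ⟨C, hC, h.mono hC (max_le le_rfl ?_)⟩
  rw [div_lt_iff₀ hδ0] at hk
  linarith

/-! ### Geometry of nondegenerate spherical curves -/

/-- Quantitative nondegeneracy of the curve `γ` on `[a, b]` at scales below `ρ`. -/
structure CurveNondeg (γ : ℝ → E3) (a b ρ c C : ℝ) : Prop where
  rho_pos : 0 < ρ
  rho_le : ρ ≤ 1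
  c_pos : 0 < c
  C_pos : 0 < C
  norm_eq : ∀ θ ∈ Icc a b, ‖γ θ‖ = 1
  chord : ∀ θ ∈ Icc a b, ∀ θ' ∈ Icc a b, |θ - θ'| ≤ ρ → c * |θ - θ'| ≤ ‖γ θ - γ θ'‖
  normal : ∀ θ₀ ∈ Icc a b, ∃ n : E3, ‖n‖ ≤ C ∧
    (∀ θ ∈ Icc a b, |θ - θ₀| ≤ ρ → |⟪γ θ, n⟫| ≤ C * |θ - θ₀| ^ 2) ∧
    ∀ θ ∈ Icc a b, ∀ θ' ∈ Icc a b, |θ - θ₀| ≤ ρ → |θ' - θ₀| ≤ ρ → ∀ d,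
      (θ₀ + d ≤ θ ∧ θ₀ + d ≤ θ' ∨ θ ≤ θ₀ - d ∧ θ' ≤ θ₀ - d) →
      c * d * |θ - θ'| ≤ |⟪γ θ, n⟫ - ⟪γ θ', n⟫|

lemma exists_mem_uIcc_hasDerivAt {f f' : ℝ → ℝ} (hf : ∀ t, HasDerivAt f (f' t) t) (x y : ℝ) :
    ∃ ζ ∈ uIcc x y, f y - f x = f' ζ * (y - x) := by
  have main : ∀ x y, x < y → ∃ ζ ∈ uIcc x y, f y - f x = f' ζ * (y - x) := by
    intro x y h
    obtain ⟨ζ, hζ, h1⟩ := exists_hasDerivAt_eq_slope f f' h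
      (fun t _ => (hf t).continuousAt.continuousWithinAt) fun t _ => hf t
    refine ⟨ζ, by rw [uIcc_of_le h.le]; exact Ioo_subset_Icc_self hζ, ?_⟩
    rw [h1, div_mul_cancel₀ _ (sub_pos.2 h).ne']
  rcases lt_trichotomy x y with h | h | h
  · exact main x y h
  · exact ⟨x, left_mem_uIcc, by rw [h]; ring⟩
  · obtain ⟨ζ, hζ, h1⟩ := main y x h
    exact ⟨ζ, by rwa [uIcc_comm], by linarith⟩

/-- Behaviour of a function near a nondegenerate critical point with value zero. -/
lemma nondegenerate_critical_point {f f' f'' : ℝ → ℝ} (hf : ∀ t, HasDerivAt f (f' t) t)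
    (hf' : ∀ t, HasDerivAt f' (f'' t) t) {s : Set ℝ} (hs : s.OrdConnected) {t₀ c C : ℝ}
    (ht₀ : t₀ ∈ s) (hc : 0 < c) (h0 : f t₀ = 0) (h0' : f' t₀ = 0)
    (hlow : ∀ t ∈ s, c ≤ f'' t) (hupp : ∀ t ∈ s, f'' t ≤ C) :
    (∀ t ∈ s, |f t| ≤ C * |t - t₀| ^ 2) ∧
    ∀ t ∈ s, ∀ t' ∈ s, ∀ d, (t₀ + d ≤ t ∧ t₀ + d ≤ t' ∨ t ≤ t₀ - d ∧ t' ≤ t₀ - d) →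
      c * d * |t - t'| ≤ |f t - f t'| := by
  have hC : 0 < C := hc.trans_le ((hlow _ ht₀).trans (hupp _ ht₀))
  have hd : ∀ t ∈ s, ∃ ζ ∈ s, f' t = f'' ζ * (t - t₀) := by
    intro t ht
    obtain ⟨ζ, hζ, h⟩ := exists_mem_uIcc_hasDerivAt hf' t₀ t
    exact ⟨ζ, hs.uIcc_subset ht₀ ht hζ, by rw [← h, h0', sub_zero]⟩
  constructor
  · intro t ht
    obtain ⟨ξ, hξ, h⟩ := exists_mem_uIcc_hasDerivAt hf t₀ t
    have hξs := hs.uIcc_subset ht₀ ht hξ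
    obtain ⟨ζ, hζ, h'⟩ := hd ξ hξs
    rw [h0, sub_zero] at h
    have h1 : |ξ - t₀| ≤ |t - t₀| := by
      have := abs_sub_left_of_mem_uIcc hξ
      exact this
    have h2 : |f'' ζ| ≤ C := by
      rw [abs_of_nonneg (hc.le.trans (hlow _ hζ))]; exact hupp _ hζ
    rw [h, h', abs_mul, abs_mul]
    calc |f'' ζ| * |ξ - t₀| * |t - t₀| ≤ C * |t - t₀| * |t - t₀| := by gcongr
      _ = _ := by ring
  · intro t ht t' ht' d hdd
    obtain ⟨ξ, hξ, h⟩ := exists_mem_uIcc_hasDerivAt hf t' t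
    have hξs := hs.uIcc_subset ht' ht hξ
    obtain ⟨ζ, hζ, h'⟩ := hd ξ hξs
    have h1 : d ≤ |ξ - t₀| := by
      rcases hdd with ⟨h3, h4⟩ | ⟨h3, h4⟩
      · have : t₀ + d ≤ ξ := (le_min h4 h3).trans hξ.1
        exact le_trans (by linarith) (le_abs_self _)
      · have : ξ ≤ t₀ - d := hξ.2.trans (max_le h4 h3)
        exact le_trans (by linarith) (neg_le_abs _)
    rw [h, h', abs_mul, abs_mul]
    refine mul_le_mul_of_nonneg_right ?_ (abs_nonneg _)
    calc c * d ≤ c * |ξ - t₀| := by gcongr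
      _ ≤ |f'' ζ| * |ξ - t₀| := by
        gcongr
        exact (hlow _ hζ).trans (le_abs_self _)

/-- The cross product on Euclidean space. -/
def crossE (u v : E3) : E3 :=
  !₂[u 1 * v 2 - u 2 * v 1, u 2 * v 0 - u 0 * v 2, u 0 * v 1 - u 1 * v 0]

lemma inner_crossE (w u v : E3) : ⟪w, crossE u v⟫ = w 0 * (u 1 * v 2 - u 2 * v 1)
    + w 1 * (u 2 * v 0 - u 0 * v 2) + w 2 * (u 0 * v 1 - u 1 * v 0) := by
  simp [crossE, PiLp.inner_apply, Fin.sum_univ_three]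
  ring

lemma inner_crossE_ne_zero {u v w : E3} (h : LinearIndependent ℝ ![u, v, w]) :
    ⟪w, crossE u v⟫ ≠ 0 := by
  set A : Matrix (Fin 3) (Fin 3) ℝ := Matrix.of fun i j => (![u, v, w] i) j with hA
  have h1 : LinearIndependent ℝ A.row := by
    have := h.map' (WithLp.linearEquiv 2 ℝ (Fin 3 → ℝ)).toLinearMap (LinearEquiv.ker _)
    exact this
  rw [Matrix.linearIndependent_rows_iff_isUnit, Matrix.isUnit_iff_isUnit_det, isUnit_iff_ne_zero,
    Matrix.det_fin_three] at h1
  intro h2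
  apply h1
  rw [inner_crossE] at h2
  simp [hA]
  linarith

lemma exists_curveNondeg {a b : ℝ} (hab : a ≤ b) {γ : ℝ → E3} (hγ : ContDiff ℝ 2 γ)
    (hsphere : ∀ θ ∈ Icc a b, ‖γ θ‖ = 1)
    (hnondeg : ∀ θ ∈ Icc a b, LinearIndependent ℝ ![γ θ, deriv γ θ, deriv (deriv γ) θ]) :
    ∃ ρ c C, CurveNondeg γ a b ρ c C := by
  have hγ1 : ContDiff ℝ 1 (deriv γ) := ((contDiff_succ_iff_deriv (n := 1)).1 hγ).2.2
  have hd : ∀ t, HasDerivAt γ (deriv γ t) t := fun t =>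
    (hγ.differentiable (by norm_num) t).hasDerivAt
  have hd' : ∀ t, HasDerivAt (deriv γ) (deriv (deriv γ) t) t := fun t =>
    (hγ1.differentiable (by norm_num) t).hasDerivAt
  have hc0 : Continuous γ := hγ.continuous
  have hc1 : Continuous (deriv γ) := hγ1.continuous
  have hc2 : Continuous (deriv (deriv γ)) := hγ1.continuous_deriv (by norm_num)
  set N : ℝ → E3 := fun t => crossE (γ t) (deriv γ t) with hN
  have hNc : Continuous N := by
    simp only [hN, crossE]
    fun_prop
  set F : ℝ × ℝ → ℝ := fun p => ⟪deriv (deriv γ) p.1, N p.2⟫ with hF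
  have hFc : Continuous F := by simp only [hF]; fun_prop
  set H : ℝ × ℝ → ℝ := fun p => ⟪deriv γ p.1, deriv γ p.2⟫ with hH
  have hHc : Continuous H := by simp only [hH]; fun_prop
  have hK : IsCompact (Icc a b) := isCompact_Icc
  have hne : (Icc a b).Nonempty := ⟨a, left_mem_Icc.2 hab⟩
  obtain ⟨c₁, hc₁, hF1⟩ : ∃ c₁ > 0, ∀ t ∈ Icc a b, c₁ ≤ |F (t, t)| := by
    obtain ⟨t, ht, hmin⟩ := hK.exists_isMinOn hne (f := fun t => |F (t, t)|)
      (by fun_prop)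
    exact ⟨_, abs_pos.2 (inner_crossE_ne_zero (hnondeg t ht)), fun t' ht' => hmin ht'⟩
  obtain ⟨c₂, hc₂, hH1⟩ : ∃ c₂ > 0, ∀ t ∈ Icc a b, c₂ ≤ ‖deriv γ t‖ := by
    obtain ⟨t, ht, hmin⟩ := hK.exists_isMinOn hne (f := fun t => ‖deriv γ t‖)
      (by fun_prop)
    exact ⟨_, norm_pos_iff.2 ((hnondeg t ht).ne_zero 1), fun t' ht' => hmin ht'⟩
  obtain ⟨C₁, hC₁⟩ : ∃ C₁, ∀ p ∈ Icc a b ×ˢ Icc a b, ‖F p‖ ≤ C₁ :=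
    (hK.prod hK).exists_bound_of_continuousOn hFc.continuousOn
  obtain ⟨C₂, hC₂⟩ : ∃ C₂, ∀ t ∈ Icc a b, ‖N t‖ ≤ C₂ :=
    hK.exists_bound_of_continuousOn hNc.continuousOn
  obtain ⟨C₃, hC₃⟩ : ∃ C₃, ∀ t ∈ Icc a b, ‖deriv γ t‖ ≤ C₃ :=
    hK.exists_bound_of_continuousOn hc1.continuousOn
  have hC₃0 : 0 < C₃ := hc₂.trans_le ((hH1 a (left_mem_Icc.2 hab)).trans (hC₃ a (left_mem_Icc.2 hab)))
  obtain ⟨ρ₁, hρ₁, hF2⟩ := Metric.uniformContinuousOn_iff_le.1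
    ((hK.prod hK).uniformContinuousOn_of_continuous hFc.continuousOn) (c₁ / 2) (by positivity)
  obtain ⟨ρ₂, hρ₂, hH2⟩ := Metric.uniformContinuousOn_iff_le.1
    ((hK.prod hK).uniformContinuousOn_of_continuous hHc.continuousOn) (c₂ ^ 2 / 2) (by positivity)
  set ρ := min 1 (min ρ₁ ρ₂) with hρ
  have hle1 : ρ ≤ ρ₁ := (min_le_right _ _).trans (min_le_left _ _)
  have hle2 : ρ ≤ ρ₂ := (min_le_right _ _).trans (min_le_right _ _)
  set c := min (c₁ / 2) (c₂ ^ 2 / 2 / C₃) with hc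
  have hcpos : 0 < c := lt_min (by positivity) (by positivity)
  set C := max 1 (max C₁ C₂) with hC
  refine ⟨ρ, c, C, lt_min one_pos (lt_min hρ₁ hρ₂), min_le_left _ _, hcpos, one_pos.trans_le (le_max_left _ _),
    hsphere, ?_, ?_⟩
  · intro θ hθ θ' hθ' hdist
    obtain ⟨ξ, hξ, h⟩ := exists_mem_uIcc_hasDerivAt (f := fun t => ⟪γ t, deriv γ θ'⟫)
      (f' := fun t => ⟪deriv γ t, deriv γ θ'⟫)
      (fun t => by simpa using (hd t).inner ℝ (hasDerivAt_const t (deriv γ θ'))) θ' θ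
    have hξI : ξ ∈ Icc a b := ordConnected_Icc.uIcc_subset hθ' hθ hξ
    have h1 : |ξ - θ'| ≤ ρ₂ := (abs_sub_left_of_mem_uIcc hξ).trans (hdist.trans hle2)
    have h2 := hH2 (ξ, θ') ⟨hξI, hθ'⟩ (θ', θ') ⟨hθ', hθ'⟩ (by
      simpa [Prod.dist_eq, Real.dist_eq] using h1)
    rw [Real.dist_eq, abs_le] at h2
    have h3 : H (θ', θ') = ‖deriv γ θ'‖ ^ 2 := real_inner_self_eq_norm_sq _
    have h4 : c₂ ^ 2 ≤ ‖deriv γ θ'‖ ^ 2 := pow_le_pow_left₀ hc₂.le (hH1 θ' hθ') 2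
    have h5 : c₂ ^ 2 / 2 ≤ H (ξ, θ') := by linarith [h2.1]
    have h6 : |⟪γ θ - γ θ', deriv γ θ'⟫| ≤ ‖γ θ - γ θ'‖ * C₃ :=
      (abs_real_inner_le_norm _ _).trans (mul_le_mul_of_nonneg_left (hC₃ _ hθ') (norm_nonneg _))
    rw [inner_sub_left, h, abs_mul] at h6
    have h7 : c₂ ^ 2 / 2 * |θ - θ'| ≤ ‖γ θ - γ θ'‖ * C₃ :=
      le_trans (mul_le_mul_of_nonneg_right (h5.trans (le_abs_self _)) (abs_nonneg _)) h6
    calc c * |θ - θ'| ≤ c₂ ^ 2 / 2 / C₃ * |θ - θ'| := by gcongr; exact min_le_right _ _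
      _ = c₂ ^ 2 / 2 * |θ - θ'| / C₃ := by ring
      _ ≤ _ := by rw [div_le_iff₀ hC₃0]; exact h7
  · intro θ₀ hθ₀
    obtain ⟨σ, hσ, hσF⟩ : ∃ σ : ℝ, |σ| = 1 ∧ σ * F (θ₀, θ₀) = |F (θ₀, θ₀)| := by
      rcases le_total 0 (F (θ₀, θ₀)) with h | h
      · exact ⟨1, by simp, by rw [abs_of_nonneg h, one_mul]⟩
      · exact ⟨-1, by simp, by rw [abs_of_nonpos h]; ring⟩
    set s := Icc a b ∩ Icc (θ₀ - ρ) (θ₀ + ρ) with hs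
    have hmem : ∀ θ ∈ Icc a b, |θ - θ₀| ≤ ρ → θ ∈ s := fun θ hθ h =>
      ⟨hθ, by rw [abs_le] at h; constructor <;> linarith [h.1, h.2]⟩
    have hρ0 : 0 < ρ := lt_min one_pos (lt_min hρ₁ hρ₂)
    have hD1 : ∀ t, HasDerivAt (fun t => ⟪γ t, σ • N θ₀⟫) ⟪deriv γ t, σ • N θ₀⟫ t :=
      fun t => by simpa using (hd t).inner ℝ (hasDerivAt_const t (σ • N θ₀))
    have hD2 : ∀ t, HasDerivAt (fun t => ⟪deriv γ t, σ • N θ₀⟫) (σ * F (t, θ₀)) t :=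
      fun t => by
        simpa [hF, real_inner_smul_right] using (hd' t).inner ℝ (hasDerivAt_const t (σ • N θ₀))
    have hbd : ∀ t ∈ s, |σ * F (t, θ₀) - (|F (θ₀, θ₀)|)| ≤ c₁ / 2 := by
      intro t ht
      have h1 : |t - θ₀| ≤ ρ₁ := by
        refine le_trans ?_ hle1
        rw [abs_le]; constructor <;> linarith [ht.2.1, ht.2.2]
      have h2 := hF2 (t, θ₀) ⟨ht.1, hθ₀⟩ (θ₀, θ₀) ⟨hθ₀, hθ₀⟩ (by
        simpa [Prod.dist_eq, Real.dist_eq] using h1)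
      rw [← hσF, ← mul_sub, abs_mul, hσ, one_mul]
      exact h2
    have key := nondegenerate_critical_point hD1 hD2 (s := s) (t₀ := θ₀) (c := c) (C := C)
      (ordConnected_Icc.inter ordConnected_Icc) (hmem θ₀ hθ₀ (by simpa using hρ0.le)) hcpos
      (by rw [real_inner_smul_right, hN, inner_crossE]; ring)
      (by rw [real_inner_smul_right, hN, inner_crossE]; ring)
      (fun t ht => by
        have := (abs_le.1 (hbd t ht)).1
        have h2 := hF1 θ₀ hθ₀
        have h3 : c ≤ c₁ / 2 := min_le_left _ _
        linarith)
      (fun t ht => by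
        refine (le_abs_self _).trans ?_
        rw [abs_mul, hσ, one_mul]
        exact (hC₁ (t, θ₀) ⟨ht.1, hθ₀⟩).trans ((le_max_left _ _).trans (le_max_right _ _)))
    refine ⟨σ • N θ₀, ?_, fun θ hθ h => key.1 θ (hmem θ hθ h), fun θ hθ θ' hθ' h h' d hdd =>
      key.2 θ (hmem θ hθ h) θ' (hmem θ' hθ' h') d hdd⟩
    rw [norm_smul, Real.norm_eq_abs, hσ, one_mul]
    exact (hC₂ θ₀ hθ₀).trans ((le_max_right _ _).trans (le_max_right _ _))

/-! ### Exponential waves with frequencies near a dilate of the curve -/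

/-- The plane wave with frequency `ξ`. -/
def wave (ξ x : E3) : ℂ := Complex.exp ((⟪x, ξ⟫ : ℝ) * Complex.I)

lemma norm_wave (ξ x : E3) : ‖wave ξ x‖ = 1 := Complex.norm_exp_ofReal_mul_I _

lemma wave_mul (ξ η x : E3) : wave ξ x * wave η x = wave (ξ + η) x := by
  rw [wave, wave, wave, ← Complex.exp_add, inner_add_right]
  push_cast; ring_nf

lemma conj_wave (ξ x : E3) : (starRingEnd ℂ) (wave ξ x) = wave (-ξ) x := by
  rw [wave, wave, ← Complex.exp_conj, inner_neg_right]
  simp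

lemma continuous_wave (ξ : E3) : Continuous (wave ξ) := by
  unfold wave; fun_prop

lemma isBddMeas_const_mul_wave (c : ℂ) (ξ : E3) : IsBddMeas (fun x => c * wave ξ x) :=
  ⟨(continuous_const.mul (continuous_wave ξ)).measurable, ‖c‖, fun x => by simp [norm_wave]⟩

/-- The Fourier transform of `m` vanishes outside the open unit ball. -/
def BandLimited (m : Measure E3) : Prop := ∀ ξ : E3, 1 ≤ ‖ξ‖ → ∫ x, wave ξ x ∂m = 0

lemma BandLimited.integral_mul_conj {m : Measure E3} (hm : BandLimited m) {ξ η : E3}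
    (h : 1 ≤ ‖ξ - η‖) (c d : ℂ) :
    ∫ x, (c * wave ξ x) * (starRingEnd ℂ) (d * wave η x) ∂m = 0 := by
  have : (fun x => (c * wave ξ x) * (starRingEnd ℂ) (d * wave η x))
      = fun x => (c * (starRingEnd ℂ) d) * wave (ξ - η) x := by
    funext x
    rw [map_mul, conj_wave, sub_eq_add_neg, ← wave_mul]; ring
  rw [this, integral_const_mul, hm _ h, mul_zero]

/-- Two points whose cells at scale `t` have bounded index difference are close. -/
lemma abs_sub_lt_of_floor {x y t : ℝ} (ht : 0 < t) {m : ℤ} (h : |⌊x / t⌋ - ⌊y / t⌋| ≤ m) :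
    |x - y| < (m + 1) * t := by
  have e : x - y = (x / t - y / t) * t := by field_simp
  rw [e, abs_mul, abs_of_pos ht]
  refine mul_lt_mul_of_pos_right ?_ ht
  have h1 := Int.floor_le (x / t)
  have h2 := Int.lt_floor_add_one (x / t)
  have h3 := Int.floor_le (y / t)
  have h4 := Int.lt_floor_add_one (y / t)
  rw [abs_le] at h
  have h5 : (-m : ℝ) ≤ ⌊x / t⌋ - ⌊y / t⌋ := by exact_mod_cast h.1
  have h6 : (⌊x / t⌋ - ⌊y / t⌋ : ℝ) ≤ m := by exact_mod_cast h.2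
  rw [abs_lt]; constructor <;> linarith

/-- If cell indices at scale `t` exceed by more than `m`, so do the points. -/
lemma mul_le_sub_of_floor {x y t : ℝ} (ht : 0 < t) {m : ℤ} (h : m < ⌊x / t⌋ - ⌊y / t⌋) :
    m * t ≤ x - y := by
  have e : x - y = (x / t - y / t) * t := by field_simp
  rw [e]
  refine mul_le_mul_of_nonneg_right ?_ ht.le
  have h1 := Int.floor_le (x / t)
  have h4 := Int.lt_floor_add_one (y / t)
  have h5 : (m + 1 : ℝ) ≤ ⌊x / t⌋ - ⌊y / t⌋ := by exact_mod_cast h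
  linarith

lemma mul_le_abs_sub_of_floor {x y t : ℝ} (ht : 0 < t) {m : ℤ}
    (h : m < |⌊x / t⌋ - ⌊y / t⌋|) : m * t ≤ |x - y| := by
  rcases lt_abs.1 h with h | h
  · exact (mul_le_sub_of_floor ht h).trans (le_abs_self _)
  · rw [neg_sub] at h
    exact (mul_le_sub_of_floor ht h).trans (by rw [abs_sub_comm]; exact le_abs_self _)

lemma cell_floor {ι : Type} (θ : ι → ℝ) (s : ℝ) (h : ℕ) (i : ι) :
    cell (fun i => ⌊θ i / s⌋) h i = ⌊θ i / (s * 2 ^ h)⌋ := by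
  have := Int.floor_div_natCast (θ i / s) (2 ^ h)
  rw [cell, ← div_div]
  push_cast at this
  exact this.symm

lemma CurveNondeg.le_abs_inner {γ : ℝ → E3} {a b ρ c C : ℝ} (hγ : CurveNondeg γ a b ρ c C)
    {R κ : ℝ} (hR : 0 < R) (hκ : 0 ≤ κ) {n : E3} {t₀ d D : ℝ}
    (hn1 : ∀ θ ∈ Icc a b, |θ - t₀| ≤ ρ → |⟪γ θ, n⟫| ≤ C * |θ - t₀| ^ 2)
    (hn2 : ∀ θ ∈ Icc a b, ∀ θ' ∈ Icc a b, |θ - t₀| ≤ ρ → |θ' - t₀| ≤ ρ → ∀ d,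
      (t₀ + d ≤ θ ∧ t₀ + d ≤ θ' ∨ θ ≤ t₀ - d ∧ θ' ≤ t₀ - d) →
      c * d * |θ - θ'| ≤ |⟪γ θ, n⟫ - ⟪γ θ', n⟫|)
    {t t' k k' : ℝ} (ht : t ∈ Icc a b) (ht' : t' ∈ Icc a b) (htρ : |t - t₀| ≤ ρ)
    (htρ' : |t' - t₀| ≤ ρ) (hk : k ∈ Icc R (R * (1 + κ))) (hk' : k' ∈ Icc R (R * (1 + κ)))
    (hD : |t - t₀| ≤ D) (hD' : |t' - t₀| ≤ D)
    (hd : t₀ + d ≤ t ∧ t₀ + d ≤ t' ∨ t ≤ t₀ - d ∧ t' ≤ t₀ - d) :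
    R * (c * d * |t - t'|) - 2 * (R * κ * (C * D ^ 2)) ≤ |k * ⟪γ t, n⟫ - k' * ⟪γ t', n⟫| := by
  have hC := hγ.C_pos.le
  have main := hn2 t ht t' ht' htρ htρ' d hd
  have b1 : |⟪γ t, n⟫| ≤ C * D ^ 2 := (hn1 t ht htρ).trans (by gcongr)
  have b2 : |⟪γ t', n⟫| ≤ C * D ^ 2 := (hn1 t' ht' htρ').trans (by gcongr)
  have hkk : ∀ k ∈ Icc R (R * (1 + κ)), |k - R| ≤ R * κ := fun k hk => by
    rw [abs_of_nonneg (by linarith [hk.1])]; linarith [hk.2]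
  set u := ⟪γ t, n⟫
  set v := ⟪γ t', n⟫
  have e : R * (u - v) = (k * u - k' * v) - ((k - R) * u - (k' - R) * v) := by ring
  have e1 : |R * (u - v)| = R * |u - v| := by rw [abs_mul, abs_of_pos hR]
  have e2 : |R * (u - v)| ≤ |k * u - k' * v| + (|(k - R) * u| + |(k' - R) * v|) := by
    rw [e]; exact (abs_sub _ _).trans (add_le_add le_rfl (abs_sub _ _))
  have hRκ : 0 ≤ R * κ := by positivity
  have e3 : |(k - R) * u| ≤ R * κ * (C * D ^ 2) := by
    rw [abs_mul]; exact mul_le_mul (hkk k hk) b1 (abs_nonneg _) hRκ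
  have e4 : |(k' - R) * v| ≤ R * κ * (C * D ^ 2) := by
    rw [abs_mul]; exact mul_le_mul (hkk k' hk') b2 (abs_nonneg _) hRκ
  have e5 := mul_le_mul_of_nonneg_left main hR.le
  linarith

lemma CurveNondeg.separated {γ : ℝ → E3} {a b ρ c C : ℝ} (hγ : CurveNondeg γ a b ρ c C)
    {m : Measure E3} (hm : BandLimited m) {ι : Type} (A : ι → ℂ) (θ k : ι → ℝ) {R s : ℝ}
    {n L : ℕ} (hs : 0 < s) (hR : 0 < R) (hRs : ρ ^ 2 ≤ R * s ^ 2) (hsn : s * 2 ^ n ≤ ρ)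
    (hL : 40 * C + C / ρ ^ 2 ≤ c * L) (hθ : ∀ i, θ i ∈ Icc a b)
    (hk : ∀ i, A i ≠ 0 → k i ∈ Icc R (R * (1 + (4 ^ n)⁻¹))) :
    Separated m (fun i x => A i * wave (k i • γ (θ i)) x) (fun i => ⌊θ i / s⌋) L n := by
  intro g h h' hgn hhg hh i i' j₁ j₂ j₃ j₄ hn hh4 hgi h2 h3 hLi
  have hs2 : ∀ r : ℕ, 0 < s * 2 ^ r := fun r => by positivity
  simp only [mem_insert_iff, mem_singleton_iff, forall_eq_or_imp, forall_eq, cell_floor] at hn hh4 hgi h2 h3 hLi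
  obtain ⟨hni', hn1, hn2, hn3, hn4⟩ := hn
  obtain ⟨hh2, hh3, hh4⟩ := hh4
  have e : (fun x => A i * wave (k i • γ (θ i)) x * (A j₁ * wave (k j₁ • γ (θ j₁)) x *
      (A j₂ * wave (k j₂ • γ (θ j₂)) x)) * (starRingEnd ℂ) (A i' * wave (k i' • γ (θ i')) x *
      (A j₃ * wave (k j₃ • γ (θ j₃)) x * (A j₄ * wave (k j₄ • γ (θ j₄)) x)))) =
      fun x => ((A i * A j₁ * A j₂) * wave (k i • γ (θ i) + k j₁ • γ (θ j₁) + k j₂ • γ (θ j₂)) x)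
        * (starRingEnd ℂ) ((A i' * A j₃ * A j₄) *
          wave (k i' • γ (θ i') + k j₃ • γ (θ j₃) + k j₄ • γ (θ j₄)) x) := by
    funext x
    simp only [← wave_mul]
    ring_nf
  rw [e]
  by_cases hA : A i = 0 ∨ A i' = 0 ∨ A j₁ = 0 ∨ A j₂ = 0 ∨ A j₃ = 0 ∨ A j₄ = 0
  · rcases hA with h | h | h | h | h | h <;> simp [h]
  push Not at hA
  obtain ⟨ai, ai', a1, a2, a3, a4⟩ := hA
  apply hm.integral_mul_conj
  set t₀ := θ j₁ with ht₀
  obtain ⟨N, hNC, hN1, hN2⟩ := hγ.normal t₀ (hθ j₁)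
  have hρ := hγ.rho_pos
  have hc := hγ.c_pos
  have hC := hγ.C_pos
  have hclose : ∀ r j j', ⌊θ j / (s * 2 ^ r)⌋ = ⌊θ j' / (s * 2 ^ r)⌋ → |θ j - θ j'| ≤ s * 2 ^ r := by
    intro r j j' h
    have := abs_sub_lt_of_floor (hs2 r) (m := 0) (x := θ j) (y := θ j') (by simp [h])
    simpa using this.le
  have hρj : ∀ j, ⌊θ j / (s * 2 ^ n)⌋ = ⌊θ j₁ / (s * 2 ^ n)⌋ → |θ j - t₀| ≤ ρ :=
    fun j hj => (hclose n j j₁ hj).trans hsn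
  set σ := s * 2 ^ g with hσ
  have hσ0 : 0 < σ := hs2 g
  have hD : |θ i - t₀| ≤ 4 * σ := by
    have := (abs_sub_lt_of_floor (hs2 g) h3).le
    norm_num at this; exact this
  have hD' : |θ i' - t₀| ≤ 4 * σ := by
    rw [← hgi] at h3
    have := (abs_sub_lt_of_floor (hs2 g) h3).le
    norm_num at this; exact this
  have hside : t₀ + σ ≤ θ i ∧ t₀ + σ ≤ θ i' ∨ θ i ≤ t₀ - σ ∧ θ i' ≤ t₀ - σ := by
    have h1 : (1 : ℤ) < |⌊θ i / σ⌋ - ⌊t₀ / σ⌋| := by linarith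
    rcases lt_abs.1 h1 with h | h
    · left
      have h5 := mul_le_sub_of_floor hσ0 h
      rw [← hgi] at h
      have h6 := mul_le_sub_of_floor hσ0 h
      norm_num at h5 h6
      constructor <;> linarith
    · right
      rw [neg_sub] at h
      have h5 := mul_le_sub_of_floor hσ0 h
      rw [← hgi] at h
      have h6 := mul_le_sub_of_floor hσ0 h
      norm_num at h5 h6
      constructor <;> linarith
  have main := hγ.le_abs_inner (κ := (4 ^ n)⁻¹) hR (by positivity) hN1 hN2 (hθ i) (hθ i')
    (hρj i hn1.symm) (hρj i' (hni'.trans hn1.symm)) (hk i ai) (hk i' ai') hD hD' hside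
  have hLi' : L * (s * 2 ^ h') ≤ |θ i - θ i'| := by
    have := mul_le_abs_sub_of_floor (hs2 h') hLi
    exact_mod_cast this
  set σ' := s * 2 ^ h' with hσ'
  have hσ'0 : 0 < σ' := hs2 h'
  have hs4 : (s * 2 ^ h) ^ 2 ≤ σ * σ' := by
    have : (2 : ℝ) ^ (2 * h) ≤ 2 ^ (g + h') := pow_le_pow_right₀ (by norm_num) hh
    calc (s * 2 ^ h) ^ 2 = s ^ 2 * 2 ^ (2 * h) := by rw [mul_pow, ← pow_mul, mul_comm h]
      _ ≤ s ^ 2 * 2 ^ (g + h') := by gcongr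
      _ = _ := by rw [hσ, hσ', pow_add]; ring
  have hκσ : (4 ^ n)⁻¹ * σ ^ 2 ≤ σ * σ' := by
    have h1 : (2 : ℝ) ^ g ≤ 4 ^ n * 2 ^ h' := by
      calc (2 : ℝ) ^ g ≤ 2 ^ n := pow_le_pow_right₀ (by norm_num) hgn
        _ ≤ 4 ^ n := by gcongr; norm_num
        _ ≤ _ := le_mul_of_one_le_right (by positivity) (one_le_pow₀ (by norm_num))
    rw [inv_mul_le_iff₀ (by positivity), sq, mul_left_comm (4 ^ n : ℝ)]
    refine mul_le_mul_of_nonneg_left ?_ hσ0.le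
    rw [hσ, hσ', mul_left_comm (4 ^ n : ℝ)]
    exact mul_le_mul_of_nonneg_left h1 hs.le
  have hsmall : ∀ j, A j ≠ 0 → ⌊θ j / (s * 2 ^ n)⌋ = ⌊θ j₁ / (s * 2 ^ n)⌋ →
      ⌊θ j / (s * 2 ^ h)⌋ = ⌊θ j₁ / (s * 2 ^ h)⌋ →
      |k j * ⟪γ (θ j), N⟫| ≤ 2 * R * (C * (σ * σ')) := by
    intro j hj hjn hjh
    have h1 := hN1 (θ j) (hθ j) (hρj j hjn)
    have h2 := hclose h j j₁ hjh
    have h4 : (4 ^ n : ℝ)⁻¹ ≤ 1 := inv_le_one_of_one_le₀ (one_le_pow₀ (by norm_num))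
    have h3 : |k j| ≤ 2 * R := by
      have := hk j hj
      rw [abs_of_nonneg (hR.le.trans this.1)]
      nlinarith [this.2]
    rw [abs_mul]
    refine mul_le_mul h3 (h1.trans ?_) (abs_nonneg _) (by positivity)
    refine mul_le_mul_of_nonneg_left (le_trans ?_ hs4) hC.le
    gcongr
  have s1 := hsmall j₁ a1 rfl rfl
  have s2 := hsmall j₂ a2 (hn2.trans hn1.symm) hh2
  have s3 := hsmall j₃ a3 (hn3.trans hn1.symm) hh3
  have s4 := hsmall j₄ a4 (hn4.trans hn1.symm) hh4
  set ξ := k i • γ (θ i) + k j₁ • γ (θ j₁) + k j₂ • γ (θ j₂)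
      - (k i' • γ (θ i') + k j₃ • γ (θ j₃) + k j₄ • γ (θ j₄)) with hξ
  have hin : ⟪ξ, N⟫ = (k i * ⟪γ (θ i), N⟫ - k i' * ⟪γ (θ i'), N⟫)
      + (k j₁ * ⟪γ (θ j₁), N⟫ + k j₂ * ⟪γ (θ j₂), N⟫ - k j₃ * ⟪γ (θ j₃), N⟫
        - k j₄ * ⟪γ (θ j₄), N⟫) := by
    rw [hξ]; simp only [inner_sub_left, inner_add_left, real_inner_smul_left]; ring
  have hlow : R * (σ * σ') * (c * L - 40 * C) ≤ |⟪ξ, N⟫| := by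
    have h1 : R * (c * σ * (L * σ')) ≤ R * (c * σ * |θ i - θ i'|) := by gcongr
    have h2 : R * (4 ^ n)⁻¹ * (C * (4 * σ) ^ 2) ≤ R * C * 16 * (σ * σ') := by
      calc R * (4 ^ n)⁻¹ * (C * (4 * σ) ^ 2) = R * C * 16 * ((4 ^ n)⁻¹ * σ ^ 2) := by ring
        _ ≤ _ := by gcongr
    rw [hin]
    have h3 := abs_sub_abs_le_abs_sub (k i * ⟪γ (θ i), N⟫ - k i' * ⟪γ (θ i'), N⟫)
      (-(k j₁ * ⟪γ (θ j₁), N⟫ + k j₂ * ⟪γ (θ j₂), N⟫ - k j₃ * ⟪γ (θ j₃), N⟫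
        - k j₄ * ⟪γ (θ j₄), N⟫))
    rw [sub_neg_eq_add, abs_neg] at h3
    have h4 : |k j₁ * ⟪γ (θ j₁), N⟫ + k j₂ * ⟪γ (θ j₂), N⟫ - k j₃ * ⟪γ (θ j₃), N⟫
        - k j₄ * ⟪γ (θ j₄), N⟫| ≤ 4 * (2 * R * (C * (σ * σ'))) := by
      rw [abs_le] at s1 s2 s3 s4 ⊢
      constructor <;> linarith [s1.1, s1.2, s2.1, s2.2, s3.1, s3.2, s4.1, s4.2]
    nlinarith
  have hsσ : s ^ 2 ≤ σ * σ' := by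
    rw [sq]
    have : ∀ r : ℕ, s ≤ s * 2 ^ r := fun r =>
      le_mul_of_one_le_right hs.le (one_le_pow₀ (by norm_num))
    exact mul_le_mul (this g) (this h') hs.le hσ0.le
  have h5 : C / ρ ^ 2 ≤ c * L - 40 * C := by linarith
  have h6 : C ≤ R * (σ * σ') * (c * L - 40 * C) := by
    calc C = ρ ^ 2 * (C / ρ ^ 2) := by field_simp
      _ ≤ R * (σ * σ') * (c * L - 40 * C) := by
        refine mul_le_mul (hRs.trans (by gcongr)) h5 (by positivity) (by positivity)
  have h7 : C ≤ ‖ξ‖ * C := h6.trans (hlow.trans ((abs_real_inner_le_norm _ _).trans (by gcongr)))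
  exact le_of_mul_le_mul_right (by linarith) hC

/-! ### A weighted sextic estimate for waves along the curve -/

lemma card_image_floor_le {ι : Type} {a b ρ : ℝ} (hρ : 0 < ρ) (hab : a ≤ b) {θ : ι → ℝ}
    (hθ : ∀ i, θ i ∈ Icc a b) (S : Finset ι) :
    ((S.image fun i => ⌊θ i / ρ⌋).card : ℝ) ≤ (b - a) / ρ + 2 := by
  have h1 : S.image (fun i => ⌊θ i / ρ⌋) ⊆ Finset.Icc ⌊a / ρ⌋ ⌊b / ρ⌋ := by
    intro q hq
    obtain ⟨i, _, rfl⟩ := Finset.mem_image.1 hq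
    rw [Finset.mem_Icc]
    constructor <;> apply Int.floor_le_floor <;> gcongr
    exacts [(hθ i).1, (hθ i).2]
  have h2 := Finset.card_le_card h1
  rw [Int.card_Icc] at h2
  have h4 : ⌊a / ρ⌋ ≤ ⌊b / ρ⌋ := Int.floor_le_floor (by gcongr)
  have h3 : ((⌊b / ρ⌋ + 1 - ⌊a / ρ⌋).toNat : ℝ) = ⌊b / ρ⌋ + 1 - ⌊a / ρ⌋ := by
    have : ((⌊b / ρ⌋ + 1 - ⌊a / ρ⌋).toNat : ℤ) = ⌊b / ρ⌋ + 1 - ⌊a / ρ⌋ :=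
      Int.toNat_of_nonneg (by linarith)
    exact_mod_cast this
  have h5 : ((S.image fun i => ⌊θ i / ρ⌋).card : ℝ) ≤ ⌊b / ρ⌋ + 1 - ⌊a / ρ⌋ := by
    rw [← h3]; exact_mod_cast h2
  have h6 := Int.floor_le (b / ρ)
  have h7 := Int.lt_floor_add_one (a / ρ)
  rw [sub_div]; linarith

lemma CurveNondeg.sixNormSq_le {γ : ℝ → E3} {a b ρ c C : ℝ} (hγ : CurveNondeg γ a b ρ c C)
    (hab : a ≤ b) {m : Measure E3} [IsFiniteMeasure m] (hm : BandLimited m) {L : ℕ} {D ε : ℝ}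
    (hL : 40 * C + C / ρ ^ 2 ≤ c * L) (hD0 : 0 ≤ D) (hD : DecouplingBound L D ε)
    {ι : Type} (A : ι → ℂ) (θ k : ι → ℝ) {R : ℝ} {n M : ℕ} (hR : (4 : ℝ) ^ (n * M) ≤ R)
    (hθ : ∀ i, θ i ∈ Icc a b) (hk : ∀ i, A i ≠ 0 → k i ∈ Icc R (R * (1 + (4 ^ n)⁻¹)))
    (S : Finset ι) :
    sixNormSq m (fun i x => A i * wave (k i • γ (θ i)) x) S ≤
      ((b - a) / ρ + 2) ^ 2 * (D * 2 ^ (ε * n)) ^ M *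
        sixNormSqSum m (fun i x => A i * wave (k i • γ (θ i)) x)
          (fun i => ⌊θ i / (ρ / 2 ^ (n * M))⌋) S := by
  have hρ := hγ.rho_pos
  have hR0 : 0 < R := lt_of_lt_of_le (by positivity) hR
  set e : ι → E3 → ℂ := fun i x => A i * wave (k i • γ (θ i)) x with he
  have heb : ∀ i, IsBddMeas (e i) := fun i => isBddMeas_const_mul_wave _ _
  set z : ℕ → ι → ℤ := fun j i => ⌊θ i / (ρ / 2 ^ (n * j))⌋ with hz
  have hcell : ∀ j i, cell (z (j + 1)) n i = z j i := by
    intro j i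
    rw [hz, cell_floor]
    congr 2
    rw [mul_add, pow_add, mul_one]; field_simp
  have hsep : ∀ j < M, Separated m e (z (j + 1)) L n := by
    intro j hj
    apply hγ.separated hm A θ k (by positivity) hR0 _ _ hL hθ hk
    · have h1 : (4 : ℝ) ^ (n * (j + 1)) ≤ R :=
        (pow_le_pow_right₀ (by norm_num) (Nat.mul_le_mul_left n hj)).trans hR
      rw [div_pow, ← pow_mul, mul_comm _ 2, pow_mul, mul_div_assoc', le_div_iff₀ (by positivity)]
      norm_num1
      nlinarith [sq_nonneg ρ]
    · rw [mul_add, pow_add, mul_one]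
      have : (1 : ℝ) ≤ 2 ^ (n * j) := one_le_pow₀ (by norm_num)
      rw [div_mul_eq_mul_div, div_le_iff₀ (by positivity)]
      have h2 : 0 < ρ * 2 ^ n := by positivity
      nlinarith
  have hD' : 0 ≤ D * 2 ^ (ε * n) := by positivity
  have hstep : ∀ j ≤ M, sixNormSqSum m e (z 0) S ≤ (D * 2 ^ (ε * n)) ^ j * sixNormSqSum m e (z j) S := by
    intro j
    induction j with
    | zero => intro; simp
    | succ j ih =>
      intro hj
      refine (ih (by omega)).trans ?_
      rw [pow_succ, mul_assoc]
      refine mul_le_mul_of_nonneg_left ?_ (by positivity)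
      rw [sixNormSqSum_eq_sum m e (z (j + 1)) S (z j) (· / 2 ^ n) fun i => (hcell j i).symm,
        Finset.mul_sum, sixNormSqSum]
      refine Finset.sum_le_sum fun q _ => ?_
      refine hD E3 m ι e (z (j + 1)) heb n (hsep j (by omega)) n le_rfl _ q fun i hi => ?_
      rw [hcell]; exact (Finset.mem_filter.1 hi).2
  have h0 := sixNormSq_le_card_sq_mul m heb S (z 0) (K := (b - a) / ρ + 2)
    (by have : 0 ≤ (b - a) / ρ := div_nonneg (by linarith) hρ.le
        linarith)
    (by simpa [hz] using card_image_floor_le hρ hab hθ S)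
  refine h0.trans ?_
  rw [mul_assoc]
  exact mul_le_mul_of_nonneg_left (hstep M le_rfl) (by positivity)

lemma sum_pow_three_le_of_pow_three_le {ι : Type} (s : Finset ι) {N u v : ι → ℝ}
    (hN : ∀ i ∈ s, 0 ≤ N i) (hu : ∀ i ∈ s, 0 ≤ u i) (hv : ∀ i ∈ s, 0 ≤ v i)
    (h : ∀ i ∈ s, N i ^ 3 ≤ u i ^ 2 * v i) :
    (∑ i ∈ s, N i) ^ 3 ≤ (∑ i ∈ s, u i) ^ 2 * ∑ i ∈ s, v i := by
  have hconj : Real.HolderConjugate (3 / 2) 3 := by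
    rw [Real.holderConjugate_iff]; norm_num
  have h1 : ∀ i ∈ s, N i ≤ u i ^ (2 / 3 : ℝ) * v i ^ (1 / 3 : ℝ) := by
    intro i hi
    refine le_of_pow_le_pow_left₀ (n := 3) (by norm_num) ?_ ?_
    · have := hu i hi; have := hv i hi; positivity
    · rw [mul_pow, ← Real.rpow_mul_natCast (hu i hi), ← Real.rpow_mul_natCast (hv i hi)]
      norm_num
      exact h i hi
  have h2 := Real.inner_le_Lp_mul_Lq_of_nonneg s hconj (f := fun i => u i ^ (2 / 3 : ℝ))
    (g := fun i => v i ^ (1 / 3 : ℝ)) (fun i hi => Real.rpow_nonneg (hu i hi) _)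
    (fun i hi => Real.rpow_nonneg (hv i hi) _)
  have e1 : ∑ i ∈ s, (u i ^ (2 / 3 : ℝ)) ^ (3 / 2 : ℝ) = ∑ i ∈ s, u i :=
    Finset.sum_congr rfl fun i hi => by rw [← Real.rpow_mul (hu i hi)]; norm_num
  have e2 : ∑ i ∈ s, (v i ^ (1 / 3 : ℝ)) ^ (3 : ℝ) = ∑ i ∈ s, v i :=
    Finset.sum_congr rfl fun i hi => by rw [← Real.rpow_mul (hv i hi)]; norm_num
  rw [e1, e2] at h2
  have hU : 0 ≤ ∑ i ∈ s, u i := Finset.sum_nonneg hu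
  have hV : 0 ≤ ∑ i ∈ s, v i := Finset.sum_nonneg hv
  calc (∑ i ∈ s, N i) ^ 3 ≤ ((∑ i ∈ s, u i) ^ (1 / (3 / 2) : ℝ) * (∑ i ∈ s, v i) ^ (1 / 3 : ℝ)) ^ 3 :=
        pow_le_pow_left₀ (Finset.sum_nonneg hN) ((Finset.sum_le_sum h1).trans h2) 3
    _ = _ := by
      rw [mul_pow, ← Real.rpow_mul_natCast hU, ← Real.rpow_mul_natCast hV]
      norm_num

lemma mul_norm_sub_le_norm_smul_sub {u v : E3} (hu : ‖u‖ = 1) (hv : ‖v‖ = 1) {R k k' : ℝ}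
    (hR : 0 ≤ R) (hk : R ≤ k) (hk' : R ≤ k') : R * ‖u - v‖ ≤ ‖k • u - k' • v‖ := by
  refine le_of_sq_le_sq ?_ (norm_nonneg _)
  rw [mul_pow, norm_sub_sq_real, norm_sub_sq_real, hu, hv, norm_smul, norm_smul, hu, hv,
    real_inner_smul_left, real_inner_smul_right]
  have h1 : ⟪u, v⟫ ≤ 1 := by
    have := real_inner_le_norm u v; rwa [hu, hv, one_mul] at this
  simp only [Real.norm_eq_abs, mul_one, sq_abs]
  have h2 : R * R ≤ k * k' := mul_le_mul hk hk' hR (hR.trans hk)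
  nlinarith [sq_nonneg (k - k'), mul_le_mul_of_nonneg_right h2 (sub_nonneg.2 h1)]

lemma wave_smul_eq (k : ℤ) (u x : E3) :
    wave ((k : ℝ) • u) x = Complex.exp ((k * ⟪x, u⟫ : ℝ) * Complex.I) := by
  rw [wave, real_inner_smul_right]

/-- Exact orthogonality of waves with integer multiples of a unit frequency. -/
lemma BandLimited.integral_norm_sum_smul_sq_le {m : Measure E3} [IsFiniteMeasure m]
    (hm : BandLimited m) {u : E3} (hu : ‖u‖ = 1) (K : Finset ℤ) (A : ℤ → ℂ) :
    ∫ x, ‖∑ k ∈ K, A k * wave ((k : ℝ) • u) x‖ ^ 2 ∂m ≤ m.real univ * ∑ k ∈ K, ‖A k‖ ^ 2 := by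
  have h := integral_norm_sum_sq_le m 0 K (fun k x => A k * wave ((k : ℝ) • u) x)
    (fun k => isBddMeas_const_mul_wave _ _) fun q _ q' _ hq => by
      apply hm.integral_mul_conj
      rw [← sub_smul, norm_smul, hu, mul_one, Real.norm_eq_abs]
      have : (1 : ℤ) ≤ |q - q'| := Order.one_le_iff_pos.2 (by exact_mod_cast hq)
      exact_mod_cast this
  refine h.trans (le_of_eq ?_)
  simp [norm_wave, Finset.mul_sum]

theorem CurveNondeg.sextic_estimate {γ : ℝ → E3} {a b ρ c C : ℝ} (hγ : CurveNondeg γ a b ρ c C)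
    (hab : a ≤ b) {m : Measure E3} [IsFiniteMeasure m] (hm : BandLimited m) (M : ℕ) {ε : ℝ}
    (hε : 0 < ε) :
    ∃ D, 0 ≤ D ∧ ∀ (n : ℕ) (R : ℝ) (V K : Finset ℤ) (θ w : ℤ → ℝ) (A : ℤ → ℤ → ℂ) (W B Λ : ℝ),
      (4 : ℝ) ^ (n * M) ≤ R → (∀ v, θ v ∈ Icc a b) →
      (∀ v ∈ V, θ v ∈ Icc ((v : ℝ) / 4 ^ (n * M)) ((v + 1) / 4 ^ (n * M))) →
      (∀ v, 0 ≤ w v) → (∀ v ∈ V, w v ≤ W) →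
      (∀ v k, A v k ≠ 0 → (k : ℝ) ∈ Icc R (R * (1 + (4 ^ n)⁻¹))) → 0 ≤ B →
      (∀ v ∈ V, ∀ t : ℝ, ‖∑ k ∈ K, A v k * Complex.exp ((k * t : ℝ) * Complex.I)‖ ≤ B) →
      (∀ u, ∑ v ∈ V with |θ v - u| ≤ (2 ^ (n * M))⁻¹, w v ≤ Λ) →
      ∫ x, ‖∑ v ∈ V, w v * ∑ k ∈ K, A v k * wave ((k : ℝ) • γ (θ v)) x‖ ^ 6 ∂m ≤
        D * 2 ^ (ε * (n * M)) * B ^ 4 * W * Λ ^ 2 * (∑ v ∈ V, w v) ^ 2 *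
          ∑ v ∈ V, w v * ∑ k ∈ K, ‖A v k‖ ^ 2 := by
  have hρ := hγ.rho_pos
  have hc := hγ.c_pos
  obtain ⟨L, hL⟩ := exists_nat_ge ((40 * C + C / ρ ^ 2) / c)
  rw [div_le_iff₀' hc] at hL
  obtain ⟨L', hL'⟩ := exists_nat_ge (1 / c)
  rw [div_le_iff₀' hc] at hL'
  obtain ⟨D₀, hD₀, hdec⟩ := exists_decouplingBound L (show 0 < ε / 3 by positivity)
  have hK0 : 0 ≤ (b - a) / ρ + 2 := by
    have : 0 ≤ (b - a) / ρ := div_nonneg (by linarith) hρ.le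
    linarith
  refine ⟨((b - a) / ρ + 2) ^ 6 * D₀ ^ (3 * M) * ((2 * L' + 1) * m.real univ), by positivity, ?_⟩
  intro n R V K θ w A W B Λ hR hθ hθV hw hwW hA hB hAB hΛ
  have hR0 : 0 < R := lt_of_lt_of_le (by positivity) hR
  set Ai : ℤ × ℤ → ℂ := fun i => w i.1 * A i.1 i.2 with hAi
  set e : ℤ × ℤ → E3 → ℂ := fun i x => Ai i * wave ((i.2 : ℝ) • γ (θ i.1)) x with he
  set z : ℤ → ℤ := fun v => ⌊θ v / (ρ / 2 ^ (n * M))⌋ with hz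
  set G : ℤ → E3 → ℂ := fun v x => w v * ∑ k ∈ K, A v k * wave ((k : ℝ) • γ (θ v)) x with hG
  have hfam : ∀ V' : Finset ℤ, famSum e (V' ×ˢ K) = fun x => ∑ v ∈ V', G v x := by
    intro V'
    funext x
    simp only [famSum, Finset.sum_product, hG, Finset.mul_sum, he, hAi, mul_assoc]
  have h1 := hγ.sixNormSq_le hab hm hL hD₀ hdec Ai (fun i => θ i.1) (fun i => (i.2 : ℝ)) hR
    (fun i => hθ i.1) (fun i hi => hA i.1 i.2 fun h => hi (by simp [hAi, h])) (V ×ˢ K)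
  change sixNormSq m e (V ×ˢ K) ≤ _ * sixNormSqSum m e (fun i => z i.1) _ at h1
  set X : ℤ → ℝ := fun v => w v * ∑ k ∈ K, ‖A v k‖ ^ 2 with hX
  have hX0 : ∀ v, 0 ≤ X v := fun v => mul_nonneg (hw v) (by positivity)
  have hcellsum : sixNormSqSum m e (fun i => z i.1) (V ×ˢ K)
      ≤ ∑ q ∈ V.image z, sixNormSq m e ((V.filter (z · = q)) ×ˢ K) := by
    have hfil : ∀ q, (V ×ˢ K).filter (fun i => z i.1 = q) = (V.filter (z · = q)) ×ˢ K := by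
      intro q; ext i; simp only [Finset.mem_filter, Finset.mem_product]; tauto
    rw [sixNormSqSum]
    simp only [hfil]
    refine Finset.sum_le_sum_of_subset_of_nonneg ?_ fun _ _ _ => sixNormSq_nonneg _ _ _
    intro q hq
    obtain ⟨i, hi, rfl⟩ := Finset.mem_image.1 hq
    exact Finset.mem_image_of_mem _ (Finset.mem_product.1 hi).1
  set l : ℤ → ℝ := fun q => ∑ v ∈ V with z v = q, w v with hl
  have hl0 : ∀ q, 0 ≤ l q := fun q => Finset.sum_nonneg fun v _ => hw v
  have hs0 : 0 < ρ / 2 ^ (n * M) := by positivity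
  have hzclose : ∀ v v', z v = z v' → |θ v - θ v'| ≤ ρ / 2 ^ (n * M) := by
    intro v v' h
    have := abs_sub_lt_of_floor hs0 (m := 0) (x := θ v) (y := θ v')
      (by rw [show ⌊θ v / (ρ / 2 ^ (n * M))⌋ = ⌊θ v' / (ρ / 2 ^ (n * M))⌋ from h]; simp)
    simpa using this.le
  have hlΛ : ∀ q ∈ V.image z, l q ≤ Λ := by
    intro q hq
    obtain ⟨v₀, hv₀, rfl⟩ := Finset.mem_image.1 hq
    refine le_trans (Finset.sum_le_sum_of_subset_of_nonneg ?_ fun _ _ _ => hw _) (hΛ (θ v₀))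
    intro v hv
    rw [Finset.mem_filter] at hv ⊢
    refine ⟨hv.1, (hzclose v v₀ hv.2).trans ?_⟩
    rw [div_eq_mul_inv]
    exact mul_le_of_le_one_left (by positivity) hγ.rho_le
  have hGb : ∀ v, IsBddMeas (G v) := fun v => by
    have : G v = fun x => ∑ k ∈ K, (w v * A v k) * wave ((k : ℝ) • γ (θ v)) x := by
      funext x; simp only [hG, Finset.mul_sum, mul_assoc]
    rw [this]
    exact IsBddMeas.sum K fun k => isBddMeas_const_mul_wave _ _
  have hGl : ∀ v ∈ V, ∀ x, ‖G v x‖ ≤ B * w v := by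
    intro v hv x
    simp only [hG, norm_mul, Complex.norm_real, Real.norm_eq_abs, abs_of_nonneg (hw v), wave_smul_eq]
    rw [mul_comm]
    exact mul_le_mul_of_nonneg_right (hAB v hv _) (hw v)
  have hGint : ∀ v ∈ V, ∫ x, ‖G v x‖ ^ 2 ∂m ≤ m.real univ * (W * X v) := by
    intro v hv
    have h2 := hm.integral_norm_sum_smul_sq_le (hγ.norm_eq _ (hθ v)) K (A v)
    have h3 : ∫ x, ‖G v x‖ ^ 2 ∂m
        = w v ^ 2 * ∫ x, ‖∑ k ∈ K, A v k * wave ((k : ℝ) • γ (θ v)) x‖ ^ 2 ∂m := by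
      rw [← integral_const_mul]
      congr 1; funext x
      simp only [hG, norm_mul, Complex.norm_real, Real.norm_eq_abs, abs_of_nonneg (hw v), mul_pow]
    rw [h3]
    calc _ ≤ w v ^ 2 * (m.real univ * ∑ k ∈ K, ‖A v k‖ ^ 2) := by gcongr
      _ = w v * (m.real univ * X v) := by simp only [hX]; ring
      _ ≤ W * (m.real univ * X v) :=
        mul_le_mul_of_nonneg_right (hwW v hv) (mul_nonneg (by positivity) (hX0 v))
      _ = _ := by ring
  have hone : ∀ q, sixNormSq m e ((V.filter (z · = q)) ×ˢ K) ^ 3 ≤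
      (l q ^ 2) ^ 2 * (B ^ 4 * ((2 * L' + 1) * m.real univ * W) * ∑ v ∈ V with z v = q, X v) := by
    intro q
    rw [sixNormSq_pow_three, hfam]
    set V' := V.filter (z · = q) with hV'
    have hsup : ∀ x, ‖∑ v ∈ V', G v x‖ ≤ B * l q := fun x => by
      refine (norm_sum_le _ _).trans ?_
      rw [hl, Finset.mul_sum]
      exact Finset.sum_le_sum fun v hv => hGl v (Finset.mem_filter.1 hv).1 x
    have horth : ∫ x, ‖∑ v ∈ V', G v x‖ ^ 2 ∂m ≤ (2 * L' + 1) * ∑ v ∈ V', ∫ x, ‖G v x‖ ^ 2 ∂m := by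
      refine integral_norm_sum_sq_le m L' V' G hGb fun v hv v' hv' hvv => ?_
      rw [hV', Finset.mem_filter] at hv hv'
      have hprod : (fun x => G v x * (starRingEnd ℂ) (G v' x)) = fun x => ∑ k ∈ K, ∑ k' ∈ K,
          (w v * A v k * wave ((k : ℝ) • γ (θ v)) x) *
            (starRingEnd ℂ) (w v' * A v' k' * wave ((k' : ℝ) • γ (θ v')) x) := by
        funext x
        rw [← Finset.sum_mul_sum, ← map_sum]
        simp only [hG, Finset.mul_sum, mul_assoc]
      rw [hprod, integral_finsetSum _ fun k _ => integrable_finsetSum _ fun k' _ =>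
        ((isBddMeas_const_mul_wave _ _).mul (isBddMeas_const_mul_wave _ _).conj).integrable m]
      refine Finset.sum_eq_zero fun k _ => ?_
      rw [integral_finsetSum _ fun k' _ =>
        ((isBddMeas_const_mul_wave _ _).mul (isBddMeas_const_mul_wave _ _).conj).integrable m]
      refine Finset.sum_eq_zero fun k' _ => ?_
      by_cases h0 : A v k = 0 ∨ A v' k' = 0
      · rcases h0 with h | h <;> simp [h]
      push Not at h0
      apply hm.integral_mul_conj
      refine le_trans ?_ (mul_norm_sub_le_norm_smul_sub (hγ.norm_eq _ (hθ v)) (hγ.norm_eq _ (hθ v'))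
        hR0.le (hA v k h0.1).1 (hA v' k' h0.2).1)
      have hd : |θ v - θ v'| ≤ ρ := (hzclose v v' (hv.2.trans hv'.2.symm)).trans
        (div_le_self hρ.le (one_le_pow₀ (by norm_num)))
      have hch := hγ.chord _ (hθ v) _ (hθ v') hd
      have hdl : L' / 4 ^ (n * M) ≤ |θ v - θ v'| := by
        have i1 := hθV v hv.1
        have i2 := hθV v' hv'.1
        have hp : (0 : ℝ) < 4 ^ (n * M) := by positivity
        rw [mem_Icc, div_le_iff₀ hp, le_div_iff₀ hp] at i1 i2
        have e1 : |θ v - θ v'| * 4 ^ (n * M) = |θ v * 4 ^ (n * M) - θ v' * 4 ^ (n * M)| := by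
          rw [← sub_mul, abs_mul, abs_of_pos hp]
        rw [div_le_iff₀ hp, e1]
        rcases lt_abs.1 hvv with h | h
        · have : (L' : ℝ) + 1 ≤ v - v' := by exact_mod_cast h
          exact le_trans (by linarith [i1.1, i2.2]) (le_abs_self _)
        · have : (L' : ℝ) + 1 ≤ -(v - v') := by exact_mod_cast h
          exact le_trans (by linarith [i1.2, i2.1]) (neg_le_abs _)
      calc (1 : ℝ) ≤ c * L' := hL'
        _ = 4 ^ (n * M) * (c * (L' / 4 ^ (n * M))) := by field_simp
        _ ≤ R * (c * |θ v - θ v'|) := by gcongr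
        _ ≤ _ := by gcongr
    have hb2 : ∫ x, ‖∑ v ∈ V', G v x‖ ^ 2 ∂m ≤ (2 * L' + 1) * m.real univ * W * ∑ v ∈ V', X v := by
      refine horth.trans ?_
      have h2 : ∑ v ∈ V', ∫ x, ‖G v x‖ ^ 2 ∂m ≤ m.real univ * (W * ∑ v ∈ V', X v) := by
        rw [Finset.mul_sum, Finset.mul_sum]
        exact Finset.sum_le_sum fun v hv => hGint v (Finset.mem_filter.1 hv).1
      have h3 : (0 : ℝ) ≤ 2 * L' + 1 := by positivity
      linarith [mul_le_mul_of_nonneg_left h2 h3]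
    have hbd := IsBddMeas.sum V' hGb
    calc ∫ x, ‖∑ v ∈ V', G v x‖ ^ 6 ∂m ≤ ∫ x, (B * l q) ^ 4 * ‖∑ v ∈ V', G v x‖ ^ 2 ∂m := by
          refine integral_mono (hbd.integrable_norm_pow m 6)
            ((hbd.integrable_norm_pow m 2).const_mul _) fun x => ?_
          have : ‖∑ v ∈ V', G v x‖ ^ 6 = ‖∑ v ∈ V', G v x‖ ^ 4 * ‖∑ v ∈ V', G v x‖ ^ 2 := by ring
          simp only [this]
          exact mul_le_mul_of_nonneg_right (pow_le_pow_left₀ (norm_nonneg _) (hsup x) 4) (by positivity)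
      _ = (B * l q) ^ 4 * ∫ x, ‖∑ v ∈ V', G v x‖ ^ 2 ∂m := integral_const_mul _ _
      _ ≤ (B * l q) ^ 4 * ((2 * L' + 1) * m.real univ * W * ∑ v ∈ V', X v) := by gcongr
      _ = _ := by ring
  rcases V.eq_empty_or_nonempty with rfl | ⟨v₁, hv₁⟩
  · simp
  have hW0 : 0 ≤ W := (hw v₁).trans (hwW v₁ hv₁)
  have hsum := sum_pow_three_le_of_pow_three_le (V.image z)
    (fun q _ => sixNormSq_nonneg m e _) (fun q _ => sq_nonneg (l q))
    (fun q _ => mul_nonneg (by positivity) (Finset.sum_nonneg fun v _ => hX0 v)) fun q _ => hone q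
  rw [← Finset.mul_sum, Finset.sum_fiberwise_of_maps_to
    (fun v hv => Finset.mem_image_of_mem z hv)] at hsum
  have hl2 : ∑ q ∈ V.image z, l q ^ 2 ≤ Λ * ∑ v ∈ V, w v := by
    rw [← Finset.sum_fiberwise_of_maps_to (fun v hv => Finset.mem_image_of_mem z hv) w, Finset.mul_sum]
    exact Finset.sum_le_sum fun q hq => by
      rw [sq]; exact mul_le_mul_of_nonneg_right (hlΛ q hq) (hl0 q)
  have hXs : 0 ≤ ∑ v ∈ V, X v := Finset.sum_nonneg fun v _ => hX0 v
  have hfin : ∫ x, ‖∑ v ∈ V, G v x‖ ^ 6 ∂m = sixNormSq m e (V ×ˢ K) ^ 3 := by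
    rw [sixNormSq_pow_three, hfam]
  change ∫ x, ‖∑ v ∈ V, G v x‖ ^ 6 ∂m ≤ _ * ∑ v ∈ V, X v
  rw [hfin]
  have hpow : ((2 : ℝ) ^ (ε / 3 * n)) ^ (M * 3) = 2 ^ (ε * (n * M)) := by
    rw [← Real.rpow_mul_natCast (by norm_num)]
    congr 1; push_cast; ring
  calc sixNormSq m e (V ×ˢ K) ^ 3
      ≤ (((b - a) / ρ + 2) ^ 2 * (D₀ * 2 ^ (ε / 3 * n)) ^ M *
          ∑ q ∈ V.image z, sixNormSq m e ((V.filter (z · = q)) ×ˢ K)) ^ 3 := by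
        refine pow_le_pow_left₀ (sixNormSq_nonneg _ _ _) (h1.trans ?_) 3
        exact mul_le_mul_of_nonneg_left hcellsum (by positivity)
    _ = ((b - a) / ρ + 2) ^ 6 * (D₀ ^ (3 * M) * (2 ^ (ε / 3 * n)) ^ (M * 3)) *
          (∑ q ∈ V.image z, sixNormSq m e ((V.filter (z · = q)) ×ˢ K)) ^ 3 := by
        rw [mul_pow, mul_pow, mul_pow, mul_pow, ← pow_mul, ← pow_mul, ← pow_mul, mul_comm M 3]
    _ ≤ ((b - a) / ρ + 2) ^ 6 * (D₀ ^ (3 * M) * (2 ^ (ε / 3 * n)) ^ (M * 3)) *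
          ((Λ * ∑ v ∈ V, w v) ^ 2 * (B ^ 4 * ((2 * L' + 1) * m.real univ * W) * ∑ v ∈ V, X v)) := by
        refine mul_le_mul_of_nonneg_left (hsum.trans ?_) (by positivity)
        refine mul_le_mul_of_nonneg_right ?_ (by positivity)
        exact pow_le_pow_left₀ (Finset.sum_nonneg fun q _ => by positivity) hl2 2
    _ = _ := by rw [hpow]; ring

/-! ### A band-limited measure -/

open scoped FourierTransform SchwartzMap in
lemma fourier_compSubConst (f : 𝓢(E3, ℂ)) (v x : E3) :
    𝓕 (f.compSubConstCLM ℂ v) x = wave (-(2 * Real.pi) • v) x * 𝓕 f x := by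
  rw [SchwartzMap.fourier_coe, SchwartzMap.fourier_coe, Real.fourier_eq', Real.fourier_eq',
    ← integral_const_mul, ← integral_add_right_eq_self _ v]
  congr 1; funext y
  rw [SchwartzMap.compSubConstCLM_apply, wave, smul_eq_mul, smul_eq_mul, ← mul_assoc,
    ← Complex.exp_add, real_inner_smul_right, inner_add_left, real_inner_comm x v, add_sub_cancel_right]
  congr 2
  push_cast; ring

open scoped FourierTransform SchwartzMap in
theorem exists_bandLimited : ∃ m : Measure E3, IsFiniteMeasure m ∧ BandLimited m ∧
    ∃ A : ℝ≥0, volume.restrict (closedBall (0 : E3) 2) ≤ A • m := by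
  have hπ := Real.pi_pos
  set r : ℝ := 1 / (8 * Real.pi) with hr
  have hr0 : 0 < r := by positivity
  let bump : ContDiffBump (0 : E3) := ⟨r / 2, r, by positivity, by linarith⟩
  have hcs : HasCompactSupport (fun x => ((bump x : ℝ) : ℂ)) :=
    bump.hasCompactSupport.comp_left (g := fun t : ℝ => (t : ℂ)) (by simp)
  have hcd : ContDiff ℝ (⊤ : ℕ∞) (fun x => ((bump x : ℝ) : ℂ)) :=
    Complex.ofRealCLM.contDiff.comp bump.contDiff
  set φ : 𝓢(E3, ℂ) := hcs.toSchwartzMap hcd with hφ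
  have hφv : ∀ x, φ x = ((bump x : ℝ) : ℂ) := fun x => rfl
  have hφ0 : ∀ x, r ≤ ‖x‖ → φ x = 0 := by
    intro x hx
    rw [hφv, bump.zero_of_le_dist (by simpa using hx), Complex.ofReal_zero]
  set d : E3 → ℝ≥0∞ := fun x => ENNReal.ofReal (‖𝓕 φ x‖ ^ 2) with hd
  have hcont : Continuous (fun x => ‖𝓕 φ x‖ ^ 2) := by
    have := (𝓕 φ).continuous
    fun_prop
  have hInt : Integrable (fun x => ‖𝓕 φ x‖ ^ 2) := by
    have := ((𝓕 φ).memLp 2 volume).integrable_norm_pow (by norm_num)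
    simpa using this
  have hdm : Measurable d := hcont.measurable.ennreal_ofReal
  refine ⟨volume.withDensity d, ⟨?_⟩, ?_, ?_⟩
  · rw [withDensity_apply _ MeasurableSet.univ, Measure.restrict_univ]
    exact hInt.lintegral_lt_top
  · intro ξ hξ
    rw [integral_withDensity_eq_integral_toReal_smul hdm (Filter.Eventually.of_forall fun x => ENNReal.ofReal_lt_top)]
    set v : E3 := (2 * Real.pi)⁻¹ • ξ with hv
    have hξv : ξ = (2 * Real.pi) • v := by rw [hv, smul_smul, mul_inv_cancel₀ (by positivity), one_smul]
    have h1 := SchwartzMap.integral_inner_fourier_fourier (φ.compSubConstCLM ℂ v) φ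
    have h2 : ∀ x, inner ℂ (𝓕 (φ.compSubConstCLM ℂ v) x) (𝓕 φ x) = (d x).toReal • wave ξ x := by
      intro x
      rw [fourier_compSubConst, RCLike.inner_apply, map_mul, conj_wave, neg_smul, neg_neg, ← hξv, hd]
      simp only
      rw [ENNReal.toReal_ofReal (by positivity), Complex.real_smul, mul_left_comm, mul_comm,
        Complex.mul_conj']
      push_cast; ring
    simp only [h2] at h1
    rw [h1]
    refine integral_eq_zero_of_ae (Filter.Eventually.of_forall fun x => ?_)
    simp only [Pi.zero_apply, SchwartzMap.compSubConstCLM_apply]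
    by_cases hx : r ≤ ‖x‖
    · rw [hφ0 x hx, inner_zero_right]
    · rw [hφ0 (x - v), inner_zero_left]
      have hvn : 2 * r ≤ ‖v‖ := by
        rw [hv, norm_smul, Real.norm_of_nonneg (by positivity), hr]
        calc 2 * (1 / (8 * Real.pi)) ≤ (2 * Real.pi)⁻¹ * 1 := by
              rw [mul_one_div, mul_one, ← one_div, div_le_div_iff₀ (by positivity) (by positivity)]
              linarith
          _ ≤ _ := by gcongr
      have := norm_sub_norm_le v x
      rw [norm_sub_rev]
      push Not at hx
      linarith
  · set I : ℝ := ∫ x, bump x with hI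
    have hI0 : 0 < I := bump.integral_pos
    have hbi : Integrable (fun x => bump x) := bump.continuous.integrable_of_hasCompactSupport bump.hasCompactSupport
    have hlow : ∀ x ∈ closedBall (0 : E3) 2, I / 2 ≤ ‖𝓕 φ x‖ := by
      intro x hx
      have hx2 : ‖x‖ ≤ 2 := by simpa using hx
      have hb : ∀ y, ‖Complex.exp ((-2 * Real.pi * ⟪y, x⟫ : ℝ) * Complex.I) * φ y - φ y‖ ≤ bump y / 2 := by
        intro y
        by_cases hy : r ≤ ‖y‖
        · rw [hφ0 y hy]; simpa using div_nonneg (bump.nonneg' y) zero_le_two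
        · push Not at hy
          rw [← sub_one_mul, norm_mul, hφv, Complex.norm_real, Real.norm_of_nonneg (bump.nonneg' y),
            mul_comm, div_eq_mul_inv]
          refine mul_le_mul_of_nonneg_left ?_ (bump.nonneg' y)
          have h1 := Real.norm_exp_I_mul_ofReal_sub_one_le (x := -2 * Real.pi * ⟪y, x⟫)
          rw [mul_comm] at h1
          refine h1.trans ?_
          rw [norm_mul, norm_mul, norm_neg, Real.norm_of_nonneg hπ.le]
          have h3 : ‖⟪y, x⟫‖ ≤ r * 2 := (norm_inner_le_norm y x).trans (by gcongr)
          calc ‖(2 : ℝ)‖ * Real.pi * ‖⟪y, x⟫‖ ≤ 2 * Real.pi * (r * 2) := by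
                rw [Real.norm_ofNat]; gcongr
            _ = 2⁻¹ := by rw [hr]; field_simp; norm_num
      have hφi : Integrable (φ : E3 → ℂ) := φ.integrable
      have hei : Integrable (fun y => Complex.exp ((-2 * Real.pi * ⟪y, x⟫ : ℝ) * Complex.I) * φ y) := by
        refine hφi.bdd_mul (c := 1) (by fun_prop) (Filter.Eventually.of_forall fun y => ?_)
        rw [Complex.norm_exp_ofReal_mul_I]
      have h4 : ‖𝓕 φ x - I‖ ≤ I / 2 := by
        have e : 𝓕 φ x - I = ∫ y, (Complex.exp ((-2 * Real.pi * ⟪y, x⟫ : ℝ) * Complex.I) * φ y - φ y) := by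
          rw [integral_sub hei hφi, SchwartzMap.fourier_coe, Real.fourier_eq', hI, ← integral_complex_ofReal]
          rfl
        rw [e]
        refine (norm_integral_le_of_norm_le (hbi.div_const 2) (Filter.Eventually.of_forall hb)).trans ?_
        rw [integral_div]
      have h5 := norm_sub_norm_le (I : ℂ) (𝓕 φ x)
      rw [norm_sub_rev, Complex.norm_real, Real.norm_of_nonneg hI0.le] at h5
      linarith
    set A : ℝ≥0 := Real.toNNReal ((I / 2) ^ 2)⁻¹ with hA
    refine ⟨A, ?_⟩
    rw [Measure.le_iff]
    intro s hs
    rw [Measure.smul_apply, withDensity_apply _ hs, Measure.restrict_apply hs, ENNReal.smul_def,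
      smul_eq_mul, ← lintegral_const_mul _ hdm, ← setLIntegral_one]
    refine (setLIntegral_mono' (hs.inter measurableSet_closedBall) fun x hx => ?_).trans
      (lintegral_mono_set inter_subset_left)
    rw [hA, hd, ENNReal.ofNNReal_toNNReal, ← ENNReal.ofReal_mul (by positivity), ← ENNReal.ofReal_one]
    refine ENNReal.ofReal_le_ofReal ?_
    rw [← div_eq_inv_mul, le_div_iff₀ (by positivity), one_mul]
    exact pow_le_pow_left₀ (by positivity) (hlow x hx.2) 2

/-! ### Trigonometric polynomials -/

/-- Lebesgue measure on a period of the circle. -/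
def circ : Measure ℝ := volume.restrict (Ioc (-Real.pi) Real.pi)

instance : IsFiniteMeasure circ := by unfold circ; infer_instance

/-- The character `t ↦ e^{ikt}`. -/
def expo (k : ℤ) (t : ℝ) : ℂ := Complex.exp ((k * t : ℝ) * Complex.I)

lemma norm_expo (k : ℤ) (t : ℝ) : ‖expo k t‖ = 1 := Complex.norm_exp_ofReal_mul_I _

lemma expo_add (k l : ℤ) (t : ℝ) : expo (k + l) t = expo k t * expo l t := by
  rw [expo, expo, expo, ← Complex.exp_add]; push_cast; ring_nf

lemma expo_add_right (k : ℤ) (s t : ℝ) : expo k (s + t) = expo k s * expo k t := by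
  rw [expo, expo, expo, ← Complex.exp_add]; push_cast; ring_nf

lemma conj_expo (k : ℤ) (t : ℝ) : (starRingEnd ℂ) (expo k t) = expo (-k) t := by
  rw [expo, expo, ← Complex.exp_conj]; simp

lemma expo_neg_right (k : ℤ) (t : ℝ) : expo k (-t) = expo (-k) t := by
  rw [expo, expo]; push_cast; ring_nf

lemma continuous_expo (k : ℤ) : Continuous (expo k) := by unfold expo; fun_prop

lemma isBddMeas_const_mul_expo (c : ℂ) (k : ℤ) : IsBddMeas (fun t => c * expo k t) :=
  ⟨(continuous_const.mul (continuous_expo k)).measurable, ‖c‖, fun t => by simp [norm_expo]⟩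

lemma periodic_expo (k : ℤ) : Function.Periodic (expo k) (2 * Real.pi) := by
  intro t
  rw [expo_add_right]
  have : expo k (2 * Real.pi) = 1 := by
    rw [expo]; convert Complex.exp_int_mul_two_pi_mul_I k using 2; push_cast; ring
  rw [this, mul_one]

lemma integral_circ_eq {E : Type} [NormedAddCommGroup E] [NormedSpace ℝ E] (f : ℝ → E) :
    ∫ t, f t ∂circ = ∫ t in (-Real.pi)..Real.pi, f t := by
  rw [circ, intervalIntegral.integral_of_le (by linarith [Real.pi_pos])]

lemma integral_expo {k : ℤ} (hk : k ≠ 0) : ∫ t, expo k t ∂circ = 0 := by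
  rw [integral_circ_eq]
  have h1 : ∀ t : ℝ, expo k t = Complex.exp ((k * Complex.I) * t) := fun t => by
    rw [expo]; push_cast; ring_nf
  simp_rw [h1]
  rw [integral_exp_mul_complex (by simpa using hk)]
  have h2 := periodic_expo k (-Real.pi)
  rw [show -Real.pi + 2 * Real.pi = Real.pi by ring, h1, h1] at h2
  rw [h2]; simp

lemma integral_circ_sub {f : ℝ → ℝ} (hf : Function.Periodic f (2 * Real.pi)) (t : ℝ) :
    ∫ s, f (t - s) ∂circ = ∫ s, f s ∂circ := by
  rw [integral_circ_eq, integral_circ_eq, intervalIntegral.integral_comp_sub_left]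
  have := hf.intervalIntegral_add_eq (t - Real.pi) (-Real.pi)
  convert this using 2 <;> ring

lemma circ_real_univ : circ.real univ = 2 * Real.pi := by
  rw [Measure.real, circ, Measure.restrict_apply_univ, Real.volume_Ioc, ENNReal.toReal_ofReal
    (by linarith [Real.pi_pos])]; ring

/-- The trigonometric polynomial with coefficients `κ` and spectrum in `S`. -/
def trig (S : Finset ℤ) (κ : ℤ → ℂ) (t : ℝ) : ℂ := ∑ k ∈ S, κ k * expo k t

lemma isBddMeas_trig (S : Finset ℤ) (κ : ℤ → ℂ) : IsBddMeas (trig S κ) :=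
  IsBddMeas.sum S fun k => isBddMeas_const_mul_expo (κ k) k

lemma continuous_trig (S : Finset ℤ) (κ : ℤ → ℂ) : Continuous (trig S κ) := by
  unfold trig
  exact continuous_finsetSum _ fun k _ => continuous_const.mul (continuous_expo k)

lemma periodic_trig (S : Finset ℤ) (κ : ℤ → ℂ) : Function.Periodic (trig S κ) (2 * Real.pi) := by
  intro t; simp only [trig, periodic_expo _ t]

lemma integral_norm_trig_sq_le (S : Finset ℤ) (κ : ℤ → ℂ) :
    ∫ t, ‖trig S κ t‖ ^ 2 ∂circ ≤ 2 * Real.pi * ∑ k ∈ S, ‖κ k‖ ^ 2 := by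
  have h := integral_norm_sum_sq_le circ 0 S (fun k t => κ k * expo k t)
    (fun k => isBddMeas_const_mul_expo (κ k) k) (by
      intro k _ l _ hkl
      have : (fun t => κ k * expo k t * (starRingEnd ℂ) (κ l * expo l t))
          = fun t => κ k * (starRingEnd ℂ) (κ l) * expo (k - l) t := by
        funext t
        rw [map_mul, conj_expo, sub_eq_add_neg, expo_add]; ring
      rw [this, integral_const_mul, integral_expo, mul_zero]
      intro h; rw [h] at hkl; simp at hkl)
  refine h.trans (le_of_eq ?_)
  simp only [norm_mul, norm_expo, mul_one, integral_const, circ_real_univ, smul_eq_mul]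
  rw [← Finset.mul_sum]; simp

/-- Bessel's inequality. -/
lemma sum_norm_integral_mul_expo_sq_le (S : Finset ℤ) {g : ℝ → ℂ} (hg : IsBddMeas g) :
    ∑ k ∈ S, ‖∫ t, g t * expo k t ∂circ‖ ^ 2 ≤ 2 * Real.pi * ∫ t, ‖g t‖ ^ 2 ∂circ := by
  set c : ℤ → ℂ := fun k => ∫ t, g t * expo k t ∂circ with hc
  set T := trig S fun k => (starRingEnd ℂ) (c k) with hT
  set X : ℝ := ∑ k ∈ S, ‖c k‖ ^ 2 with hX
  have hTb : IsBddMeas T := isBddMeas_trig _ _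
  have h1 : ∫ t, g t * T t ∂circ = (X : ℂ) := by
    have : (fun t => g t * T t) = fun t => ∑ k ∈ S, (starRingEnd ℂ) (c k) * (g t * expo k t) := by
      funext t
      rw [hT, trig, Finset.mul_sum]
      exact Finset.sum_congr rfl fun k _ => by ring
    rw [this, integral_finsetSum]
    · rw [hX]; push_cast
      refine Finset.sum_congr rfl fun k _ => ?_
      rw [integral_const_mul, mul_comm, Complex.mul_conj, Complex.normSq_eq_norm_sq]; push_cast; rfl
    · intro k _
      have := (hg.mul (isBddMeas_const_mul_expo 1 k)).integrable circ
      simp only [one_mul] at this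
      exact this.const_mul _
  have hX0 : 0 ≤ X := Finset.sum_nonneg fun k _ => by positivity
  have h2 : X ≤ ∫ t, ‖g t‖ * ‖T t‖ ∂circ := by
    have := norm_integral_le_integral_norm (μ := circ) (fun t => g t * T t)
    rw [h1, Complex.norm_real, Real.norm_of_nonneg hX0] at this
    simpa only [norm_mul] using this
  have h3 := sq_integral_mul_le circ (u := fun t => ‖g t‖) (v := fun t => ‖T t‖)
    (hg.integrable_norm_pow circ 2) (hTb.integrable_norm_pow circ 2)
    (by simpa using hg.integrable_norm_pow_mul hTb circ 1 1)
  have h4 : ∫ t, ‖T t‖ ^ 2 ∂circ ≤ 2 * Real.pi * X := by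
    refine (integral_norm_trig_sq_le _ _).trans (le_of_eq ?_)
    simp [hX]
  have h5 : 0 ≤ ∫ t, ‖g t‖ ^ 2 ∂circ := integral_nonneg fun t => by positivity
  have h6 : X ^ 2 ≤ (∫ t, ‖g t‖ ^ 2 ∂circ) * (2 * Real.pi * X) :=
    (pow_le_pow_left₀ hX0 h2 2).trans (h3.trans (mul_le_mul_of_nonneg_left h4 h5))
  rcases hX0.eq_or_lt with h | h
  · rw [← h]; have := Real.pi_pos; positivity
  · refine le_of_mul_le_mul_right ?_ h
    nlinarith

lemma sq_mul_le_norm_expo_sub_one_sq {t : ℝ} (ht : |t| ≤ Real.pi) :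
    4 / Real.pi ^ 2 * t ^ 2 ≤ ‖expo 1 t - 1‖ ^ 2 := by
  have h := Real.cos_le_one_sub_mul_cos_sq ht
  have h2 : ‖expo 1 t - 1‖ ^ 2 = 2 - 2 * Real.cos t := by
    rw [← Complex.normSq_eq_norm_sq, Complex.normSq_apply, expo]
    simp only [Int.cast_one, one_mul, Complex.sub_re, Complex.sub_im, Complex.one_re, Complex.one_im,
      Complex.exp_ofReal_mul_I_re, Complex.exp_ofReal_mul_I_im]
    nlinarith [Real.sin_sq_add_cos_sq t]
  rw [h2]
  have h3 : 4 / Real.pi ^ 2 * t ^ 2 = 2 * (2 / Real.pi ^ 2 * t ^ 2) := by ring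
  linarith

/-- A trigonometric polynomial whose coefficients vary slowly has bounded `L¹` norm. -/
lemma integral_norm_trig_le {H B : ℝ} (hH : 0 < H) (S : Finset ℤ) (κ : ℤ → ℂ)
    (hS : ∀ k, κ k ≠ 0 → k ∈ S) (hcard : (S.card : ℝ) ≤ 3 * H) (hB : ∀ k, ‖κ k‖ ≤ B)
    (hLip : ∀ k, ‖κ (k + 1) - κ k‖ ≤ B / H) : ∫ t, ‖trig S κ t‖ ∂circ ≤ 24 * B := by
  have hB0 : 0 ≤ B := (norm_nonneg _).trans (hB 0)
  set S' := S ∪ S.image (· + 1) with hS'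
  have hc' : (S'.card : ℝ) ≤ 6 * H := by
    have h1 : S'.card ≤ S.card + S.card :=
      (Finset.card_union_le _ _).trans (Nat.add_le_add_left Finset.card_image_le _)
    have h2 : (S'.card : ℝ) ≤ S.card + S.card := by exact_mod_cast h1
    linarith
  have hdiff : ∀ t, trig S κ t * (expo 1 t - 1) = trig S' (fun k => κ (k - 1) - κ k) t := by
    intro t
    have e1 : trig S κ t = ∑ k ∈ S', κ k * expo k t := by
      refine Finset.sum_subset Finset.subset_union_left fun k _ hk => ?_
      rw [not_imp_comm.1 (hS k) hk, zero_mul]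
    have e2 : trig S κ t * expo 1 t = ∑ k ∈ S', κ (k - 1) * expo k t := by
      have : trig S κ t * expo 1 t = ∑ k ∈ S.image (· + 1), κ (k - 1) * expo k t := by
        rw [Finset.sum_image (fun _ _ _ _ h => by simpa using h), trig, Finset.sum_mul]
        refine Finset.sum_congr rfl fun k _ => ?_
        rw [add_sub_cancel_right, expo_add]; ring
      rw [this]
      refine Finset.sum_subset Finset.subset_union_right fun k _ hk => ?_
      rw [not_imp_comm.1 (hS (k - 1)), zero_mul]
      intro h
      exact hk (Finset.mem_image.2 ⟨k - 1, h, by ring⟩)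
    rw [mul_sub, mul_one, e2, e1, trig, ← Finset.sum_sub_distrib]
    exact Finset.sum_congr rfl fun k _ => by ring
  have hpi := Real.pi_pos
  have hT := isBddMeas_trig S κ
  have hE : IsBddMeas (fun t => expo 1 t - 1) := by
    refine ⟨((continuous_expo 1).sub continuous_const).measurable, 2, fun t => ?_⟩
    refine (norm_sub_le _ _).trans ?_
    rw [norm_expo]; norm_num
  have hI1 : ∫ t, ‖trig S κ t‖ ^ 2 ∂circ ≤ 2 * Real.pi * (3 * H * B ^ 2) := by
    refine (integral_norm_trig_sq_le _ _).trans (mul_le_mul_of_nonneg_left ?_ (by positivity))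
    calc ∑ k ∈ S, ‖κ k‖ ^ 2 ≤ ∑ k ∈ S, B ^ 2 :=
          Finset.sum_le_sum fun k _ => pow_le_pow_left₀ (norm_nonneg _) (hB k) 2
      _ = S.card * B ^ 2 := by simp
      _ ≤ _ := by gcongr
  have hI2 : ∫ t, ‖trig S κ t‖ ^ 2 * ‖expo 1 t - 1‖ ^ 2 ∂circ
      ≤ 2 * Real.pi * (6 * H * (B / H) ^ 2) := by
    have : (fun t => ‖trig S κ t‖ ^ 2 * ‖expo 1 t - 1‖ ^ 2)
        = fun t => ‖trig S' (fun k => κ (k - 1) - κ k) t‖ ^ 2 := by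
      funext t; rw [← mul_pow, ← norm_mul, hdiff]
    rw [this]
    refine (integral_norm_trig_sq_le _ _).trans (mul_le_mul_of_nonneg_left ?_ (by positivity))
    calc ∑ k ∈ S', ‖κ (k - 1) - κ k‖ ^ 2 ≤ ∑ k ∈ S', (B / H) ^ 2 :=
          Finset.sum_le_sum fun k _ => pow_le_pow_left₀ (norm_nonneg _) (by
            have := hLip (k - 1)
            rwa [sub_add_cancel, norm_sub_rev] at this) 2
      _ = S'.card * (B / H) ^ 2 := by simp
      _ ≤ _ := by gcongr
  set q : ℝ → ℝ := fun t => 1 + (2 * H / Real.pi * t) ^ 2 with hq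
  have hq0 : ∀ t, 0 < q t := fun t => by positivity
  have hqc : Continuous q := by fun_prop
  have hqi : Integrable (fun t => (q t)⁻¹) :=
    integrable_inv_one_add_sq.comp_mul_left' (by positivity : 2 * H / Real.pi ≠ 0)
  have hI3 : ∫ t, (q t)⁻¹ ∂circ ≤ Real.pi ^ 2 / (2 * H) := by
    calc ∫ t, (q t)⁻¹ ∂circ ≤ ∫ t, (q t)⁻¹ :=
          setIntegral_le_integral hqi (Filter.Eventually.of_forall fun t => (inv_pos.2 (hq0 t)).le)
      _ = |(2 * H / Real.pi)⁻¹| • ∫ t : ℝ, (1 + t ^ 2)⁻¹ :=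
          Measure.integral_comp_mul_left (fun t : ℝ => (1 + t ^ 2)⁻¹) (2 * H / Real.pi)
      _ = Real.pi ^ 2 / (2 * H) := by
          rw [integral_univ_inv_one_add_sq, abs_of_pos (by positivity), smul_eq_mul]
          field_simp
  have hqb : ∀ t ∈ Ioc (-Real.pi) Real.pi, q t ≤ 1 + H ^ 2 * ‖expo 1 t - 1‖ ^ 2 := by
    intro t ht
    have := sq_mul_le_norm_expo_sub_one_sq (abs_le.2 ⟨ht.1.le, ht.2⟩)
    have h2 := mul_le_mul_of_nonneg_left this (sq_nonneg H)
    have h3 : (2 * H / Real.pi * t) ^ 2 = H ^ 2 * (4 / Real.pi ^ 2 * t ^ 2) := by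
      field_simp; ring
    rw [hq]; dsimp only; rw [h3]; linarith
  have hi1 : Integrable (fun t => ‖trig S κ t‖ ^ 2) circ := hT.integrable_norm_pow circ 2
  have hi2 : Integrable (fun t => ‖trig S κ t‖ ^ 2 * ‖expo 1 t - 1‖ ^ 2) circ :=
    hT.integrable_norm_pow_mul hE circ 2 2
  have hi3 : Integrable (fun t => ‖trig S κ t‖ ^ 2 + H ^ 2 * (‖trig S κ t‖ ^ 2 * ‖expo 1 t - 1‖ ^ 2))
      circ := hi1.add (hi2.const_mul _)
  have hqbae : ∀ᵐ t ∂circ, ‖trig S κ t‖ ^ 2 * q t ≤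
      ‖trig S κ t‖ ^ 2 + H ^ 2 * (‖trig S κ t‖ ^ 2 * ‖expo 1 t - 1‖ ^ 2) := by
    filter_upwards [ae_restrict_mem measurableSet_Ioc] with t ht
    have := mul_le_mul_of_nonneg_left (hqb t ht) (sq_nonneg ‖trig S κ t‖)
    linarith
  have hTq : Continuous fun t => ‖trig S κ t‖ ^ 2 * q t := by
    have := continuous_trig S κ; fun_prop
  have hi4 : Integrable (fun t => ‖trig S κ t‖ ^ 2 * q t) circ :=
    hi3.mono' hTq.aestronglyMeasurable (by
      filter_upwards [hqbae] with t ht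
      rwa [Real.norm_of_nonneg (mul_nonneg (sq_nonneg _) (hq0 t).le)])
  have hI4 : ∫ t, ‖trig S κ t‖ ^ 2 * q t ∂circ ≤ 18 * Real.pi * H * B ^ 2 := by
    calc _ ≤ _ := integral_mono_ae hi4 hi3 hqbae
      _ = _ := by rw [integral_add hi1 (hi2.const_mul _), integral_const_mul]
      _ ≤ 2 * Real.pi * (3 * H * B ^ 2) + H ^ 2 * (2 * Real.pi * (6 * H * (B / H) ^ 2)) := by gcongr
      _ = _ := by field_simp; ring
  have hcs := sq_integral_mul_le circ (u := fun t => ‖trig S κ t‖ * √(q t)) (v := fun t => (√(q t))⁻¹)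
    (by simpa only [mul_pow, Real.sq_sqrt (hq0 _).le] using hi4)
    (by simp only [inv_pow, Real.sq_sqrt (hq0 _).le]; exact hqi.restrict)
    (by
      have : (fun t => ‖trig S κ t‖ * √(q t) * (√(q t))⁻¹) = fun t => ‖trig S κ t‖ := by
        funext t; rw [mul_inv_cancel_right₀ (Real.sqrt_pos.2 (hq0 t)).ne']
      rw [this]
      simpa using hT.integrable_norm_pow circ 1)
  simp only [mul_inv_cancel_right₀ (Real.sqrt_pos.2 (hq0 _)).ne', mul_pow, inv_pow,
    Real.sq_sqrt (hq0 _).le] at hcs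
  refine le_of_sq_le_sq ?_ (by positivity)
  calc _ ≤ _ := hcs
    _ ≤ 18 * Real.pi * H * B ^ 2 * (Real.pi ^ 2 / (2 * H)) := by
      refine mul_le_mul hI4 hI3 (integral_nonneg fun t => (inv_pos.2 (hq0 t)).le) (by positivity)
    _ = 9 * Real.pi ^ 3 * B ^ 2 := by field_simp; ring
    _ ≤ 9 * 4 ^ 3 * B ^ 2 := by gcongr; exact Real.pi_le_four
    _ ≤ (24 * B) ^ 2 := by nlinarith [sq_nonneg B]

/-! ### Duality for smoothed projections -/

lemma lintegral_pow_six_le {X : Type} [MeasurableSpace X] (m : Measure X) {f : X → ℝ≥0∞}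
    (hf : Measurable f) : (∫⁻ x, f x ∂m) ^ 6 ≤ m univ ^ 5 * ∫⁻ x, f x ^ 6 ∂m := by
  have h := ENNReal.lintegral_mul_le_Lp_mul_Lq m (p := 6) (q := 6 / 5)
    ⟨by norm_num, by norm_num, by norm_num⟩ hf.aemeasurable (aemeasurable_const (b := (1 : ℝ≥0∞)))
  simp only [Pi.mul_apply, mul_one, ENNReal.one_rpow, lintegral_const, one_mul] at h
  refine (pow_le_pow_left' h 6).trans (le_of_eq ?_)
  rw [mul_pow, ← ENNReal.rpow_mul_natCast, ← ENNReal.rpow_mul_natCast, mul_comm]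
  congr 1
  · rw [← ENNReal.rpow_natCast]; norm_num
  · norm_num

/-- The uniform probability measure on the ball of radius `r`. -/
def ballAvg (r : ℝ) : Measure E3 := ProbabilityTheory.cond volume (ball 0 r)

lemma isProbabilityMeasure_ballAvg {r : ℝ} (hr : 0 < r) : IsProbabilityMeasure (ballAvg r) :=
  ProbabilityTheory.cond_isProbabilityMeasure_of_finite (measure_ball_pos _ _ hr).ne'
    measure_ball_lt_top.ne

lemma ae_ballAvg_mem (r : ℝ) : ∀ᵐ y ∂(ballAvg r), y ∈ ball (0 : E3) r :=
  ProbabilityTheory.ae_cond_mem measurableSet_ball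

/-- Averaging a Frostman measure over balls gives a measure with bounded density. -/
lemma lintegral_lintegral_ball_le {μ m : Measure E3} [SFinite μ] {α c r : ℝ} {A : ℝ≥0}
    (hA : volume.restrict (closedBall (0 : E3) 2) ≤ A • m) (hμ : μ (closedBall 0 1)ᶜ = 0)
    (hc : ∀ x : E3, ∀ r > 0, μ (ball x r) ≤ ENNReal.ofReal (c * r ^ α)) (hr : 0 < r) (hr1 : r ≤ 1)
    {h : E3 → ℝ≥0∞} (hh : Measurable h) :
    ∫⁻ x, ∫⁻ y in ball 0 r, h (x + y) ∂volume ∂μ ≤ ENNReal.ofReal (c * r ^ α) * (A * ∫⁻ z, h z ∂m) := by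
  have hmeas : MeasurableSet {q : E3 × E3 | dist q.2 q.1 < r} :=
    (isOpen_lt (by fun_prop) continuous_const).measurableSet
  have h1 : ∀ x ∈ closedBall (0 : E3) 1, ∫⁻ y in ball 0 r, h (x + y) ≤
      ∫⁻ z in closedBall 0 2, {q : E3 × E3 | dist q.2 q.1 < r}.indicator (fun q => h q.2) (x, z) := by
    intro x hx
    rw [← lintegral_indicator measurableSet_ball, ← lintegral_indicator measurableSet_closedBall,
      ← lintegral_add_left_eq_self ((closedBall (0 : E3) 2).indicator _) x]
    refine lintegral_mono fun y => ?_
    by_cases hy : y ∈ ball (0 : E3) r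
    · have h2 : x + y ∈ closedBall (0 : E3) 2 := by
        rw [mem_closedBall_zero_iff] at *
        rw [mem_ball_zero_iff] at hy
        exact (norm_add_le _ _).trans (by linarith)
      have h3 : (x, x + y) ∈ {q : E3 × E3 | dist q.2 q.1 < r} := by
        simpa using hy
      rw [indicator_of_mem hy, indicator_of_mem h2, indicator_of_mem h3]
    · rw [indicator_of_notMem hy]; exact zero_le
  have hae : ∀ᵐ x ∂μ, x ∈ closedBall (0 : E3) 1 := hμ
  calc ∫⁻ x, ∫⁻ y in ball 0 r, h (x + y) ∂volume ∂μ
      ≤ ∫⁻ x, ∫⁻ z in closedBall 0 2,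
          {q : E3 × E3 | dist q.2 q.1 < r}.indicator (fun q => h q.2) (x, z) ∂volume ∂μ :=
        lintegral_mono_ae (by filter_upwards [hae] with x hx using h1 x hx)
    _ = ∫⁻ z in closedBall 0 2, ∫⁻ x,
          {q : E3 × E3 | dist q.2 q.1 < r}.indicator (fun q => h q.2) (x, z) ∂μ ∂volume :=
        lintegral_lintegral_swap (f := fun x z =>
          {q : E3 × E3 | dist q.2 q.1 < r}.indicator (fun q => h q.2) (x, z)) ((hh.comp measurable_snd).indicator hmeas).aemeasurable
    _ ≤ ∫⁻ z in closedBall 0 2, ENNReal.ofReal (c * r ^ α) * h z := by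
        refine lintegral_mono fun z => ?_
        have : (fun x => {q : E3 × E3 | dist q.2 q.1 < r}.indicator (fun q => h q.2) (x, z))
            = (ball z r).indicator fun _ => h z := by
          funext x
          simp only [indicator_apply, mem_ofPred_eq, mem_ball, dist_comm]
        rw [this, lintegral_indicator measurableSet_ball, setLIntegral_const, mul_comm]
        gcongr
        exact hc z r hr
    _ ≤ ENNReal.ofReal (c * r ^ α) * (A * ∫⁻ z, h z ∂m) := by
        rw [lintegral_const_mul _ hh]
        gcongr
        refine (lintegral_mono' hA le_rfl).trans (le_of_eq ?_)
        rw [lintegral_smul_measure]; rfl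

lemma exists_lintegral_ballAvg_le {m : Measure E3} {A : ℝ≥0}
    (hA : volume.restrict (closedBall (0 : E3) 2) ≤ A • m) :
    ∃ D : ℝ, 0 < D ∧ ∀ (μ : Measure E3) (α c r : ℝ), SFinite μ → μ (closedBall 0 1)ᶜ = 0 →
    (∀ x : E3, ∀ r > 0, μ (ball x r) ≤ ENNReal.ofReal (c * r ^ α)) → 0 ≤ c → 0 < r → r ≤ 1 →
    ∀ h : E3 → ℝ≥0∞, Measurable h →
    ∫⁻ x, ∫⁻ y, h (x + y) ∂(ballAvg r) ∂μ ≤ ENNReal.ofReal (D * c * r ^ (α - 3)) * ∫⁻ z, h z ∂m := by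
  set v := (volume : Measure E3).real (ball 0 1) with hv
  have hv0 : 0 < v := ENNReal.toReal_pos (measure_ball_pos _ _ one_pos).ne' measure_ball_lt_top.ne
  refine ⟨(A + 1) / v, by positivity, fun μ α c r _ hμ hc hc0 hr hr1 h hh => ?_⟩
  have hvol : (volume : Measure E3) (ball 0 r) = ENNReal.ofReal (r ^ 3 * v) := by
    rw [Measure.addHaar_ball _ _ hr.le, ENNReal.ofReal_mul (by positivity), hv, Measure.real,
      ENNReal.ofReal_toReal measure_ball_lt_top.ne]
    simp
  have h1 : ∀ x, ∫⁻ y, h (x + y) ∂(ballAvg r)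
      = ENNReal.ofReal ((r ^ 3 * v)⁻¹) * ∫⁻ y in ball 0 r, h (x + y) := by
    intro x
    rw [ballAvg, ProbabilityTheory.cond, lintegral_smul_measure, hvol, smul_eq_mul,
      ENNReal.ofReal_inv_of_pos (by positivity)]
  simp_rw [h1]
  have hmeas : Measurable fun x => ∫⁻ y in ball (0 : E3) r, h (x + y) :=
    Measurable.lintegral_prod_right' (f := fun q : E3 × E3 => h (q.1 + q.2))
      (hh.comp (measurable_fst.add measurable_snd))
  rw [lintegral_const_mul _ hmeas]
  calc _ ≤ ENNReal.ofReal ((r ^ 3 * v)⁻¹) *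
        (ENNReal.ofReal (c * r ^ α) * (ENNReal.ofReal (A + 1) * ∫⁻ z, h z ∂m)) := by
        gcongr
        refine (lintegral_lintegral_ball_le hA hμ hc hr hr1 hh).trans ?_
        gcongr
        rw [← ENNReal.ofReal_coe_nnreal]
        exact ENNReal.ofReal_le_ofReal (by linarith)
    _ = _ := by
        rw [← mul_assoc, ← mul_assoc, ← ENNReal.ofReal_mul (by positivity),
          ← ENNReal.ofReal_mul (by positivity)]
        congr 2
        rw [Real.rpow_sub hr]
        norm_num
        field_simp

lemma norm_wave_sub_one_le (ξ x : E3) : ‖wave ξ x - 1‖ ≤ ‖x‖ * ‖ξ‖ := by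
  have := Real.norm_exp_I_mul_ofReal_sub_one_le (x := ⟪x, ξ⟫)
  rw [mul_comm] at this
  exact this.trans (norm_inner_le_norm x ξ)

lemma wave_add_right (ξ x y : E3) : wave ξ (x + y) = wave ξ x * wave ξ y := by
  rw [wave, wave, wave, ← Complex.exp_add, inner_add_left]
  push_cast; ring_nf

/-- The Fourier transform of the uniform measure on the ball of radius `r`. -/
def ballHat (r : ℝ) (ξ : E3) : ℂ := ∫ y, wave ξ y ∂(ballAvg r)

lemma integrable_wave (m : Measure E3) [IsFiniteMeasure m] (ξ : E3) : Integrable (wave ξ) m := by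
  simpa using (isBddMeas_const_mul_wave 1 ξ).integrable m

lemma norm_ballHat_sub_le {r : ℝ} (hr : 0 < r) (ξ η : E3) :
    ‖ballHat r ξ - ballHat r η‖ ≤ r * ‖ξ - η‖ := by
  have := isProbabilityMeasure_ballAvg hr
  rw [ballHat, ballHat, ← integral_sub (integrable_wave _ _) (integrable_wave _ _)]
  have := norm_integral_le_of_norm_le_const (μ := ballAvg r) (C := r * ‖ξ - η‖)
    (f := fun y => wave ξ y - wave η y) (by
      filter_upwards [ae_ballAvg_mem r] with y hy
      have e : wave ξ y - wave η y = wave η y * (wave (ξ - η) y - 1) := by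
        rw [mul_sub, wave_mul, mul_one]; congr 2; abel
      rw [e, norm_mul, norm_wave, one_mul]
      refine (norm_wave_sub_one_le _ _).trans ?_
      gcongr
      exact (mem_ball_zero_iff.1 hy).le)
  simpa using this

lemma ballHat_zero {r : ℝ} (hr : 0 < r) : ballHat r 0 = 1 := by
  have := isProbabilityMeasure_ballAvg hr
  simp [ballHat, wave]

lemma half_le_norm_ballHat {r : ℝ} (hr : 0 < r) {ξ : E3} (hξ : r * ‖ξ‖ ≤ 1 / 2) :
    1 / 2 ≤ ‖ballHat r ξ‖ := by
  have h := norm_ballHat_sub_le hr 0 ξ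
  rw [ballHat_zero hr, zero_sub, norm_neg] at h
  have h2 := norm_sub_norm_le (1 : ℂ) (ballHat r ξ)
  rw [norm_one] at h2
  linarith

/-- The convolution of `T` with the image of `μ` under `x ↦ ⟪x, u⟫`. -/
def projTrig (μ : Measure E3) (S : Finset ℤ) (κ : ℤ → ℂ) (u : E3) (t : ℝ) : ℂ :=
  ∫ x, trig S κ (t - ⟪x, u⟫) ∂μ

lemma expo_inner (k : ℤ) (u x : E3) : expo k ⟪x, u⟫ = wave ((k : ℝ) • u) x :=
  (wave_smul_eq k u x).symm

lemma norm_div_sub_div_le {κ b : ℤ → ℂ} {L δ : ℝ} (hL : ∀ k, ‖κ (k + 1) - κ k‖ ≤ L)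
    (hb : ∀ k, κ k ≠ 0 → 1 / 2 ≤ ‖b k‖) (hκ : ∀ k, ‖κ k‖ ≤ 1) (hδ : ∀ k, ‖b (k + 1) - b k‖ ≤ δ)
    (k : ℤ) : ‖κ (k + 1) / b (k + 1) - κ k / b k‖ ≤ 2 * L + 4 * δ := by
  have hδ0 : 0 ≤ δ := (norm_nonneg _).trans (hδ 0)
  have key : ∀ j, ‖κ j / b j‖ ≤ 2 * ‖κ j‖ := by
    intro j
    rcases eq_or_ne (κ j) 0 with h | h
    · simp [h]
    · have := hb j h
      rw [norm_div, div_le_iff₀ (by linarith)]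
      nlinarith [norm_nonneg (κ j)]
  rcases eq_or_ne (κ k) 0 with h0 | h0
  · have h1 := hL k
    have h2 := key (k + 1)
    rw [h0, sub_zero] at h1
    rw [h0, zero_div, sub_zero]
    linarith
  rcases eq_or_ne (κ (k + 1)) 0 with h1 | h1
  · have h2 := hL k
    have h3 := key k
    rw [h1, zero_sub, norm_neg] at h2
    rw [h1, zero_div, zero_sub, norm_neg]
    linarith
  have hb0 := hb k h0
  have hb1 := hb (k + 1) h1
  have hb0' : b k ≠ 0 := norm_pos_iff.1 (by linarith)
  have hb1' : b (k + 1) ≠ 0 := norm_pos_iff.1 (by linarith)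
  have e : κ (k + 1) / b (k + 1) - κ k / b k
      = (κ (k + 1) - κ k) / b (k + 1) - (κ k / b k) * ((b (k + 1) - b k) / b (k + 1)) := by
    field_simp; ring
  have h2 : ∀ z : ℂ, ‖z / b (k + 1)‖ ≤ 2 * ‖z‖ := by
    intro z
    rw [norm_div, div_le_iff₀ (by linarith)]
    nlinarith [norm_nonneg z]
  rw [e]
  refine (norm_sub_le _ _).trans ?_
  rw [norm_mul]
  have h3 : ‖κ k / b k‖ * ‖(b (k + 1) - b k) / b (k + 1)‖ ≤ 2 * (2 * δ) :=
    mul_le_mul ((key k).trans (by linarith [hκ k])) ((h2 _).trans (by linarith [hδ k]))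
      (norm_nonneg _) (by norm_num)
  linarith [h2 (κ (k + 1) - κ k), hL k]

/-- Convolution of a bounded function with a trigonometric polynomial. -/
lemma norm_sum_mul_expo_le {S : Finset ℤ} {κ : ℤ → ℂ} {g : ℝ → ℂ} (hg : IsBddMeas g)
    (hg1 : ∀ t, ‖g t‖ ≤ 1) (t : ℝ) :
    ‖∑ k ∈ S, κ k * (starRingEnd ℂ) (∫ s, g s * expo k s ∂circ) * expo k t‖
      ≤ ∫ s, ‖trig S κ s‖ ∂circ := by
  have e : ∑ k ∈ S, κ k * (starRingEnd ℂ) (∫ s, g s * expo k s ∂circ) * expo k t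
      = ∫ s, (starRingEnd ℂ) (g s) * trig S κ (t - s) ∂circ := by
    have h1 : ∀ s, (starRingEnd ℂ) (g s) * trig S κ (t - s)
        = ∑ k ∈ S, κ k * expo k t * (starRingEnd ℂ) (g s * expo k s) := by
      intro s
      rw [trig, Finset.mul_sum]
      refine Finset.sum_congr rfl fun k _ => ?_
      rw [sub_eq_add_neg, expo_add_right, expo_neg_right, map_mul, conj_expo]; ring
    simp_rw [h1]
    rw [integral_finsetSum]
    · refine Finset.sum_congr rfl fun k _ => ?_
      rw [integral_const_mul, integral_conj]; ring
    · intro k _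
      have := (hg.mul (isBddMeas_const_mul_expo 1 k)).conj.integrable circ
      simp only [one_mul] at this
      exact this.const_mul _
  rw [e]
  have hper : Function.Periodic (fun s => ‖trig S κ s‖) (2 * Real.pi) := fun s => by
    simp only [periodic_trig S κ s]
  rw [← integral_circ_sub hper t]
  refine norm_integral_le_of_norm_le ?_ (Filter.Eventually.of_forall fun s => ?_)
  · obtain ⟨_, B, hB⟩ := isBddMeas_trig S κ
    refine Integrable.of_bound (C := B) ?_ (Filter.Eventually.of_forall fun s => ?_)
    · exact ((continuous_trig S κ).norm.comp (continuous_const.sub continuous_id)).aestronglyMeasurable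
    · simpa using hB _
  · rw [norm_mul, RCLike.norm_conj]
    exact mul_le_of_le_one_left (norm_nonneg _) (hg1 s)

lemma conj_integral_mul_projTrig {μ : Measure E3} [IsFiniteMeasure μ] (S : Finset ℤ) (κ : ℤ → ℝ)
    (u : E3) {g : ℝ → ℂ} (hg : IsBddMeas g) :
    (starRingEnd ℂ) (∫ t, g t * projTrig μ S (fun k => (κ k : ℂ)) u t ∂circ)
      = ∫ x, ∑ k ∈ S, κ k * (starRingEnd ℂ) (∫ s, g s * expo k s ∂circ) * wave ((k : ℝ) • u) x ∂μ := by
  have h1 : ∀ t, projTrig μ S (fun k => (κ k : ℂ)) u t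
      = ∑ k ∈ S, κ k * expo k t * ∫ x, wave (-((k : ℝ) • u)) x ∂μ := by
    intro t
    have e : ∀ x : E3, trig S (fun k => (κ k : ℂ)) (t - ⟪x, u⟫)
        = ∑ k ∈ S, κ k * expo k t * wave (-((k : ℝ) • u)) x := by
      intro x
      refine Finset.sum_congr rfl fun k _ => ?_
      rw [sub_eq_add_neg, expo_add_right, expo_neg_right, ← conj_expo, expo_inner, conj_wave]; ring
    rw [projTrig]
    simp_rw [e]
    rw [integral_finsetSum _ fun k _ => (integrable_wave _ _).const_mul _]
    exact Finset.sum_congr rfl fun k _ => integral_const_mul _ _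
  have hi : ∀ k, Integrable (fun t => g t * expo k t) circ := fun k => by
    have := (hg.mul (isBddMeas_const_mul_expo 1 k)).integrable circ
    simpa only [one_mul] using this
  have h2 : ∫ t, g t * projTrig μ S (fun k => (κ k : ℂ)) u t ∂circ
      = ∑ k ∈ S, κ k * (∫ s, g s * expo k s ∂circ) * ∫ x, wave (-((k : ℝ) • u)) x ∂μ := by
    have : (fun t => g t * projTrig μ S (fun k => (κ k : ℂ)) u t)
        = fun t => ∑ k ∈ S, (κ k * ∫ x, wave (-((k : ℝ) • u)) x ∂μ) * (g t * expo k t) := by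
      funext t
      rw [h1, Finset.mul_sum]
      exact Finset.sum_congr rfl fun k _ => by ring
    rw [this, integral_finsetSum _ fun k _ => (hi k).const_mul _]
    exact Finset.sum_congr rfl fun k _ => by rw [integral_const_mul]; ring
  rw [h2, map_sum, integral_finsetSum _ fun k _ => (integrable_wave _ _).const_mul _]
  refine Finset.sum_congr rfl fun k _ => ?_
  have h3 : (starRingEnd ℂ) (∫ x, wave (-((k : ℝ) • u)) x ∂μ) = ∫ x, wave ((k : ℝ) • u) x ∂μ := by
    rw [← integral_conj]; simp only [conj_wave, neg_neg]
  rw [integral_const_mul, map_mul, map_mul, Complex.conj_ofReal, h3]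

/-- Frequencies `κ` form a smooth bump on the scale `H`, supported in `[R, R (1 + 4⁻ⁿ)]`. -/
structure IsBump (S : Finset ℤ) (κ : ℤ → ℝ) (H R : ℝ) (n : ℕ) : Prop where
  H_pos : 0 < H
  H_le : H ≤ R
  mem : ∀ k, κ k ≠ 0 → k ∈ S
  card_le : (S.card : ℝ) ≤ 3 * H
  abs_le : ∀ k, |κ k| ≤ 1
  lip : ∀ k, |κ (k + 1) - κ k| ≤ 5 / H
  band : ∀ k, κ k ≠ 0 → (k : ℝ) ∈ Icc R (R * (1 + (4 ^ n)⁻¹))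

theorem CurveNondeg.exists_dual_estimate {γ : ℝ → E3} {a b ρ c C : ℝ}
    (hγ : CurveNondeg γ a b ρ c C) (hab : a ≤ b) (M : ℕ) {ε : ℝ} (hε : 0 < ε) :
    ∃ D, 0 ≤ D ∧ ∀ (n : ℕ) (R H α cμ : ℝ) (S V : Finset ℤ) (κ : ℤ → ℝ) (θ w : ℤ → ℝ) (W Λ : ℝ)
      (μ : Measure E3) (g : ℤ → ℝ → ℂ), 1 ≤ R →
      (4 : ℝ) ^ (n * M) ≤ R → IsBump S κ H R n → (∀ v, θ v ∈ Icc a b) →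
      (∀ v ∈ V, θ v ∈ Icc ((v : ℝ) / 4 ^ (n * M)) ((v + 1) / 4 ^ (n * M))) →
      (∀ v, 0 ≤ w v) → (∀ v ∈ V, w v ≤ W) → 0 ≤ W →
      (∀ u, ∑ v ∈ V with |θ v - u| ≤ (2 ^ (n * M))⁻¹, w v ≤ Λ) →
      IsFiniteMeasure μ → μ (closedBall 0 1)ᶜ = 0 → 0 ≤ cμ →
      (∀ x : E3, ∀ r > 0, μ (ball x r) ≤ ENNReal.ofReal (cμ * r ^ α)) → α ≤ 3 → 0 ≤ α →
      (∀ v, IsBddMeas (g v)) → (∀ v t, ‖g v t‖ ≤ 1) →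
      ‖∑ v ∈ V, w v * ∫ t, g v t * projTrig μ S (fun k => (κ k : ℂ)) (γ (θ v)) t ∂circ‖ ^ 6 ≤
        D * μ.real univ ^ 5 * cμ * R ^ (3 - α) * 2 ^ (ε * (n * M)) * W * Λ ^ 2 *
          (∑ v ∈ V, w v) ^ 2 * ∑ v ∈ V, w v * ∫ t, ‖g v t‖ ^ 2 ∂circ := by
  obtain ⟨m, _, hm, A, hA⟩ := exists_bandLimited
  obtain ⟨D₁, hD₁, hconv⟩ := exists_lintegral_ballAvg_le hA
  obtain ⟨D₂, hD₂, hsext⟩ := hγ.sextic_estimate hab hm M hε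
  refine ⟨D₁ * 4 ^ 3 * D₂ * 288 ^ 4 * (4 * (2 * Real.pi)), by have := Real.pi_pos; positivity, ?_⟩
  intro n R H α cμ S V κ θ w W Λ μ g hR1 hR hκ hθ hθV hw0 hwW hW0 hΛ _ hμ hcμ0 hcμ hα3 hα0 hg hg1
  have hR0 : 0 < R := one_pos.trans_le hR1
  set r : ℝ := 1 / (4 * R) with hr
  have hr0 : 0 < r := by positivity
  have hr1 : r ≤ 1 := by rw [hr, div_le_one (by positivity)]; linarith
  have := isProbabilityMeasure_ballAvg hr0
  have hγ1 : ∀ v, ‖γ (θ v)‖ = 1 := fun v => hγ.norm_eq _ (hθ v)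
  set bb : ℤ → ℤ → ℂ := fun v k => ballHat r ((k : ℝ) • γ (θ v)) with hbb
  have hbb_half : ∀ v k, κ k ≠ 0 → 1 / 2 ≤ ‖bb v k‖ := by
    intro v k hk
    refine half_le_norm_ballHat hr0 ?_
    have h1 := hκ.band k hk
    have h2 : (0 : ℝ) ≤ k := hR0.le.trans h1.1
    have h3 : ((4 : ℝ) ^ n)⁻¹ ≤ 1 := inv_le_one_of_one_le₀ (one_le_pow₀ (by norm_num))
    have h4 : (k : ℝ) ≤ R * 2 := h1.2.trans (by gcongr; linarith)
    rw [norm_smul, hγ1, mul_one, Real.norm_of_nonneg h2, hr, div_mul_eq_mul_div,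
      div_le_div_iff₀ (by positivity) two_pos]
    linarith
  have hbb_lip : ∀ v k, ‖bb v (k + 1) - bb v k‖ ≤ r := by
    intro v k
    refine (norm_ballHat_sub_le hr0 _ _).trans ?_
    rw [← sub_smul, norm_smul, hγ1]; simp
  set G : ℤ → ℤ → ℂ := fun v k => (starRingEnd ℂ) (∫ s, g v s * expo k s ∂circ) with hG
  set AA : ℤ → ℤ → ℂ := fun v k => κ k / bb v k * G v k with hAA
  have hAb : ∀ v k, AA v k * bb v k = κ k * G v k := by
    intro v k
    rcases eq_or_ne (κ k) 0 with h | h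
    · simp [hAA, h]
    · have : bb v k ≠ 0 := norm_pos_iff.1 (by linarith [hbb_half v k h])
      rw [hAA]; field_simp
  set F : E3 → ℂ := fun z => ∑ v ∈ V, w v * ∑ k ∈ S, AA v k * wave ((k : ℝ) • γ (θ v)) z with hF
  have hFb : IsBddMeas F := by
    refine IsBddMeas.sum V fun v => ?_
    have h1 : IsBddMeas fun z : E3 => (w v : ℂ) := ⟨measurable_const, ‖(w v : ℂ)‖, fun _ => le_rfl⟩
    exact h1.mul (IsBddMeas.sum S fun k => isBddMeas_const_mul_wave _ _)
  have hsm := hsext n R V S θ w AA W 288 Λ hR hθ hθV hw0 hwW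
    (fun v k h => hκ.band k fun h0 => h (by simp [hAA, h0])) (by norm_num) (by
      intro v _ t
      refine (norm_sum_mul_expo_le (κ := fun k => κ k / bb v k) (hg v) (hg1 v) t).trans ?_
      have hκ' : ∀ k, (κ k : ℂ) ≠ 0 → κ k ≠ 0 := fun k h => by exact_mod_cast h
      have := integral_norm_trig_le hκ.H_pos S (fun k => κ k / bb v k) (B := 12)
        (fun k hk => hκ.mem k fun h0 => hk (by simp [h0])) hκ.card_le (by
          intro k
          rcases eq_or_ne (κ k) 0 with h | h
          · simp [h]
          · have h2 := hbb_half v k h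
            rw [norm_div, div_le_iff₀ (by linarith)]
            have := hκ.abs_le k
            rw [Complex.norm_real, Real.norm_eq_abs]; linarith) (by
          intro k
          refine (norm_div_sub_div_le (κ := fun k => (κ k : ℂ)) (L := 5 / H) (fun k => ?_)
            (fun k hk => hbb_half v k (hκ' k hk)) (fun k => ?_) (hbb_lip v) k).trans ?_
          · rw [← Complex.ofReal_sub, Complex.norm_real]; exact hκ.lip k
          · rw [Complex.norm_real]; exact hκ.abs_le k
          · have : r ≤ 1 / (4 * H) := by
              rw [hr]
              exact one_div_le_one_div_of_le (by have := hκ.H_pos; positivity) (by linarith [hκ.H_le])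
            have e : 12 / H = 2 * (5 / H) + 4 * (1 / (4 * H)) + 1 / H := by
              have := hκ.H_pos; field_simp; norm_num
            have : 0 < 1 / H := by have := hκ.H_pos; positivity
            linarith)
      linarith) hΛ
  have hAA2 : ∀ v, ∑ k ∈ S, ‖AA v k‖ ^ 2 ≤ 4 * (2 * Real.pi) * ∫ t, ‖g v t‖ ^ 2 ∂circ := by
    intro v
    have hB := sum_norm_integral_mul_expo_sq_le S (hg v)
    calc ∑ k ∈ S, ‖AA v k‖ ^ 2 ≤ ∑ k ∈ S, 4 * ‖∫ t, g v t * expo k t ∂circ‖ ^ 2 := by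
          refine Finset.sum_le_sum fun k _ => ?_
          have : ‖(κ k : ℂ) / bb v k‖ ≤ 2 := by
            rcases eq_or_ne (κ k) 0 with h | h
            · simp [h]
            · have h2 := hbb_half v k h
              rw [norm_div, div_le_iff₀ (by linarith)]
              have := hκ.abs_le k
              rw [Complex.norm_real, Real.norm_eq_abs]; linarith
          rw [hAA]; dsimp only
          rw [norm_mul, mul_pow, hG]; dsimp only; rw [RCLike.norm_conj]
          have h4 : ‖(κ k : ℂ) / bb v k‖ ^ 2 ≤ 2 ^ 2 := pow_le_pow_left₀ (norm_nonneg _) this 2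
          exact mul_le_mul_of_nonneg_right (by linarith) (by positivity)
      _ ≤ _ := by rw [← Finset.mul_sum, mul_assoc]; gcongr
  have hconj : (starRingEnd ℂ) (∑ v ∈ V, w v *
      ∫ t, g v t * projTrig μ S (fun k => (κ k : ℂ)) (γ (θ v)) t ∂circ)
      = ∫ x, ∫ y, F (x + y) ∂(ballAvg r) ∂μ := by
    have h1 : ∀ x, ∫ y, F (x + y) ∂(ballAvg r) =
        ∑ v ∈ V, w v * ∑ k ∈ S, κ k * G v k * wave ((k : ℝ) • γ (θ v)) x := by
      intro x
      have e : ∀ y, F (x + y) = ∑ v ∈ V, w v * ∑ k ∈ S,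
          (AA v k * wave ((k : ℝ) • γ (θ v)) x) * wave ((k : ℝ) • γ (θ v)) y := by
        intro y
        simp only [hF, wave_add_right, mul_assoc]
      simp_rw [e]
      rw [integral_finsetSum _ fun v _ => Integrable.const_mul (integrable_finsetSum _ fun k _ =>
        (integrable_wave _ _).const_mul _) _]
      refine Finset.sum_congr rfl fun v _ => ?_
      rw [integral_const_mul, integral_finsetSum _ fun k _ => (integrable_wave _ _).const_mul _]
      congr 1
      refine Finset.sum_congr rfl fun k _ => ?_
      rw [integral_const_mul, ← hAb]
      simp only [hbb, ballHat]; ring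
    simp_rw [h1]
    rw [map_sum, integral_finsetSum _ fun v _ => Integrable.const_mul (integrable_finsetSum _ fun k _ =>
        (integrable_wave _ _).const_mul _) _]
    refine Finset.sum_congr rfl fun v _ => ?_
    rw [integral_const_mul, map_mul, Complex.conj_ofReal, conj_integral_mul_projTrig S κ _ (hg v)]
  have hFm : Measurable fun q : E3 × E3 => ‖F (q.1 + q.2)‖ₑ :=
    (hFb.1.comp (measurable_fst.add measurable_snd)).enorm
  set I := ∑ v ∈ V, w v * ∫ t, g v t * projTrig μ S (fun k => (κ k : ℂ)) (γ (θ v)) t ∂circ with hI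
  have hbound : ‖I‖ₑ ≤ ∫⁻ q, ‖F (q.1 + q.2)‖ₑ ∂(μ.prod (ballAvg r)) := by
    have : ‖I‖ₑ = ‖(starRingEnd ℂ) I‖ₑ := by simp [enorm, nnnorm]
    rw [this, hconj, lintegral_prod _ hFm.aemeasurable]
    exact (enorm_integral_le_lintegral_enorm _).trans
      (lintegral_mono fun x => enorm_integral_le_lintegral_enorm _)
  have hfin : ‖I‖ₑ ^ 6 ≤ μ univ ^ 5 * (ENNReal.ofReal (D₁ * cμ * r ^ (α - 3)) *
      ENNReal.ofReal (∫ z, ‖F z‖ ^ 6 ∂m)) := by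
    refine (pow_le_pow_left' hbound 6).trans ((lintegral_pow_six_le _ hFm).trans ?_)
    rw [← univ_prod_univ, Measure.prod_prod, measure_univ (μ := ballAvg r), mul_one]
    gcongr
    rw [lintegral_prod _ (hFm.pow_const 6).aemeasurable]
    refine (hconv μ α cμ r inferInstance hμ hcμ hcμ0 hr0 hr1 (fun z => ‖F z‖ₑ ^ 6)
      (hFb.1.enorm.pow_const 6)).trans (le_of_eq ?_)
    rw [ofReal_integral_eq_lintegral_ofReal (hFb.integrable_norm_pow m 6)
      (Filter.Eventually.of_forall fun z => by positivity)]
    congr 2; ext z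
    rw [ENNReal.ofReal_pow (norm_nonneg _), ofReal_norm]
  have hreal : ‖I‖ ^ 6 ≤ μ.real univ ^ 5 * (D₁ * cμ * r ^ (α - 3) * ∫ z, ‖F z‖ ^ 6 ∂m) := by
    have hx : 0 ≤ D₁ * cμ * r ^ (α - 3) := by positivity
    have h0 : 0 ≤ ∫ z, ‖F z‖ ^ 6 ∂m := integral_nonneg fun z => by positivity
    rw [← ofReal_norm, ← ENNReal.ofReal_pow (norm_nonneg _), ← ENNReal.ofReal_mul hx,
      ← ofReal_measureReal, ← ENNReal.ofReal_pow measureReal_nonneg,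
      ← ENNReal.ofReal_mul (by positivity), ENNReal.ofReal_le_ofReal_iff (by positivity)] at hfin
    exact hfin
  have hrpow : r ^ (α - 3) ≤ 4 ^ 3 * R ^ (3 - α) := by
    rw [hr, one_div, Real.inv_rpow (by positivity), ← Real.rpow_neg (by positivity), neg_sub,
      Real.mul_rpow (by norm_num) hR0.le]
    gcongr
    calc (4 : ℝ) ^ (3 - α) ≤ 4 ^ (3 : ℝ) :=
          Real.rpow_le_rpow_of_exponent_le (by norm_num) (by linarith)
      _ = 4 ^ 3 := by norm_num
  have hΛ0 : 0 ≤ Λ ^ 2 := sq_nonneg _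
  calc ‖I‖ ^ 6 ≤ μ.real univ ^ 5 * (D₁ * cμ * (4 ^ 3 * R ^ (3 - α)) * (D₂ * 2 ^ (ε * (n * M)) *
        288 ^ 4 * W * Λ ^ 2 * (∑ v ∈ V, w v) ^ 2 *
          ∑ v ∈ V, w v * (4 * (2 * Real.pi) * ∫ t, ‖g v t‖ ^ 2 ∂circ))) := by
        refine hreal.trans ?_
        gcongr μ.real univ ^ 5 * (D₁ * cμ * ?_ * ?_)
        · exact hsm.trans (mul_le_mul_of_nonneg_left (Finset.sum_le_sum fun v _ =>
            mul_le_mul_of_nonneg_left (hAA2 v) (hw0 v)) (by positivity))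
    _ = _ := by
        simp_rw [mul_left_comm (w _) (4 * (2 * Real.pi))]
        rw [← Finset.mul_sum]; ring

/-! ### From duality to a bound in `L^{6/5}` -/

lemma rpow_le_dyadic_sum {s x : ℝ} (hs : 0 < s) (hx0 : 0 ≤ x) (L : ℕ) (hx : x ≤ 2 ^ L * s) :
    x ^ (6 / 5 : ℝ) ≤ s ^ (1 / 5 : ℝ) * x + ∑ i ∈ Finset.range L,
      (Ioc (2 ^ i * s) (2 ^ (i + 1) * s)).indicator (fun _ => (2 ^ (i + 1) * s) ^ (6 / 5 : ℝ)) x := by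
  induction L with
  | zero =>
    rw [pow_zero, one_mul] at hx
    have : x ^ (6 / 5 : ℝ) = x ^ (1 / 5 : ℝ) * x := by
      rw [show (6 / 5 : ℝ) = 1 / 5 + 1 by norm_num, Real.rpow_add_one' hx0 (by norm_num)]
    rw [Finset.sum_range_zero, add_zero, this]
    gcongr
  | succ L ih =>
    have hnn : ∀ i, 0 ≤ (Ioc (2 ^ i * s) (2 ^ (i + 1) * s)).indicator
        (fun _ => (2 ^ (i + 1) * s) ^ (6 / 5 : ℝ)) x := fun i =>
      indicator_nonneg (fun _ _ => by positivity) _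
    rw [Finset.sum_range_succ]
    rcases le_or_gt x (2 ^ L * s) with h | h
    · linarith [ih h, hnn L]
    · rw [indicator_of_mem (show x ∈ Ioc (2 ^ L * s) (2 ^ (L + 1) * s) from ⟨h, hx⟩)]
      have h1 : x ^ (6 / 5 : ℝ) ≤ (2 ^ (L + 1) * s) ^ (6 / 5 : ℝ) := by gcongr
      have h2 := Finset.sum_nonneg fun i (_ : i ∈ Finset.range L) => hnn i
      have h3 : 0 ≤ s ^ (1 / 5 : ℝ) * x := by positivity
      linarith

lemma integrable_norm_rpow {X : Type} [MeasurableSpace X] {m : Measure X} [IsFiniteMeasure m]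
    {f : X → ℂ} (hf : IsBddMeas f) {p : ℝ} (hp : 0 ≤ p) : Integrable (fun x => ‖f x‖ ^ p) m := by
  obtain ⟨hf, B, hB⟩ := hf
  refine Integrable.of_bound (hf.norm.pow_const p).aestronglyMeasurable (B ^ p)
    (Filter.Eventually.of_forall fun x => ?_)
  rw [Real.norm_of_nonneg (by positivity)]
  exact Real.rpow_le_rpow (norm_nonneg _) (hB x) hp

/-- A restricted dual bound of exponent `6` gives a bound in `L^{6/5}`, with a logarithmic loss. -/
lemma sum_integral_rpow_le {V : Finset ℤ} {w : ℤ → ℝ} {U : ℤ → ℝ → ℂ} (hw : ∀ v, 0 ≤ w v)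
    (hU : ∀ v, IsBddMeas (U v)) {Q : ℝ} (hQ : 0 ≤ Q)
    (hdual : ∀ g : ℤ → ℝ → ℂ, (∀ v, IsBddMeas (g v)) → (∀ v t, ‖g v t‖ ≤ 1) →
      ‖∑ v ∈ V, w v * ∫ t, g v t * U v t ∂circ‖ ^ 6 ≤ Q * ∑ v ∈ V, w v * ∫ t, ‖g v t‖ ^ 2 ∂circ)
    {s : ℝ} (hs : 0 < s) (L : ℕ) (hL : ∀ v t, ‖U v t‖ ≤ 2 ^ L * s) :
    ∑ v ∈ V, w v * ∫ t, ‖U v t‖ ^ (6 / 5 : ℝ) ∂circ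
      ≤ s ^ (1 / 5 : ℝ) * ∑ v ∈ V, w v * ∫ t, ‖U v t‖ ∂circ + 8 * L * Q ^ (1 / 5 : ℝ) := by
  set E : ℝ → ℤ → Set ℝ := fun σ v => {t | ‖U v t‖ ∈ Ioc σ (2 * σ)} with hE
  have hEm : ∀ σ v, MeasurableSet (E σ v) := fun σ v => (hU v).1.norm measurableSet_Ioc
  set A : ℝ → ℝ := fun σ => ∑ v ∈ V, w v * circ.real (E σ v) with hA
  have hA0 : ∀ σ, 0 ≤ A σ := fun σ =>
    Finset.sum_nonneg fun v _ => mul_nonneg (hw v) measureReal_nonneg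
  have hweak : ∀ σ, 0 < σ → (2 * σ) ^ (6 / 5 : ℝ) * A σ ≤ 8 * Q ^ (1 / 5 : ℝ) := by
    intro σ hσ
    set g : ℤ → ℝ → ℂ := fun v => (E σ v).indicator fun t => (starRingEnd ℂ) (U v t) / (2 * σ) with hg
    have hg1 : ∀ v t, ‖g v t‖ ≤ (E σ v).indicator (fun _ => (1 : ℝ)) t := by
      intro v t
      by_cases ht : t ∈ E σ v
      · rw [hg]; dsimp only
        rw [indicator_of_mem ht, indicator_of_mem ht, norm_div, RCLike.norm_conj]
        have h2 : ‖(2 * σ : ℂ)‖ = 2 * σ := by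
          rw [norm_mul, Complex.norm_real, Real.norm_of_nonneg hσ.le]; simp
        rw [h2, div_le_one (by positivity)]
        exact ht.2
      · rw [hg]; dsimp only
        rw [indicator_of_notMem ht, indicator_of_notMem ht, norm_zero]
    have hg1' : ∀ v t, ‖g v t‖ ≤ 1 := fun v t =>
      (hg1 v t).trans (indicator_le_self' (fun _ _ => zero_le_one) t)
    have hgb : ∀ v, IsBddMeas (g v) := fun v =>
      ⟨((hU v).conj.1.div_const _).indicator (hEm σ v), 1, hg1' v⟩
    have hd := hdual g hgb hg1'
    have h1 : ∀ v, ∫ t, ‖g v t‖ ^ 2 ∂circ ≤ circ.real (E σ v) := by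
      intro v
      calc ∫ t, ‖g v t‖ ^ 2 ∂circ ≤ ∫ t, (E σ v).indicator (fun _ => (1 : ℝ)) t ∂circ := by
            refine integral_mono ((hgb v).integrable_norm_pow circ 2)
              ((integrable_const 1).indicator (hEm σ v)) fun t => ?_
            have := hg1 v t
            have h3 := hg1' v t
            dsimp only
            nlinarith [norm_nonneg (g v t)]
        _ = circ.real (E σ v) := by
            rw [integral_indicator (hEm σ v)]; simp
    have h2 : ∀ v, ∃ y : ℝ, ∫ t, g v t * U v t ∂circ = y ∧ σ / 2 * circ.real (E σ v) ≤ y := by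
      intro v
      have e : (fun t => g v t * U v t)
          = fun t => (((E σ v).indicator (fun t => ‖U v t‖ ^ 2 / (2 * σ)) t : ℝ) : ℂ) := by
        funext t
        by_cases ht : t ∈ E σ v
        · rw [hg]; dsimp only
          rw [indicator_of_mem ht, indicator_of_mem ht, div_mul_eq_mul_div, mul_comm,
            Complex.mul_conj, Complex.normSq_eq_norm_sq]
          push_cast; rfl
        · rw [hg]; dsimp only
          rw [indicator_of_notMem ht, indicator_of_notMem ht]; simp
      refine ⟨∫ t, (E σ v).indicator (fun t => ‖U v t‖ ^ 2 / (2 * σ)) t ∂circ, ?_, ?_⟩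
      · rw [e, integral_complex_ofReal]
      · have h3 : σ / 2 * circ.real (E σ v) = ∫ t, (E σ v).indicator (fun _ => σ / 2) t ∂circ := by
          rw [integral_indicator (hEm σ v)]; simp [mul_comm]
        rw [h3]
        refine integral_mono ((integrable_const _).indicator (hEm σ v))
          ((((hU v).integrable_norm_pow circ 2).div_const _).indicator (hEm σ v)) fun t => ?_
        by_cases ht : t ∈ E σ v
        · dsimp only
          rw [indicator_of_mem ht, indicator_of_mem ht, div_le_div_iff₀ two_pos (by positivity)]
          have := ht.1
          nlinarith
        · dsimp only
          rw [indicator_of_notMem ht, indicator_of_notMem ht]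
    choose y hy hy2 using h2
    simp_rw [hy] at hd
    have h4 : σ / 2 * A σ ≤ ∑ v ∈ V, w v * y v := by
      rw [hA]; dsimp only
      rw [Finset.mul_sum]
      exact Finset.sum_le_sum fun v _ => by
        rw [mul_left_comm]; exact mul_le_mul_of_nonneg_left (hy2 v) (hw v)
    have h5 : (σ / 2 * A σ) ^ 6 ≤ Q * A σ := by
      have h6 : ‖∑ v ∈ V, (w v : ℂ) * (y v : ℂ)‖ = |∑ v ∈ V, w v * y v| := by
        rw [← Real.norm_eq_abs, ← Complex.norm_real]; push_cast; rfl
      rw [h6] at hd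
      calc (σ / 2 * A σ) ^ 6 ≤ |∑ v ∈ V, w v * y v| ^ 6 :=
            pow_le_pow_left₀ (mul_nonneg (by positivity) (hA0 σ)) (h4.trans (le_abs_self _)) 6
        _ ≤ _ := hd
        _ ≤ _ := mul_le_mul_of_nonneg_left (Finset.sum_le_sum fun v _ =>
            mul_le_mul_of_nonneg_left (h1 v) (hw v)) hQ
    rcases (hA0 σ).eq_or_lt with h0 | h0
    · rw [← h0, mul_zero]; positivity
    have h7 : (2 * σ) ^ 6 * A σ ^ 5 ≤ 8 ^ 5 * Q := by
      refine le_of_mul_le_mul_right ?_ h0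
      calc (2 * σ) ^ 6 * A σ ^ 5 * A σ = 4096 * (σ / 2 * A σ) ^ 6 := by ring
        _ ≤ 4096 * (Q * A σ) := by gcongr
        _ ≤ 8 ^ 5 * Q * A σ := by nlinarith [mul_nonneg hQ h0.le]
    have h8 := Real.rpow_le_rpow (by positivity) h7 (show (0 : ℝ) ≤ 1 / 5 by norm_num)
    rw [Real.mul_rpow (by positivity) (by positivity), Real.mul_rpow (by positivity) hQ,
      ← Real.rpow_natCast, ← Real.rpow_natCast (A σ), ← Real.rpow_natCast (8 : ℝ),
      ← Real.rpow_mul (by positivity), ← Real.rpow_mul (by positivity),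
      ← Real.rpow_mul (by positivity)] at h8
    norm_num at h8
    norm_num
    exact h8
  have hpt : ∀ v, ∫ t, ‖U v t‖ ^ (6 / 5 : ℝ) ∂circ ≤ s ^ (1 / 5 : ℝ) * ∫ t, ‖U v t‖ ∂circ +
      ∑ i ∈ Finset.range L, (2 * (2 ^ i * s)) ^ (6 / 5 : ℝ) * circ.real (E (2 ^ i * s) v) := by
    intro v
    have hi0 : Integrable (fun t => ‖U v t‖) circ := by simpa using (hU v).integrable_norm_pow circ 1
    have hi1 : ∀ i, Integrable ((E (2 ^ i * s) v).indicator
        (fun _ => (2 * (2 ^ i * s)) ^ (6 / 5 : ℝ))) circ := fun i =>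
      (integrable_const _).indicator (hEm _ v)
    calc ∫ t, ‖U v t‖ ^ (6 / 5 : ℝ) ∂circ
        ≤ ∫ t, (s ^ (1 / 5 : ℝ) * ‖U v t‖ + ∑ i ∈ Finset.range L,
          (E (2 ^ i * s) v).indicator (fun _ => (2 * (2 ^ i * s)) ^ (6 / 5 : ℝ)) t) ∂circ := by
          refine integral_mono (integrable_norm_rpow (hU v) (by norm_num))
            ((hi0.const_mul _).add (integrable_finsetSum _ fun i _ => hi1 i)) fun t => ?_
          refine (rpow_le_dyadic_sum hs (norm_nonneg (U v t)) L (hL v t)).trans (le_of_eq ?_)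
          congr 1
          refine Finset.sum_congr rfl fun i _ => ?_
          simp only [indicator_apply, hE, mem_ofPred_eq, pow_succ', mul_assoc]
      _ = _ := by
          rw [integral_add (hi0.const_mul _) (integrable_finsetSum _ fun i _ => hi1 i),
            integral_const_mul, integral_finsetSum _ fun i _ => hi1 i]
          congr 1
          refine Finset.sum_congr rfl fun i _ => ?_
          rw [integral_indicator (hEm _ v)]; simp [mul_comm]
  calc ∑ v ∈ V, w v * ∫ t, ‖U v t‖ ^ (6 / 5 : ℝ) ∂circ
      ≤ ∑ v ∈ V, w v * (s ^ (1 / 5 : ℝ) * ∫ t, ‖U v t‖ ∂circ +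
      ∑ i ∈ Finset.range L, (2 * (2 ^ i * s)) ^ (6 / 5 : ℝ) * circ.real (E (2 ^ i * s) v)) :=
        Finset.sum_le_sum fun v _ => mul_le_mul_of_nonneg_left (hpt v) (hw v)
    _ = s ^ (1 / 5 : ℝ) * ∑ v ∈ V, w v * ∫ t, ‖U v t‖ ∂circ +
          ∑ i ∈ Finset.range L, (2 * (2 ^ i * s)) ^ (6 / 5 : ℝ) * A (2 ^ i * s) := by
        simp_rw [mul_add, Finset.sum_add_distrib, Finset.mul_sum, hA]
        congr 1
        · exact Finset.sum_congr rfl fun v _ => by ring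
        · rw [Finset.sum_comm]
          refine Finset.sum_congr rfl fun i _ => ?_
          rw [Finset.mul_sum]
          exact Finset.sum_congr rfl fun v _ => by ring
    _ ≤ _ := by
        gcongr
        refine (Finset.sum_le_sum fun i _ => hweak (2 ^ i * s) (by positivity)).trans (le_of_eq ?_)
        rw [Finset.sum_const, Finset.card_range, nsmul_eq_mul]; ring

/-! ### Discretization in the angular variable and the estimate for a single bump -/

lemma continuous_integral_wave (μ : Measure E3) [IsFiniteMeasure μ] :
    Continuous fun ξ : E3 => ∫ x, wave ξ x ∂μ := by
  refine continuous_of_dominated (bound := fun _ => 1) (fun ξ => (continuous_wave ξ).aestronglyMeasurable)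
    (fun ξ => Filter.Eventually.of_forall fun x => (norm_wave ξ x).le) (integrable_const _)
    (Filter.Eventually.of_forall fun x => ?_)
  unfold wave; fun_prop

lemma projTrig_eq_sum (μ : Measure E3) [IsFiniteMeasure μ] (S : Finset ℤ) (κ : ℤ → ℂ) (u : E3)
    (t : ℝ) : projTrig μ S κ u t = ∑ k ∈ S, κ k * expo k t * ∫ x, wave (-((k : ℝ) • u)) x ∂μ := by
  have e : ∀ x : E3, trig S κ (t - ⟪x, u⟫)
      = ∑ k ∈ S, κ k * expo k t * wave (-((k : ℝ) • u)) x := by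
    intro x
    refine Finset.sum_congr rfl fun k _ => ?_
    rw [sub_eq_add_neg, expo_add_right, expo_neg_right, ← conj_expo, expo_inner, conj_wave]; ring
  rw [projTrig]
  simp_rw [e]
  rw [integral_finsetSum _ fun k _ => (integrable_wave _ _).const_mul _]
  exact Finset.sum_congr rfl fun k _ => integral_const_mul _ _

lemma continuous_projTrig (μ : Measure E3) [IsFiniteMeasure μ] (S : Finset ℤ) (κ : ℤ → ℂ) :
    Continuous fun q : E3 × ℝ => projTrig μ S κ q.1 q.2 := by
  simp_rw [projTrig_eq_sum]
  refine continuous_finsetSum _ fun k _ => ?_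
  have h1 := (continuous_expo k).comp (continuous_snd (X := E3) (Y := ℝ))
  have h2 := (continuous_integral_wave μ).comp
    ((continuous_fst (X := E3) (Y := ℝ)).const_smul (k : ℝ)).neg
  exact (continuous_const.mul h1).mul h2

lemma norm_projTrig_le (μ : Measure E3) [IsFiniteMeasure μ] (S : Finset ℤ) {κ : ℤ → ℂ}
    (hκ : ∀ k, ‖κ k‖ ≤ 1) (u : E3) (t : ℝ) : ‖projTrig μ S κ u t‖ ≤ S.card * μ.real univ := by
  refine norm_integral_le_of_norm_le_const (Filter.Eventually.of_forall fun x => ?_)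
  refine (norm_sum_le _ _).trans ?_
  calc ∑ k ∈ S, ‖κ k * expo k (t - ⟪x, u⟫)‖ ≤ ∑ k ∈ S, (1 : ℝ) :=
        Finset.sum_le_sum fun k _ => by rw [norm_mul, norm_expo, mul_one]; exact hκ k
    _ = S.card := by simp

lemma isBddMeas_projTrig (μ : Measure E3) [IsFiniteMeasure μ] (S : Finset ℤ) {κ : ℤ → ℂ}
    (hκ : ∀ k, ‖κ k‖ ≤ 1) (u : E3) : IsBddMeas (projTrig μ S κ u) :=
  ⟨((continuous_projTrig μ S κ).comp (continuous_const.prodMk continuous_id)).measurable, _,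
    norm_projTrig_le μ S hκ u⟩

lemma continuous_integral_projTrig (μ : Measure E3) [IsFiniteMeasure μ] (S : Finset ℤ) (κ : ℤ → ℂ)
    {γ : ℝ → E3} (hγ : Continuous γ) {p : ℝ} (hp : 0 < p) :
    Continuous fun θ => ∫ t, ‖projTrig μ S κ (γ θ) t‖ ^ p ∂circ := by
  simp_rw [integral_circ_eq]
  refine intervalIntegral.continuous_parametric_intervalIntegral_of_continuous' ?_ _ _
  have h := (continuous_projTrig μ S κ).comp (hγ.prodMap continuous_id)
  exact h.norm.rpow_const fun _ => Or.inr hp.le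

lemma exists_discretization {a b : ℝ} (hab : a ≤ b) {N : ℝ} (hN : 0 < N) {Φ : ℝ → ℝ}
    (hΦ : Continuous Φ) (hΦ0 : ∀ t, 0 ≤ Φ t) (lam : Measure ℝ) [IsFiniteMeasure lam]
    (hlam : lam (Icc a b)ᶜ = 0) :
    ∃ (V : Finset ℤ) (θ : ℤ → ℝ), (∀ v, θ v ∈ Icc a b) ∧
      (∀ v ∈ V, θ v ∈ Icc ((v : ℝ) / N) ((v + 1) / N)) ∧
      ∫ t, Φ t ∂lam ≤ ∑ v ∈ V, lam.real (Ico ((v : ℝ) / N) ((v + 1) / N)) * Φ (θ v) := by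
  set V := Finset.Icc ⌊a * N⌋ ⌊b * N⌋ with hV
  have hne : ∀ v ∈ V, (Icc a b ∩ Icc ((v : ℝ) / N) ((v + 1) / N)).Nonempty := by
    intro v hv
    rw [hV, Finset.mem_Icc] at hv
    have h1 : (v : ℝ) / N ≤ b := by
      rw [div_le_iff₀ hN]; exact Int.le_floor.1 hv.2
    have h2 : a ≤ (v + 1) / N := by
      rw [le_div_iff₀ hN]
      have h3 := Int.lt_floor_add_one (a * N)
      have h4 : ((⌊a * N⌋ : ℤ) : ℝ) ≤ v := by exact_mod_cast hv.1
      linarith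
    have h3 : (v : ℝ) / N ≤ (v + 1) / N := by gcongr; linarith
    exact ⟨max a (v / N), ⟨le_max_left _ _, max_le hab h1⟩, le_max_right _ _, max_le h2 h3⟩
  have hex : ∀ v, ∃ t ∈ Icc a b, v ∈ V → t ∈ Icc ((v : ℝ) / N) ((v + 1) / N) ∧
      ∀ t' ∈ Icc a b ∩ Icc ((v : ℝ) / N) ((v + 1) / N), Φ t' ≤ Φ t := by
    intro v
    by_cases hv : v ∈ V
    · obtain ⟨t, ht, hmax⟩ := (isCompact_Icc.inter isCompact_Icc).exists_isMaxOn (hne v hv)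
        hΦ.continuousOn
      exact ⟨t, ht.1, fun _ => ⟨ht.2, hmax⟩⟩
    · exact ⟨a, ⟨le_rfl, hab⟩, fun h => absurd h hv⟩
  choose θ hθ1 hθ2 using hex
  refine ⟨V, θ, hθ1, fun v hv => (hθ2 v hv).1, ?_⟩
  have hi : ∀ v : ℤ, Integrable ((Ico ((v : ℝ) / N) ((v + 1) / N)).indicator fun _ => Φ (θ v)) lam :=
    fun v => (integrable_const _).indicator measurableSet_Ico
  calc ∫ t, Φ t ∂lam
      ≤ ∫ t, ∑ v ∈ V, (Ico ((v : ℝ) / N) ((v + 1) / N)).indicator (fun _ => Φ (θ v)) t ∂lam := by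
        refine integral_mono_of_nonneg (Filter.Eventually.of_forall hΦ0)
          (integrable_finsetSum _ fun v _ => hi v) ?_
        have hae : ∀ᵐ t ∂lam, t ∈ Icc a b := hlam
        filter_upwards [hae] with t ht
        have h1 : ⌊t * N⌋ ∈ V := by
          rw [hV, Finset.mem_Icc]
          constructor <;> apply Int.floor_le_floor <;> gcongr
          exacts [ht.1, ht.2]
        have h2 : t ∈ Ico ((⌊t * N⌋ : ℝ) / N) ((⌊t * N⌋ + 1) / N) := by
          rw [mem_Ico, div_le_iff₀ hN, lt_div_iff₀ hN]
          exact ⟨Int.floor_le _, Int.lt_floor_add_one _⟩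
        calc Φ t ≤ Φ (θ ⌊t * N⌋) := (hθ2 _ h1).2 t ⟨ht, h2.1, h2.2.le⟩
          _ = (Ico ((⌊t * N⌋ : ℝ) / N) ((⌊t * N⌋ + 1) / N)).indicator
                (fun _ => Φ (θ ⌊t * N⌋)) t := by rw [indicator_of_mem h2]
          _ ≤ _ := Finset.single_le_sum (f := fun v : ℤ =>
              (Ico ((v : ℝ) / N) ((v + 1) / N)).indicator (fun _ => Φ (θ v)) t)
              (fun v _ => indicator_nonneg (fun _ _ => hΦ0 _) _) h1
    _ = _ := by
        rw [integral_finsetSum _ fun v _ => hi v]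
        refine Finset.sum_congr rfl fun v _ => ?_
        rw [integral_indicator measurableSet_Ico]; simp

lemma sum_measureReal_Ico_le {N : ℝ} (hN : 0 < N) (lam : Measure ℝ) [IsFiniteMeasure lam]
    (V : Finset ℤ) {s : Set ℝ} (hs : ∀ v ∈ V, Ico ((v : ℝ) / N) ((v + 1) / N) ⊆ s) :
    ∑ v ∈ V, lam.real (Ico ((v : ℝ) / N) ((v + 1) / N)) ≤ lam.real s := by
  rw [← measureReal_biUnion_finset (fun v _ v' _ hvv => ?_) fun v _ => measurableSet_Ico]
  · exact measureReal_mono (iUnion₂_subset hs)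
  · refine disjoint_left.2 fun t ht ht' => hvv ?_
    rw [mem_Ico, div_le_iff₀ hN, lt_div_iff₀ hN] at ht ht'
    have h1 : ⌊t * N⌋ = v := Int.floor_eq_iff.2 ht
    have h2 : ⌊t * N⌋ = v' := Int.floor_eq_iff.2 ht'
    exact h1.symm.trans h2

/-- `μ` satisfies a Frostman condition with exponent `α` and constant `c`. -/
def IsFrostman {X : Type} [PseudoMetricSpace X] [MeasurableSpace X] (μ : Measure X) (α c : ℝ) : Prop :=
  ∀ x : X, ∀ r > 0, μ (ball x r) ≤ ENNReal.ofReal (c * r ^ α)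

lemma IsFrostman.measureReal_le {X : Type} [PseudoMetricSpace X] [MeasurableSpace X]
    {μ : Measure X} {α c : ℝ} (h : IsFrostman μ α c) (hc : 0 ≤ c) (x : X) {r : ℝ} (hr : 0 < r) :
    μ.real (ball x r) ≤ c * r ^ α :=
  ENNReal.toReal_le_of_le_ofReal (by positivity) (h x r hr)

/-! ### The estimate for a single bump -/

/-- The quantity `c_α(μ)^{p-1} μ(ℝ³) λ(ℝ)^{(2-p)/2} c_β(λ)^{p/2}` for `p = 6/5`. -/
def massBound (cμ mμ ml cl : ℝ) : ℝ :=
  cμ ^ (1 / 5 : ℝ) * mμ * ml ^ (2 / 5 : ℝ) * cl ^ (3 / 5 : ℝ)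

lemma massBound_nonneg {cμ mμ ml cl : ℝ} (h1 : 0 ≤ cμ) (h2 : 0 ≤ mμ) (h3 : 0 ≤ ml) (h4 : 0 ≤ cl) :
    0 ≤ massBound cμ mμ ml cl := by unfold massBound; positivity

lemma massBound_pow_five {cμ mμ ml cl : ℝ} (h1 : 0 ≤ cμ) (h3 : 0 ≤ ml) (h4 : 0 ≤ cl) :
    massBound cμ mμ ml cl ^ 5 = cμ * mμ ^ 5 * ml ^ 2 * cl ^ 3 := by
  unfold massBound
  rw [mul_pow, mul_pow, mul_pow, ← Real.rpow_mul_natCast h1, ← Real.rpow_mul_natCast h3,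
    ← Real.rpow_mul_natCast h4]
  norm_num

lemma mul_le_massBound {cμ mμ ml cl B : ℝ} (h1 : 0 ≤ cμ) (h2 : 0 ≤ mμ) (h3 : 0 ≤ ml) (h4 : 0 ≤ cl)
    (hB : 0 ≤ B) (h : ml ≤ cl * B) :
    cμ ^ (1 / 5 : ℝ) * mμ * ml ≤ B ^ (3 / 5 : ℝ) * massBound cμ mμ ml cl := by
  have e : ml = ml ^ (2 / 5 : ℝ) * ml ^ (3 / 5 : ℝ) := by
    rw [← Real.rpow_add' h3 (by norm_num)]; norm_num
  have h5 : ml ^ (3 / 5 : ℝ) ≤ cl ^ (3 / 5 : ℝ) * B ^ (3 / 5 : ℝ) := by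
    rw [← Real.mul_rpow h4 hB]; exact Real.rpow_le_rpow h3 h (by norm_num)
  unfold massBound
  calc cμ ^ (1 / 5 : ℝ) * mμ * ml = cμ ^ (1 / 5 : ℝ) * mμ * ml ^ (2 / 5 : ℝ) * ml ^ (3 / 5 : ℝ) := by
        conv_lhs => rw [e]
        ring
    _ ≤ cμ ^ (1 / 5 : ℝ) * mμ * ml ^ (2 / 5 : ℝ) * (cl ^ (3 / 5 : ℝ) * B ^ (3 / 5 : ℝ)) := by gcongr
    _ = _ := by ring

lemma IsFrostman.measureReal_univ_le {X : Type} [PseudoMetricSpace X] [MeasurableSpace X]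
    {μ : Measure X} {α c : ℝ} (h : IsFrostman μ α c) (hc : 0 ≤ c) {s : Set X} (hs : μ sᶜ = 0)
    {x : X} {r : ℝ} (hr : 0 < r) (hsub : s ⊆ ball x r) : μ.real univ ≤ c * r ^ α := by
  have h1 : μ univ ≤ μ (ball x r) := by
    calc μ univ ≤ μ (ball x r ∪ sᶜ) := measure_mono fun y _ => by
          by_cases hy : y ∈ s
          · exact Or.inl (hsub hy)
          · exact Or.inr hy
      _ ≤ μ (ball x r) + μ sᶜ := measure_union_le _ _
      _ = μ (ball x r) := by rw [hs, add_zero]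
  exact ENNReal.toReal_le_of_le_ofReal (by positivity) (h1.trans (h x r hr))

lemma exponent_gain {n M : ℕ} {R ρ₀ α β cl : ℝ} (hα1 : 1 < α) (hα3 : α ≤ 3)
    (hM : 44 ≤ M * (2 * β - (3 - α))) (hρ₀ : 1 ≤ ρ₀) (hR1 : 1 ≤ R) (hcl : 0 ≤ cl)
    (hR : R ≤ ρ₀ * 4 ^ (n * (M + 1))) :
    R ^ (3 - α) * 2 ^ ((2 * β - (3 - α)) * (n * M)) * (cl * (2 / 4 ^ (n * M)) ^ β) *
      (cl * (3 / 2 ^ (n * M)) ^ β) ^ 2 ≤ ρ₀ ^ 2 * 18 ^ β * cl ^ 3 * ((4 ^ (4 * n))⁻¹) ^ 5 := by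
  have hR0 : 0 ≤ R := by linarith
  have hN : (0 : ℝ) < 4 ^ (n * M) := by positivity
  have h42 : ∀ x : ℝ, (4 : ℝ) ^ x = 2 ^ (2 * x) := fun x => by
    rw [Real.rpow_mul (by norm_num)]; norm_num
  have h1 : R ^ (3 - α) ≤ ρ₀ ^ 2 * 2 ^ (4 * n : ℝ) * 2 ^ (2 * (n * M) * (3 - α)) := by
    have e : ρ₀ * 4 ^ (n * (M + 1)) = ρ₀ * 4 ^ n * (2 : ℝ) ^ (2 * (n * M) : ℝ) := by
      rw [← h42, mul_add, pow_add, ← Real.rpow_natCast 4 (n * M)]; push_cast; ring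
    calc R ^ (3 - α) ≤ (ρ₀ * 4 ^ n * (2 : ℝ) ^ (2 * (n * M) : ℝ)) ^ (3 - α) := by
          rw [← e]; exact Real.rpow_le_rpow hR0 hR (by linarith)
      _ = (ρ₀ * 4 ^ n) ^ (3 - α) * 2 ^ (2 * (n * M) * (3 - α)) := by
          rw [Real.mul_rpow (by positivity) (by positivity), ← Real.rpow_mul (by norm_num)]
      _ ≤ (ρ₀ * 4 ^ n) ^ (2 : ℝ) * 2 ^ (2 * (n * M) * (3 - α)) := by
          gcongr
          · exact one_le_mul_of_one_le_of_one_le hρ₀ (one_le_pow₀ (by norm_num))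
          · linarith
      _ = _ := by
          rw [Real.rpow_two, mul_pow, ← Real.rpow_natCast (4 : ℝ) n, ← Real.rpow_mul_natCast
            (by norm_num), h42]
          push_cast; ring_nf
  have h2 : (2 / 4 ^ (n * M) : ℝ) ^ β = 2 ^ β * 2 ^ (-(2 * (n * M) * β)) := by
    rw [Real.div_rpow (by norm_num) hN.le, ← Real.rpow_natCast, ← Real.rpow_mul (by norm_num), h42,
      div_eq_mul_inv, ← Real.rpow_neg (by norm_num)]
    push_cast; ring_nf
  have h3 : ((3 / 2 ^ (n * M) : ℝ) ^ β) ^ 2 = 9 ^ β * 2 ^ (-(2 * (n * M) * β)) := by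
    rw [Real.div_rpow (by norm_num) (by positivity), ← Real.rpow_natCast 2,
      ← Real.rpow_mul (by norm_num), div_eq_mul_inv, ← Real.rpow_neg (by norm_num), mul_pow,
      ← Real.rpow_mul_natCast (by norm_num), ← Real.rpow_mul_natCast (by norm_num), mul_comm β,
      Real.rpow_mul (by norm_num)]
    push_cast; norm_num; left; congr 1; ring
  have h4 : ((4 ^ (4 * n) : ℝ)⁻¹) ^ 5 = 2 ^ (-(40 * n) : ℝ) := by
    rw [← Real.rpow_natCast 4, h42, ← Real.rpow_neg (by norm_num), ← Real.rpow_mul_natCast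
      (by norm_num)]
    push_cast; ring_nf
  have h18 : (18 : ℝ) ^ β = 2 ^ β * 9 ^ β := by
    rw [← Real.mul_rpow (by norm_num) (by norm_num)]; norm_num
  rw [mul_pow, h2, h3, h4, h18]
  calc R ^ (3 - α) * 2 ^ ((2 * β - (3 - α)) * (n * M)) * (cl * (2 ^ β * 2 ^ (-(2 * (n * M) * β)))) *
        (cl ^ 2 * (9 ^ β * 2 ^ (-(2 * (n * M) * β))))
      ≤ (ρ₀ ^ 2 * 2 ^ (4 * n : ℝ) * 2 ^ (2 * (n * M) * (3 - α))) *
        2 ^ ((2 * β - (3 - α)) * (n * M)) * (cl * (2 ^ β * 2 ^ (-(2 * (n * M) * β)))) *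
        (cl ^ 2 * (9 ^ β * 2 ^ (-(2 * (n * M) * β)))) := by gcongr
    _ = ρ₀ ^ 2 * (2 ^ β * 9 ^ β) * cl ^ 3 * (2 ^ (4 * n : ℝ) * 2 ^ (2 * (n * M) * (3 - α)) *
        2 ^ ((2 * β - (3 - α)) * (n * M)) * 2 ^ (-(2 * (n * M) * β)) * 2 ^ (-(2 * (n * M) * β))) := by
        ring
    _ ≤ _ := by
        gcongr
        simp_rw [← Real.rpow_add (show (0 : ℝ) < 2 by norm_num)]
        apply Real.rpow_le_rpow_of_exponent_le (by norm_num)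
        have := mul_le_mul_of_nonneg_left hM (Nat.cast_nonneg (α := ℝ) n)
        nlinarith

set_option maxHeartbeats 1000000 in
theorem CurveNondeg.exists_bump_estimate {γ : ℝ → E3} {a b ρ c C : ℝ}
    (hγ : CurveNondeg γ a b ρ c C) (hγc : Continuous γ) (hab : a ≤ b) (M : ℕ) {α β ρ₀ : ℝ}
    (hα1 : 1 < α) (hα3 : α ≤ 3) (hM : 44 ≤ M * (2 * β - (3 - α))) (hρ₀ : 1 ≤ ρ₀) :
    ∃ D, 0 ≤ D ∧ ∀ (n : ℕ) (R H cμ cl : ℝ) (S : Finset ℤ) (κ : ℤ → ℝ) (μ : Measure E3)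
      (lam : Measure ℝ) [IsFiniteMeasure μ] [IsFiniteMeasure lam], 1 ≤ R →
      (4 : ℝ) ^ (n * M) ≤ R → R ≤ ρ₀ * 4 ^ (n * (M + 1)) → IsBump S κ H R n →
      μ (closedBall 0 1)ᶜ = 0 → 0 < cμ → IsFrostman μ α cμ →
      lam (Icc a b)ᶜ = 0 → 0 ≤ cl → IsFrostman lam β cl →
      ∫ θ, ∫ t, ‖projTrig μ S (fun k => (κ k : ℂ)) (γ θ) t‖ ^ (6 / 5 : ℝ) ∂circ ∂lam ≤
        D * (n + 1) * (4 ^ (4 * n))⁻¹ * massBound cμ (μ.real univ) (lam.real univ) cl := by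
  have hη : 0 < 2 * β - (3 - α) := by
    by_contra h
    have := mul_nonpos_of_nonneg_of_nonpos (Nat.cast_nonneg (α := ℝ) M) (not_lt.1 h)
    linarith
  obtain ⟨D₁, hD₁, hdual⟩ := hγ.exists_dual_estimate hab M hη
  obtain ⟨L₀, hL₀⟩ : ∃ L₀ : ℕ, 24 * ρ₀ ≤ 2 ^ L₀ := by
    obtain ⟨k, hk⟩ := pow_unbounded_of_one_lt (24 * ρ₀) (show (1 : ℝ) < 2 by norm_num)
    exact ⟨k, hk.le⟩
  set B : ℝ := (b - a + 1) ^ β with hB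
  have hB0 : 0 ≤ B := Real.rpow_nonneg (by linarith) _
  set K : ℝ := D₁ * ρ₀ ^ 2 * 18 ^ β with hK
  have hK0 : 0 ≤ K := by positivity
  refine ⟨6 * Real.pi * ρ₀ * B ^ (3 / 5 : ℝ) + 8 * (L₀ + 2 * (6 * M + 26)) * K ^ (1 / 5 : ℝ),
    by have := Real.pi_pos; positivity, ?_⟩
  intro n R H cμ cl S κ μ lam _ _ hR1 hNR hRle hκ hμ hcμ hFμ hlam hcl hFl
  set N : ℝ := 4 ^ (n * M) with hN
  have hN0 : 0 < N := by positivity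
  have hNsq : N = (2 ^ (n * M)) ^ 2 := by
    rw [hN, pow_right_comm]; norm_num
  set q : ℝ := 2 ^ (n * M) with hq
  have hq1 : 1 ≤ q := one_le_pow₀ (by norm_num)
  set mμ := μ.real univ with hmμ
  set ml := lam.real univ with hml
  have hmμ0 : 0 ≤ mμ := measureReal_nonneg
  have hml0 : 0 ≤ ml := measureReal_nonneg
  have hκ1 : ∀ k, ‖(κ k : ℂ)‖ ≤ 1 := fun k => by
    rw [Complex.norm_real]; exact hκ.abs_le k
  have hmμle : mμ ≤ cμ * 8 := by
    refine (hFμ.measureReal_univ_le hcμ.le hμ (x := 0) (r := 2) (by norm_num)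
      (closedBall_subset_ball (by norm_num))).trans ?_
    gcongr
    calc (2 : ℝ) ^ α ≤ 2 ^ (3 : ℝ) := Real.rpow_le_rpow_of_exponent_le (by norm_num) hα3
      _ = 8 := by norm_num
  have hmlle : ml ≤ cl * B := by
    refine hFl.measureReal_univ_le hcl hlam (x := a) (by linarith) fun t ht => ?_
    rw [mem_ball, Real.dist_eq, abs_of_nonneg (by linarith [ht.1])]; linarith [ht.2]
  have hcard : (S.card : ℝ) ≤ 3 * (ρ₀ * 4 ^ (n * (M + 1))) :=
    hκ.card_le.trans (by linarith [hκ.H_le])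
  have hX0 := massBound_nonneg hcμ.le hmμ0 hml0 hcl
  have hlin := mul_le_massBound hcμ.le hmμ0 hml0 hcl hB0 hmlle
  set X := massBound cμ mμ ml cl with hX
  obtain ⟨V, θ, hθ, hθV, hle⟩ := exists_discretization hab hN0
    (continuous_integral_projTrig μ S (fun k => (κ k : ℂ)) hγc (p := 6 / 5) (by norm_num))
    (fun t => integral_nonneg fun _ => by positivity) lam hlam
  refine hle.trans ?_
  set w : ℤ → ℝ := fun v => lam.real (Ico ((v : ℝ) / N) ((v + 1) / N)) with hw
  have hw0 : ∀ v, 0 ≤ w v := fun v => measureReal_nonneg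
  have hdiv : ∀ v : ℤ, ((v : ℝ) + 1) / N = v / N + 1 / N := fun v => by ring
  have hN1 : 0 < 1 / N := by positivity
  have hwW : ∀ v ∈ V, w v ≤ cl * (2 / N) ^ β := by
    intro v _
    refine (measureReal_mono ?_).trans (hFl.measureReal_le hcl (v / N) (by positivity))
    intro t ht
    rw [mem_Ico, hdiv] at ht
    rw [mem_ball, Real.dist_eq, abs_of_nonneg (by linarith [ht.1]), show 2 / N = 1 / N + 1 / N by ring]
    linarith [ht.2]
  have hwΛ : ∀ u, ∑ v ∈ V with |θ v - u| ≤ q⁻¹, w v ≤ cl * (3 / q) ^ β := by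
    intro u
    refine (sum_measureReal_Ico_le hN0 lam _ (s := ball u (3 / q)) fun v hv t ht => ?_).trans
      (hFl.measureReal_le hcl u (by positivity))
    rw [Finset.mem_filter] at hv
    have h1 := hθV v hv.1
    rw [mem_Icc, hdiv] at h1
    rw [mem_Ico, hdiv] at ht
    have h2 := abs_le.1 hv.2
    have h3 : 1 / N ≤ q⁻¹ := by
      rw [hNsq, one_div]; exact inv_anti₀ (by positivity) (by nlinarith)
    have h4 : 0 < q⁻¹ := by positivity
    rw [mem_ball, Real.dist_eq, abs_lt, div_eq_mul_inv]
    constructor <;> linarith [h1.1, h1.2, ht.1, ht.2, h2.1, h2.2]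
  have hwsum : ∑ v ∈ V, w v ≤ ml := sum_measureReal_Ico_le hN0 lam V fun _ _ => subset_univ _
  have hwsum0 : 0 ≤ ∑ v ∈ V, w v := Finset.sum_nonneg fun v _ => hw0 v
  set Q : ℝ := K * X ^ 5 * ((4 ^ (4 * n))⁻¹) ^ 5 with hQ
  have hQ0 : 0 ≤ Q := by positivity
  have hQroot : Q ^ (1 / 5 : ℝ) = K ^ (1 / 5 : ℝ) * X * (4 ^ (4 * n))⁻¹ := by
    have e : ∀ x : ℝ, 0 ≤ x → (x ^ 5) ^ (1 / 5 : ℝ) = x := fun x hx => by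
      rw [← Real.rpow_natCast_mul hx]; norm_num
    rw [hQ, Real.mul_rpow (by positivity) (by positivity), Real.mul_rpow hK0 (by positivity),
      e _ hX0, e _ (by positivity)]
  have hdual' : ∀ g : ℤ → ℝ → ℂ, (∀ v, IsBddMeas (g v)) → (∀ v t, ‖g v t‖ ≤ 1) →
      ‖∑ v ∈ V, w v * ∫ t, g v t * projTrig μ S (fun k => (κ k : ℂ)) (γ (θ v)) t ∂circ‖ ^ 6 ≤
        Q * ∑ v ∈ V, w v * ∫ t, ‖g v t‖ ^ 2 ∂circ := by
    intro g hg hg1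
    refine (hdual n R H α cμ S V κ θ w (cl * (2 / N) ^ β) (cl * (3 / q) ^ β) μ g hR1 hNR hκ hθ hθV
      hw0 hwW (by positivity) hwΛ inferInstance hμ hcμ.le hFμ hα3 (by linarith) hg hg1).trans ?_
    have h0 : 0 ≤ ∑ v ∈ V, w v * ∫ t, ‖g v t‖ ^ 2 ∂circ := Finset.sum_nonneg fun v _ =>
      mul_nonneg (hw0 v) (integral_nonneg fun _ => by positivity)
    refine mul_le_mul_of_nonneg_right ?_ h0
    have hgain := exponent_gain (n := n) hα1 hα3 hM hρ₀ hR1 hcl hRle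
    rw [hQ, massBound_pow_five hcμ.le hml0 hcl]
    calc D₁ * mμ ^ 5 * cμ * R ^ (3 - α) * 2 ^ ((2 * β - (3 - α)) * (n * M)) * (cl * (2 / N) ^ β) *
          (cl * (3 / q) ^ β) ^ 2 * (∑ v ∈ V, w v) ^ 2
        = D₁ * mμ ^ 5 * cμ * (∑ v ∈ V, w v) ^ 2 * (R ^ (3 - α) *
          2 ^ ((2 * β - (3 - α)) * (n * M)) * (cl * (2 / N) ^ β) * (cl * (3 / q) ^ β) ^ 2) := by ring
      _ ≤ D₁ * mμ ^ 5 * cμ * ml ^ 2 *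
          (ρ₀ ^ 2 * 18 ^ β * cl ^ 3 * ((4 ^ (4 * n))⁻¹) ^ 5) := by gcongr
      _ = _ := by rw [hK]; ring
  set y : ℝ := 4 ^ (n * (M + 5)) with hy
  have hy0 : 0 < y := by positivity
  have hs : 0 < cμ * (y⁻¹) ^ 5 := by positivity
  set U : ℤ → ℝ → ℂ := fun v t => projTrig μ S (fun k => (κ k : ℂ)) (γ (θ v)) t with hU
  have hUle : ∀ v t, ‖U v t‖ ≤ 3 * (ρ₀ * 4 ^ (n * (M + 1))) * mμ := fun v t =>
    (norm_projTrig_le μ S hκ1 _ t).trans (by gcongr)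
  have hL : ∀ v t, ‖U v t‖ ≤ 2 ^ (L₀ + 2 * (n * (6 * M + 26))) * (cμ * (y⁻¹) ^ 5) := by
    intro v t
    have e : (2 : ℝ) ^ (L₀ + 2 * (n * (6 * M + 26))) * (cμ * (y⁻¹) ^ 5)
        = 2 ^ L₀ * 4 ^ (n * (M + 1)) * cμ := by
      have : (2 : ℝ) ^ (2 * (n * (6 * M + 26))) = 4 ^ (n * (M + 1)) * y ^ 5 := by
        rw [pow_mul, hy, ← pow_mul (4 : ℝ), ← pow_add, show (2 : ℝ) ^ 2 = 4 by norm_num]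
        congr 1; ring
      rw [pow_add, this]; field_simp
    rw [e]
    calc ‖U v t‖ ≤ 3 * (ρ₀ * 4 ^ (n * (M + 1))) * mμ := hUle v t
      _ ≤ 3 * (ρ₀ * 4 ^ (n * (M + 1))) * (cμ * 8) := by gcongr
      _ = (24 * ρ₀) * 4 ^ (n * (M + 1)) * cμ := by ring
      _ ≤ _ := by gcongr
  have hmain := sum_integral_rpow_le hw0 (fun v => isBddMeas_projTrig μ S hκ1 (γ (θ v))) hQ0 hdual'
    hs _ hL
  refine hmain.trans ?_
  have hfirst : (cμ * (y⁻¹) ^ 5) ^ (1 / 5 : ℝ) * ∑ v ∈ V, w v * ∫ t, ‖U v t‖ ∂circ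
      ≤ 6 * Real.pi * ρ₀ * B ^ (3 / 5 : ℝ) * (4 ^ (4 * n))⁻¹ * X := by
    have e : (cμ * (y⁻¹) ^ 5) ^ (1 / 5 : ℝ) = cμ ^ (1 / 5 : ℝ) * y⁻¹ := by
      rw [Real.mul_rpow hcμ.le (by positivity), ← Real.rpow_natCast_mul (by positivity)]; norm_num
    have hInt : ∀ v, ∫ t, ‖U v t‖ ∂circ ≤ 3 * (ρ₀ * 4 ^ (n * (M + 1))) * mμ * (2 * Real.pi) := by
      intro v
      rw [← circ_real_univ]
      refine (Real.le_norm_self _).trans (norm_integral_le_of_norm_le_const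
        (Filter.Eventually.of_forall fun t => ?_))
      rw [norm_norm]; exact hUle v t
    have hpi := Real.pi_pos
    calc (cμ * (y⁻¹) ^ 5) ^ (1 / 5 : ℝ) * ∑ v ∈ V, w v * ∫ t, ‖U v t‖ ∂circ
        ≤ (cμ ^ (1 / 5 : ℝ) * y⁻¹) *
          ∑ v ∈ V, w v * (3 * (ρ₀ * 4 ^ (n * (M + 1))) * mμ * (2 * Real.pi)) := by
          rw [e]
          gcongr with v hv
          exact hInt v
      _ ≤ (cμ ^ (1 / 5 : ℝ) * y⁻¹) * (ml * (3 * (ρ₀ * 4 ^ (n * (M + 1))) * mμ * (2 * Real.pi))) := by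
          rw [← Finset.sum_mul]; gcongr
      _ = 6 * Real.pi * ρ₀ * (cμ ^ (1 / 5 : ℝ) * mμ * ml) * (4 ^ (4 * n))⁻¹ := by
          have : y = 4 ^ (n * (M + 1)) * 4 ^ (4 * n) := by rw [hy, ← pow_add]; congr 1; ring
          rw [this]; field_simp; ring
      _ ≤ 6 * Real.pi * ρ₀ * (B ^ (3 / 5 : ℝ) * X) * (4 ^ (4 * n))⁻¹ := by gcongr
      _ = _ := by ring
  rw [hQroot]
  have hn1 : (1 : ℝ) ≤ n + 1 := by linarith [Nat.cast_nonneg (α := ℝ) n]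
  have hLn : ((L₀ + 2 * (n * (6 * M + 26)) : ℕ) : ℝ) ≤ (L₀ + 2 * (6 * M + 26)) * (n + 1) := by
    push_cast
    have : (0 : ℝ) ≤ L₀ * n := by positivity
    have : (0 : ℝ) ≤ M := by positivity
    nlinarith
  have hpi := Real.pi_pos
  calc _ ≤ 6 * Real.pi * ρ₀ * B ^ (3 / 5 : ℝ) * (4 ^ (4 * n))⁻¹ * X * (n + 1) +
        8 * ((L₀ + 2 * (6 * M + 26)) * (n + 1)) * (K ^ (1 / 5 : ℝ) * X * (4 ^ (4 * n))⁻¹) := by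
        refine add_le_add (hfirst.trans (le_mul_of_one_le_right (by positivity) hn1)) ?_
        gcongr
    _ = _ := by ring

/-! ### Decomposition of the Fejér multiplier into bumps -/

/-- The truncation of `x` to `[0, 1]`. -/
def ramp (x : ℝ) : ℝ := max 0 (min 1 x)

lemma ramp_nonneg (x : ℝ) : 0 ≤ ramp x := le_max_left _ _

lemma ramp_le_one (x : ℝ) : ramp x ≤ 1 := max_le zero_le_one (min_le_left _ _)

lemma ramp_of_nonpos {x : ℝ} (h : x ≤ 0) : ramp x = 0 := max_eq_left ((min_le_right _ _).trans h)

lemma ramp_of_one_le {x : ℝ} (h : 1 ≤ x) : ramp x = 1 := by rw [ramp, min_eq_left h]; norm_num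

lemma abs_ramp_sub_ramp_le (x y : ℝ) : |ramp x - ramp y| ≤ |x - y| := by
  unfold ramp
  refine (abs_max_sub_max_le_max _ _ _ _).trans (max_le (by simp) ?_)
  exact (abs_min_sub_min_le_max _ _ _ _).trans (max_le (by simp) le_rfl)

lemma abs_mul_sub_mul_le {f f' g g' x y : ℝ} (hf : |f| ≤ 1) (hg' : |g'| ≤ 1) (hx : |f' - f| ≤ x)
    (hy : |g' - g| ≤ y) : |f' * g' - f * g| ≤ x + y := by
  have e : f' * g' - f * g = (f' - f) * g' + f * (g' - g) := by ring
  rw [e]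
  refine (abs_add_le _ _).trans (add_le_add ?_ ?_) <;> rw [abs_mul]
  · exact (mul_le_of_le_one_right (abs_nonneg _) hg').trans hx
  · exact (mul_le_of_le_one_left (abs_nonneg _) hf).trans hy

/-- The part of the Fejér multiplier around the frequencies between two radii. -/
def ringCoeff (X X' : ℝ) (k : ℤ) : ℝ := ramp (2 - k / X') - ramp (2 - k / X)

lemma ringCoeff_abs_le (X X' : ℝ) (k : ℤ) : |ringCoeff X X' k| ≤ 1 := by
  rw [ringCoeff, abs_le]
  constructor <;>
  linarith [ramp_nonneg (2 - k / X), ramp_nonneg (2 - k / X'), ramp_le_one (2 - k / X),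
    ramp_le_one (2 - k / X')]

lemma abs_ramp_step_le {X : ℝ} (hX : 0 < X) (k : ℤ) (d : ℝ) :
    |ramp (d - ((k + 1 : ℤ) : ℝ) / X) - ramp (d - k / X)| ≤ 1 / X := by
  refine (abs_ramp_sub_ramp_le _ _).trans ?_
  rw [show d - ((k + 1 : ℤ) : ℝ) / X - (d - k / X) = -(1 / X) by push_cast; ring, abs_neg,
    abs_of_pos (by positivity)]

lemma abs_ramp_step_le' {X : ℝ} (hX : 0 < X) (k : ℤ) (d : ℝ) :
    |ramp (((k + 1 : ℤ) : ℝ) / X - d) - ramp (k / X - d)| ≤ 1 / X := by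
  refine (abs_ramp_sub_ramp_le _ _).trans ?_
  rw [show ((k + 1 : ℤ) : ℝ) / X - d - (k / X - d) = 1 / X by push_cast; ring,
    abs_of_pos (by positivity)]

/-- A tent of width `H` centred at `l H`. -/
def tentCoeff (H : ℝ) (l : ℕ) (k : ℤ) : ℝ := ramp (k / H - (l - 1)) - ramp (k / H - l)

lemma tentCoeff_abs_le (H : ℝ) (l : ℕ) (k : ℤ) : |tentCoeff H l k| ≤ 1 := by
  rw [tentCoeff, abs_le]
  constructor <;>
  linarith [ramp_nonneg (k / H - l), ramp_nonneg (k / H - (l - 1)), ramp_le_one (k / H - l),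
    ramp_le_one (k / H - (l - 1))]

lemma tentCoeff_ne_zero {H : ℝ} (hH : 0 < H) {l : ℕ} {k : ℤ} (h : tentCoeff H l k ≠ 0) :
    (l - 1) * H < k ∧ k < (l + 1) * H := by
  by_contra hc
  apply h
  rw [not_and_or, not_lt, not_lt, ← div_le_iff₀ hH, ← le_div_iff₀ hH] at hc
  rw [tentCoeff]
  rcases hc with hc | hc
  · rw [ramp_of_nonpos (by linarith), ramp_of_nonpos (by linarith), sub_zero]
  · rw [ramp_of_one_le (by linarith), ramp_of_one_le (by linarith), sub_self]

lemma ringCoeff_ne_zero {X X' : ℝ} (hX : 0 < X) (hX' : X ≤ X') {k : ℤ} (h : ringCoeff X X' k ≠ 0) :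
    X < k ∧ k < 2 * X' := by
  have hX'0 : 0 < X' := hX.trans_le hX'
  by_contra hc
  apply h
  rw [not_and_or, not_lt, not_lt] at hc
  rw [ringCoeff]
  rcases hc with hc | hc
  · have h1 := (div_le_one hX).2 hc
    have h2 := (div_le_one hX'0).2 (hc.trans hX')
    rw [ramp_of_one_le (by linarith), ramp_of_one_le (by linarith), sub_self]
  · have h1 : 2 ≤ k / X' := (le_div_iff₀ hX'0).2 hc
    have h2 : 2 ≤ k / X := (le_div_iff₀ hX).2 (by nlinarith)
    rw [ramp_of_nonpos (by linarith), ramp_of_nonpos (by linarith), sub_zero]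

/-- The inner radius of the `n`-th frequency ring. -/
def ringRadius (M n : ℕ) : ℝ := 4 * 4 ^ (n * (M + 1))

lemma ringRadius_pos (M n : ℕ) : 0 < ringRadius M n := by unfold ringRadius; positivity

lemma ringRadius_le (M n : ℕ) : ringRadius M n ≤ ringRadius M (n + 1) := by
  unfold ringRadius; gcongr <;> norm_num

/-- The `l`-th bump inside the `n`-th ring of the Fejér multiplier of order `N`. -/
def bumpCoeff (M : ℕ) (N : ℝ) (n l : ℕ) (k : ℤ) : ℝ :=
  ramp (1 - k / N) * ringCoeff (ringRadius M n) (ringRadius M (n + 1)) k *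
    tentCoeff (4 ^ (n * M)) l k

lemma bumpCoeff_abs_le (M : ℕ) (N : ℝ) (n l : ℕ) (k : ℤ) : |bumpCoeff M N n l k| ≤ 1 := by
  rw [bumpCoeff, abs_mul, abs_mul]
  refine mul_le_one₀ (mul_le_one₀ ?_ (abs_nonneg _) (ringCoeff_abs_le _ _ _)) (abs_nonneg _)
    (tentCoeff_abs_le _ _ _)
  rw [abs_of_nonneg (ramp_nonneg _)]; exact ramp_le_one _

lemma bumpCoeff_ne_zero {M : ℕ} {N : ℝ} (hN : 0 < N) {n l : ℕ} {k : ℤ} (h : bumpCoeff M N n l k ≠ 0) :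
    (k < N ∧ ringRadius M n < k ∧ k < 2 * ringRadius M (n + 1)) ∧
      (l - 1) * 4 ^ (n * M) < (k : ℝ) ∧ k < (l + 1) * (4 : ℝ) ^ (n * M) := by
  have h1 := mul_ne_zero_iff.1 h
  have h2 := mul_ne_zero_iff.1 h1.1
  refine ⟨⟨?_, ringCoeff_ne_zero (ringRadius_pos _ _) (ringRadius_le _ _) h2.2⟩,
    tentCoeff_ne_zero (by positivity) h1.2⟩
  by_contra hc
  have := (one_le_div hN).2 (not_lt.1 hc)
  exact h2.1 (ramp_of_nonpos (by linarith))

lemma ringRadius_eq (M n : ℕ) : ringRadius M n = 4 * 4 ^ n * 4 ^ (n * M) := by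
  rw [ringRadius, mul_add, pow_add]; ring

lemma bumpCoeff_eq_zero {M : ℕ} {N : ℝ} (hN : 0 < N) {n l : ℕ} (hl : l < 4 * 4 ^ n) (k : ℤ) :
    bumpCoeff M N n l k = 0 := by
  by_contra h
  have h1 := bumpCoeff_ne_zero hN h
  have h2 := h1.1.2.1
  rw [ringRadius_eq] at h2
  have h3 : (l + 1 : ℝ) ≤ 4 * 4 ^ n := by exact_mod_cast hl
  have h4 : (l + 1) * (4 : ℝ) ^ (n * M) ≤ 4 * 4 ^ n * 4 ^ (n * M) := by gcongr
  linarith [h1.2.2]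

lemma isBump_bumpCoeff {M : ℕ} {N : ℝ} {n l : ℕ} (hN : (4 : ℝ) ^ (n * M) ≤ N)
    (hl : 4 * 4 ^ n ≤ l) :
    IsBump (Finset.Ioo (((l : ℤ) - 1) * 4 ^ (n * M)) ((l + 1) * 4 ^ (n * M))) (bumpCoeff M N n l)
      (4 ^ (n * M)) ((l - 1) * 4 ^ (n * M)) n := by
  have hH : (0 : ℝ) < 4 ^ (n * M) := by positivity
  have hN0 : 0 < N := hH.trans_le hN
  have hl' : 4 * (4 : ℝ) ^ n ≤ l := by exact_mod_cast hl
  have h4n : (1 : ℝ) ≤ 4 ^ n := one_le_pow₀ (by norm_num)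
  have hX : (4 : ℝ) ^ (n * M) ≤ ringRadius M n := by rw [ringRadius_eq]; nlinarith
  refine ⟨hH, by nlinarith, ?_, ?_, bumpCoeff_abs_le M N n l, ?_, ?_⟩
  · intro k hk
    have h := (bumpCoeff_ne_zero hN0 hk).2
    rw [Finset.mem_Ioo]
    exact ⟨by exact_mod_cast h.1, by exact_mod_cast h.2⟩
  · rw [Int.card_Ioo, show ((l : ℤ) + 1) * 4 ^ (n * M) - (l - 1) * 4 ^ (n * M) - 1
      = ((2 * 4 ^ (n * M) : ℕ) : ℤ) - 1 by push_cast; ring]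
    have h1 : ((((2 * 4 ^ (n * M) : ℕ) : ℤ) - 1).toNat) ≤ 2 * 4 ^ (n * M) := by omega
    have h2 : (((((2 * 4 ^ (n * M) : ℕ) : ℤ) - 1).toNat : ℕ) : ℝ) ≤ ((2 * 4 ^ (n * M) : ℕ) : ℝ) := by
      exact_mod_cast h1
    push_cast at h2 ⊢
    linarith
  · intro k
    have hring : |ringCoeff (ringRadius M n) (ringRadius M (n + 1)) (k + 1) -
        ringCoeff (ringRadius M n) (ringRadius M (n + 1)) k| ≤
          1 / 4 ^ (n * M) + 1 / 4 ^ (n * M) := by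
      have h1 := abs_ramp_step_le (ringRadius_pos M n) k 2
      have h2 := abs_ramp_step_le (ringRadius_pos M (n + 1)) k 2
      have h3 : 1 / ringRadius M n ≤ 1 / 4 ^ (n * M) := one_div_le_one_div_of_le hH hX
      have h4 : 1 / ringRadius M (n + 1) ≤ 1 / 4 ^ (n * M) :=
        one_div_le_one_div_of_le hH (hX.trans (ringRadius_le _ _))
      rw [abs_le] at h1 h2 ⊢
      unfold ringCoeff
      constructor <;> linarith [h1.1, h1.2, h2.1, h2.2]
    have htent : |tentCoeff (4 ^ (n * M)) l (k + 1) - tentCoeff (4 ^ (n * M)) l k| ≤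
          1 / 4 ^ (n * M) + 1 / 4 ^ (n * M) := by
      have h1 := abs_ramp_step_le' hH k l
      have h2 := abs_ramp_step_le' hH k (l - 1)
      rw [abs_le] at h1 h2 ⊢
      unfold tentCoeff
      constructor <;> linarith [h1.1, h1.2, h2.1, h2.2]
    have hfej := (abs_ramp_step_le hN0 k 1).trans (one_div_le_one_div_of_le hH hN)
    have hr1 : ∀ x, |ramp x| ≤ 1 := fun x => by
      rw [abs_of_nonneg (ramp_nonneg _)]; exact ramp_le_one _
    have h5 := abs_mul_sub_mul_le (hr1 _) (ringCoeff_abs_le _ _ _) hfej hring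
    have h6 := abs_mul_sub_mul_le (f := ramp (1 - k / N) *
      ringCoeff (ringRadius M n) (ringRadius M (n + 1)) k)
      (by rw [abs_mul]; exact mul_le_one₀ (hr1 _) (abs_nonneg _) (ringCoeff_abs_le _ _ _))
      (tentCoeff_abs_le _ _ _) h5 htent
    refine h6.trans (le_of_eq ?_)
    ring
  · intro k hk
    have h := (bumpCoeff_ne_zero hN0 hk).2
    refine ⟨h.1.le, h.2.le.trans ?_⟩
    have h1 : (l + 1 : ℝ) ≤ (l - 1) * (1 + (4 ^ n)⁻¹) := by
      have h2 : 2 ≤ (l - 1) * ((4 : ℝ) ^ n)⁻¹ := by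
        rw [← div_eq_mul_inv, le_div_iff₀ (by positivity)]; linarith
      linarith
    calc (l + 1) * (4 : ℝ) ^ (n * M) ≤ ((l - 1) * (1 + (4 ^ n)⁻¹)) * 4 ^ (n * M) := by gcongr
      _ = _ := by ring

/-- The number of tents needed to cover the `n`-th ring. -/
def tentCount (M n : ℕ) : ℕ := 8 * 4 ^ (M + 1) * 4 ^ n + 1

lemma ramp_eq_sum_bumpCoeff {M J : ℕ} {N : ℝ} (hJ : N ≤ ringRadius M J) {k : ℤ}
    (hk : 0 ≤ k) (hkN : (k : ℝ) ≤ N) :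
    ramp (1 - k / N) = ramp (1 - k / N) * ramp (2 - k / ringRadius M 0) +
      ∑ n ∈ Finset.range J, ∑ l ∈ Finset.range (tentCount M n), bumpCoeff M N n l k := by
  have hk0 : (0 : ℝ) ≤ k := by exact_mod_cast hk
  have htent : ∀ n, ∑ l ∈ Finset.range (tentCount M n), bumpCoeff M N n l k
      = ramp (1 - k / N) * ringCoeff (ringRadius M n) (ringRadius M (n + 1)) k := by
    intro n
    by_cases h0 : ringCoeff (ringRadius M n) (ringRadius M (n + 1)) k = 0
    · simp [bumpCoeff, h0]
    have h1 := (ringCoeff_ne_zero (ringRadius_pos _ _) (ringRadius_le _ _) h0).2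
    have hH : (0 : ℝ) < 4 ^ (n * M) := by positivity
    have h2 : (k : ℝ) / 4 ^ (n * M) ≤ 8 * 4 ^ (M + 1) * 4 ^ n := by
      rw [div_le_iff₀ hH]
      refine h1.le.trans (le_of_eq ?_)
      rw [ringRadius]; ring
    unfold bumpCoeff
    rw [← Finset.mul_sum]
    have h3 : ∑ l ∈ Finset.range (tentCount M n), tentCoeff (4 ^ (n * M)) l k = 1 := by
      have h4 : ∀ l : ℕ, tentCoeff (4 ^ (n * M)) l k = ramp (k / 4 ^ (n * M) - (l - 1))
          - ramp (k / 4 ^ (n * M) - ((l + 1 : ℕ) - 1)) := fun l => by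
        rw [tentCoeff]; push_cast; ring_nf
      simp_rw [h4]
      rw [Finset.sum_range_sub' (fun l : ℕ => ramp (k / 4 ^ (n * M) - (l - 1))), ramp_of_one_le,
        ramp_of_nonpos, sub_zero]
      · rw [tentCount]; push_cast; linarith
      · have : 0 ≤ (k : ℝ) / 4 ^ (n * M) := by positivity
        push_cast; linarith
    rw [h3, mul_one]
  simp_rw [htent]
  rw [← Finset.mul_sum, ← mul_add]
  unfold ringCoeff
  rw [Finset.sum_range_sub (fun n => ramp (2 - k / ringRadius M n))]
  have h5 := (div_le_one (ringRadius_pos M J)).2 (hkN.trans hJ)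
  rw [ramp_of_one_le (x := 2 - k / ringRadius M J) (by linarith)]
  ring

/-! ### Summation of the bumps -/

lemma sum_rpow_six_fifths_le (L : ℕ) {f : ℕ → ℝ} (hf : ∀ n, 0 ≤ f n) :
    (∑ l ∈ Finset.range L, f l) ^ (6 / 5 : ℝ) ≤
      L * ∑ l ∈ Finset.range L, f l ^ (6 / 5 : ℝ) := by
  have h := Real.rpow_sum_le_const_mul_sum_rpow_of_nonneg (Finset.range L) (f := f) (p := 6 / 5)
    (by norm_num) fun i _ => hf i
  refine h.trans ?_
  rw [Finset.card_range]
  refine mul_le_mul_of_nonneg_right ?_ (Finset.sum_nonneg fun l _ => Real.rpow_nonneg (hf l) _)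
  rcases Nat.eq_zero_or_pos L with rfl | hL
  · norm_num
  · conv_rhs => rw [← Real.rpow_one (L : ℝ)]
    exact Real.rpow_le_rpow_of_exponent_le (by exact_mod_cast hL) (by norm_num)

lemma add_rpow_six_fifths_le {x y : ℝ} (hx : 0 ≤ x) (hy : 0 ≤ y) :
    (x + y) ^ (6 / 5 : ℝ) ≤ 2 * (x ^ (6 / 5 : ℝ) + y ^ (6 / 5 : ℝ)) := by
  have h := sum_rpow_six_fifths_le 2 (f := fun n => if n = 0 then x else y)
    fun n => by split_ifs <;> assumption
  simpa [Finset.sum_range_succ] using h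

lemma sum_range_rpow_six_fifths_le (J : ℕ) : ∀ {f : ℕ → ℝ}, (∀ n, 0 ≤ f n) →
    (∑ n ∈ Finset.range J, f n) ^ (6 / 5 : ℝ) ≤
      ∑ n ∈ Finset.range J, 2 ^ (n + 1) * f n ^ (6 / 5 : ℝ) := by
  induction J with
  | zero => intro f _; simp
  | succ J ih =>
    intro f hf
    rw [Finset.sum_range_succ', Finset.sum_range_succ']
    refine (add_rpow_six_fifths_le (Finset.sum_nonneg fun n _ => hf _) (hf 0)).trans ?_
    rw [mul_add]
    refine add_le_add ?_ (by norm_num)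
    refine (mul_le_mul_of_nonneg_left (ih fun n => hf (n + 1)) (by norm_num)).trans ?_
    rw [Finset.mul_sum]
    exact le_of_eq (Finset.sum_congr rfl fun n _ => by ring)

lemma projTrig_congr (μ : Measure E3) [IsFiniteMeasure μ] {S T : Finset ℤ} {κ : ℤ → ℂ}
    (h : ∀ k, κ k ≠ 0 → (k ∈ S ↔ k ∈ T)) (u : E3) (t : ℝ) :
    projTrig μ S κ u t = projTrig μ T κ u t := by
  rw [projTrig_eq_sum, projTrig_eq_sum]
  refine Finset.sum_congr_of_eq_on_inter (fun k hS hT => ?_) (fun k hT hS => ?_) fun _ _ _ => rfl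
  · rw [show κ k = 0 by by_contra h0; exact hT ((h k h0).1 hS)]; simp
  · rw [show κ k = 0 by by_contra h0; exact hS ((h k h0).2 hT)]; simp

/-- The frequency support of the `l`-th bump in the `n`-th ring. -/
def bumpSupport (M n l : ℕ) : Finset ℤ :=
  Finset.Ioo (((l : ℤ) - 1) * 4 ^ (n * M)) ((l + 1) * 4 ^ (n * M))

lemma norm_projTrig_fejer_le (μ : Measure E3) [IsFiniteMeasure μ] {M J N : ℕ} (hN0 : 0 < N)
    (hN : (N : ℝ) ≤ ringRadius M J) (u : E3) (t : ℝ) :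
    ‖projTrig μ (Finset.Ioo 0 (N : ℤ)) (fun k => (ramp (1 - k / N) : ℂ)) u t‖ ≤
      7 * μ.real univ + ∑ n ∈ Finset.range J, ∑ l ∈ Finset.range (tentCount M n),
        ‖projTrig μ (bumpSupport M n l) (fun k => (bumpCoeff M N n l k : ℂ)) u t‖ := by
  have hN0' : (0 : ℝ) < N := by exact_mod_cast hN0
  set T := Finset.Ioo 0 (N : ℤ) with hT
  set κb : ℤ → ℂ := fun k => (ramp (1 - k / N) * ramp (2 - k / ringRadius M 0) : ℝ) with hκb
  have hsplit : projTrig μ T (fun k => (ramp (1 - k / N) : ℂ)) u t = projTrig μ T κb u t +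
      ∑ n ∈ Finset.range J, ∑ l ∈ Finset.range (tentCount M n),
        projTrig μ T (fun k => (bumpCoeff M N n l k : ℂ)) u t := by
    simp_rw [projTrig_eq_sum]
    simp_rw [Finset.sum_comm (t := T)]
    rw [← Finset.sum_add_distrib]
    refine Finset.sum_congr rfl fun k hk => ?_
    rw [hT, Finset.mem_Ioo] at hk
    have hkN : (k : ℝ) ≤ N := by exact_mod_cast hk.2.le
    rw [ramp_eq_sum_bumpCoeff hN hk.1.le hkN]
    simp only [hκb]
    push_cast
    simp_rw [add_mul, Finset.sum_mul]
  have hbase : ‖projTrig μ T κb u t‖ ≤ 7 * μ.real univ := by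
    rw [projTrig_congr μ (T := T ∩ Finset.Ioo 0 8) (fun k hk => ?_)]
    · refine (norm_projTrig_le μ _ (fun k => ?_) u t).trans ?_
      · rw [hκb, Complex.norm_real, Real.norm_of_nonneg (mul_nonneg (ramp_nonneg _) (ramp_nonneg _))]
        exact mul_le_one₀ (ramp_le_one _) (ramp_nonneg _) (ramp_le_one _)
      · gcongr
        have h1 : (T ∩ Finset.Ioo 0 8).card ≤ (Finset.Ioo (0 : ℤ) 8).card :=
          Finset.card_le_card Finset.inter_subset_right
        rw [show (Finset.Ioo (0 : ℤ) 8).card = 7 by rfl] at h1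
        exact_mod_cast h1
    · rw [Finset.mem_inter]
      refine ⟨fun h => ⟨h, Finset.mem_Ioo.2 ⟨(Finset.mem_Ioo.1 h).1, ?_⟩⟩, fun h => h.1⟩
      by_contra hc
      have h8 : (8 : ℝ) ≤ k := by exact_mod_cast not_lt.1 hc
      have h2 : ramp (2 - k / ringRadius M 0) = 0 := ramp_of_nonpos (by
        simp only [ringRadius, zero_mul, pow_zero]; linarith)
      simp [hκb, h2] at hk
  have hpiece : ∀ n l, projTrig μ T (fun k => (bumpCoeff M N n l k : ℂ)) u t =
      projTrig μ (bumpSupport M n l) (fun k => (bumpCoeff M N n l k : ℂ)) u t := by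
    intro n l
    refine projTrig_congr μ (fun k hk => ?_) u t
    have h := bumpCoeff_ne_zero hN0' (by exact_mod_cast hk)
    refine iff_of_true ?_ ?_
    · rw [hT, Finset.mem_Ioo]
      exact ⟨by exact_mod_cast (ringRadius_pos M n).trans h.1.2.1, by exact_mod_cast h.1.1⟩
    · rw [bumpSupport, Finset.mem_Ioo]
      exact ⟨by exact_mod_cast h.2.1, by exact_mod_cast h.2.2⟩
  rw [hsplit]
  refine (norm_add_le _ _).trans (add_le_add hbase ?_)
  refine (norm_sum_le _ _).trans (Finset.sum_le_sum fun n _ => ?_)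
  refine (norm_sum_le _ _).trans (Finset.sum_le_sum fun l _ => ?_)
  rw [hpiece]

lemma isBddMeas_projTrig_comp (μ : Measure E3) [IsFiniteMeasure μ] (S : Finset ℤ) {κ : ℤ → ℂ}
    (hκ : ∀ k, ‖κ k‖ ≤ 1) {γ : ℝ → E3} (hγ : Continuous γ) :
    IsBddMeas fun q : ℝ × ℝ => projTrig μ S κ (γ q.1) q.2 :=
  ⟨((continuous_projTrig μ S κ).comp (hγ.prodMap continuous_id)).measurable, _,
    fun _ => norm_projTrig_le μ S hκ _ _⟩

lemma ring_sum_le (M n : ℕ) : (2 : ℝ) ^ (n + 1) * (tentCount M n * (tentCount M n *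
    ((n + 1) * (4 ^ (4 * n))⁻¹))) ≤ 8 * (8 * 4 ^ (M + 1)) ^ 2 * (1 / 2) ^ n := by
  have h1 : (tentCount M n : ℝ) ≤ 2 * (8 * 4 ^ (M + 1)) * 4 ^ n := by
    have : (1 : ℝ) ≤ 8 * 4 ^ (M + 1) * 4 ^ n := by
      have h1 : (1 : ℝ) ≤ 4 ^ (M + 1) := one_le_pow₀ (by norm_num)
      have h2 : (1 : ℝ) ≤ 4 ^ n := one_le_pow₀ (by norm_num)
      nlinarith
    rw [tentCount]; push_cast; linarith
  have h2 : (n : ℝ) + 1 ≤ 2 ^ n := by exact_mod_cast Nat.lt_two_pow_self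
  calc (2 : ℝ) ^ (n + 1) * (tentCount M n * (tentCount M n * ((n + 1) * (4 ^ (4 * n))⁻¹)))
      ≤ 2 ^ (n + 1) * ((2 * (8 * 4 ^ (M + 1)) * 4 ^ n) * ((2 * (8 * 4 ^ (M + 1)) * 4 ^ n) *
        (2 ^ n * (4 ^ (4 * n))⁻¹))) := by gcongr
    _ = 8 * (8 * 4 ^ (M + 1)) ^ 2 * (2 * 4 * 4 * 2 / 4 ^ 4) ^ n := by
        have e : (2 * 4 * 4 * 2 / 4 ^ 4 : ℝ) ^ n = 2 ^ n * 4 ^ n * 4 ^ n * 2 ^ n * (4 ^ (4 * n))⁻¹ := by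
          rw [div_pow, mul_pow, mul_pow, mul_pow, ← pow_mul, div_eq_mul_inv]
        rw [e]; ring
    _ ≤ _ := by
        refine mul_le_mul_of_nonneg_left ?_ (by positivity)
        exact pow_le_pow_left₀ (by norm_num) (by norm_num) n

theorem CurveNondeg.exists_fejer_estimate {γ : ℝ → E3} {a b ρ c C : ℝ}
    (hγ : CurveNondeg γ a b ρ c C) (hγc : Continuous γ) (hab : a ≤ b) (M : ℕ) {α β : ℝ}
    (hα1 : 1 < α) (hα3 : α ≤ 3) (hM : 44 ≤ M * (2 * β - (3 - α))) :
    ∃ D, 0 ≤ D ∧ ∀ (J N : ℕ) (cμ cl : ℝ) (μ : Measure E3) (lam : Measure ℝ) [IsFiniteMeasure μ]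
      [IsFiniteMeasure lam], N = 4 ^ (J * M) →
      μ (closedBall 0 1)ᶜ = 0 → 0 < cμ → IsFrostman μ α cμ →
      lam (Icc a b)ᶜ = 0 → 0 ≤ cl → IsFrostman lam β cl →
      ∫ q, (μ.real univ + 2 * ‖projTrig μ (Finset.Ioo 0 (N : ℤ))
          (fun k => (ramp (1 - k / N) : ℂ)) (γ q.1) q.2‖) ^ (6 / 5 : ℝ) ∂(lam.prod circ) ≤
        D * massBound cμ (μ.real univ) (lam.real univ) cl := by
  set ρ₀ : ℝ := 8 * 4 ^ (M + 1) with hρ₀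
  have hρ₀1 : 1 ≤ ρ₀ := by
    have : (1 : ℝ) ≤ 4 ^ (M + 1) := one_le_pow₀ (by norm_num)
    linarith
  obtain ⟨D₁, hD₁, hbump⟩ := hγ.exists_bump_estimate hγc hab M hα1 hα3 hM hρ₀1
  set B : ℝ := (b - a + 1) ^ β with hB
  have hB0 : 0 ≤ B := Real.rpow_nonneg (by linarith) _
  have hpi := Real.pi_pos
  refine ⟨2 * (15 ^ (6 / 5 : ℝ) * (2 * Real.pi) * (8 ^ (1 / 5 : ℝ) * B ^ (3 / 5 : ℝ))) +
    2 * (2 ^ (6 / 5 : ℝ) * D₁ * (8 * ρ₀ ^ 2 * 2)), by positivity, ?_⟩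
  intro J N cμ cl μ lam _ _ hN hμ hcμ hFμ hlam hcl hFl
  have hN0 : 0 < N := by rw [hN]; positivity
  have hN0' : (0 : ℝ) < N := by exact_mod_cast hN0
  have hNr : (N : ℝ) = 4 ^ (J * M) := by rw [hN]; push_cast; ring
  have hNJ : (N : ℝ) ≤ ringRadius M J := by
    rw [hNr, ringRadius_eq]
    have : (1 : ℝ) ≤ 4 ^ J := one_le_pow₀ (by norm_num)
    have : (0 : ℝ) < 4 ^ (J * M) := by positivity
    nlinarith
  set mμ := μ.real univ with hmμ
  set ml := lam.real univ with hml
  have hmμ0 : 0 ≤ mμ := measureReal_nonneg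
  have hml0 : 0 ≤ ml := measureReal_nonneg
  have hmμle : mμ ≤ cμ * 8 := by
    refine (hFμ.measureReal_univ_le hcμ.le hμ (x := 0) (r := 2) (by norm_num)
      (closedBall_subset_ball (by norm_num))).trans ?_
    gcongr
    calc (2 : ℝ) ^ α ≤ 2 ^ (3 : ℝ) := Real.rpow_le_rpow_of_exponent_le (by norm_num) hα3
      _ = 8 := by norm_num
  have hmlle : ml ≤ cl * B := by
    refine hFl.measureReal_univ_le hcl hlam (x := a) (by linarith) fun t ht => ?_
    rw [mem_ball, Real.dist_eq, abs_of_nonneg (by linarith [ht.1])]; linarith [ht.2]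
  have hX0 := massBound_nonneg hcμ.le hmμ0 hml0 hcl
  have hlin := mul_le_massBound hcμ.le hmμ0 hml0 hcl hB0 hmlle
  set X := massBound cμ mμ ml cl with hX
  set P : ℕ → ℕ → ℝ × ℝ → ℝ := fun n l q =>
    ‖projTrig μ (bumpSupport M n l) (fun k => (bumpCoeff M N n l k : ℂ)) (γ q.1) q.2‖ with hP
  have hP0 : ∀ n l q, 0 ≤ P n l q := fun n l q => norm_nonneg _
  have hPint : ∀ n l, Integrable (fun q => P n l q ^ (6 / 5 : ℝ)) (lam.prod circ) := fun n l =>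
    integrable_norm_rpow (isBddMeas_projTrig_comp μ _ (fun k => by
      rw [Complex.norm_real]; exact bumpCoeff_abs_le M N n l k) hγc) (by norm_num)
  have hpiece : ∀ n ∈ Finset.range J, ∀ l ∈ Finset.range (tentCount M n),
      ∫ q, P n l q ^ (6 / 5 : ℝ) ∂(lam.prod circ) ≤ D₁ * ((n + 1) * (4 ^ (4 * n))⁻¹) * X := by
    intro n hn l hl
    rw [Finset.mem_range] at hn hl
    by_cases hl4 : l < 4 * 4 ^ n
    · have h0 : ∀ q, P n l q ^ (6 / 5 : ℝ) = 0 := fun q => by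
        simp only [hP, bumpCoeff_eq_zero hN0' hl4, projTrig_eq_sum]
        simp
      simp only [h0, integral_zero]
      positivity
    · rw [integral_prod _ (hPint n l)]
      have hl4' : 4 * (4 : ℝ) ^ n ≤ l := by exact_mod_cast not_lt.1 hl4
      have h4n : (1 : ℝ) ≤ 4 ^ n := one_le_pow₀ (by norm_num)
      have hH1 : (1 : ℝ) ≤ 4 ^ (n * M) := one_le_pow₀ (by norm_num)
      have hHR : (4 : ℝ) ^ (n * M) ≤ (l - 1) * 4 ^ (n * M) := by nlinarith
      have hHN : (4 : ℝ) ^ (n * M) ≤ N := by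
        rw [hNr]
        exact pow_le_pow_right₀ (by norm_num) (Nat.mul_le_mul_right _ hn.le)
      have hlc : (l : ℝ) ≤ ρ₀ * 4 ^ n := by
        rw [tentCount] at hl
        have : l ≤ 8 * 4 ^ (M + 1) * 4 ^ n := by omega
        rw [hρ₀]; exact_mod_cast this
      have h := hbump n ((l - 1) * 4 ^ (n * M)) (4 ^ (n * M)) cμ cl (bumpSupport M n l)
        (bumpCoeff M N n l) μ lam (hH1.trans hHR) hHR ?_ (isBump_bumpCoeff hHN (not_lt.1 hl4))
        hμ hcμ hFμ hlam hcl hFl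
      · refine h.trans (le_of_eq (by ring))
      · calc ((l : ℝ) - 1) * 4 ^ (n * M) ≤ ρ₀ * 4 ^ n * 4 ^ (n * M) := by gcongr; linarith
          _ = _ := by rw [mul_add, pow_add]; ring
  have hpt : ∀ q : ℝ × ℝ, (mμ + 2 * ‖projTrig μ (Finset.Ioo 0 (N : ℤ))
          (fun k => (ramp (1 - k / N) : ℂ)) (γ q.1) q.2‖) ^ (6 / 5 : ℝ) ≤
      2 * (15 * mμ) ^ (6 / 5 : ℝ) + 2 * (2 ^ (6 / 5 : ℝ) * ∑ n ∈ Finset.range J, 2 ^ (n + 1) *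
        (tentCount M n * ∑ l ∈ Finset.range (tentCount M n), P n l q ^ (6 / 5 : ℝ))) := by
    intro q
    have h1 := norm_projTrig_fejer_le μ hN0 hNJ (γ q.1) q.2
    have hs0 : ∀ n, 0 ≤ ∑ l ∈ Finset.range (tentCount M n), P n l q := fun n =>
      Finset.sum_nonneg fun l _ => hP0 n l q
    have hss0 := Finset.sum_nonneg fun n (_ : n ∈ Finset.range J) => hs0 n
    calc _ ≤ (15 * mμ + 2 * ∑ n ∈ Finset.range J, ∑ l ∈ Finset.range (tentCount M n), P n l q)
          ^ (6 / 5 : ℝ) := by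
          refine Real.rpow_le_rpow (by positivity) ?_ (by norm_num)
          linarith
      _ ≤ _ := by
          refine (add_rpow_six_fifths_le (by positivity) (by positivity)).trans ?_
          rw [mul_add, Real.mul_rpow (by norm_num) hss0]
          gcongr
          refine (sum_range_rpow_six_fifths_le J hs0).trans ?_
          gcongr with n hn
          exact sum_rpow_six_fifths_le _ fun l => hP0 n l q
  have hint1 : ∀ n, Integrable (fun q => (2 : ℝ) ^ (n + 1) *
        (tentCount M n * ∑ l ∈ Finset.range (tentCount M n), P n l q ^ (6 / 5 : ℝ)))
        (lam.prod circ) := fun n =>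
    ((integrable_finsetSum _ fun l _ => hPint n l).const_mul _).const_mul _
  have hint2 : Integrable (fun q => 2 * (2 ^ (6 / 5 : ℝ) * ∑ n ∈ Finset.range J, (2 : ℝ) ^ (n + 1) *
        (tentCount M n * ∑ l ∈ Finset.range (tentCount M n), P n l q ^ (6 / 5 : ℝ))))
        (lam.prod circ) :=
    ((integrable_finsetSum _ fun n _ => hint1 n).const_mul _).const_mul _
  refine (integral_mono_of_nonneg (Filter.Eventually.of_forall fun q => by positivity)
    ((integrable_const _).add hint2) (Filter.Eventually.of_forall hpt)).trans ?_
  simp only [Pi.add_apply]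
  rw [integral_add (integrable_const _) hint2, integral_const, integral_const_mul,
    integral_const_mul, integral_finsetSum _ fun n _ => hint1 n, add_mul]
  refine add_le_add ?_ ?_
  · have e1 : (lam.prod circ).real univ = ml * (2 * Real.pi) := by
      rw [← circ_real_univ, ← univ_prod_univ, measureReal_prod_prod]
    have e2 : mμ ^ (6 / 5 : ℝ) ≤ 8 ^ (1 / 5 : ℝ) * (cμ ^ (1 / 5 : ℝ) * mμ) := by
      calc mμ ^ (6 / 5 : ℝ) = mμ ^ (1 / 5 : ℝ) * mμ := by
            conv_rhs => rw [← Real.rpow_add_one' hmμ0 (by norm_num)]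
            norm_num
        _ ≤ (cμ * 8) ^ (1 / 5 : ℝ) * mμ := by gcongr
        _ = _ := by rw [Real.mul_rpow hcμ.le (by norm_num)]; ring
    rw [e1, smul_eq_mul, Real.mul_rpow (by norm_num) hmμ0]
    calc ml * (2 * Real.pi) * (2 * (15 ^ (6 / 5 : ℝ) * mμ ^ (6 / 5 : ℝ)))
        ≤ ml * (2 * Real.pi) * (2 * (15 ^ (6 / 5 : ℝ) *
          (8 ^ (1 / 5 : ℝ) * (cμ ^ (1 / 5 : ℝ) * mμ)))) := by gcongr
      _ = 2 * (15 ^ (6 / 5 : ℝ) * (2 * Real.pi) * 8 ^ (1 / 5 : ℝ)) *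
          (cμ ^ (1 / 5 : ℝ) * mμ * ml) := by ring
      _ ≤ 2 * (15 ^ (6 / 5 : ℝ) * (2 * Real.pi) * 8 ^ (1 / 5 : ℝ)) * (B ^ (3 / 5 : ℝ) * X) := by
          gcongr
      _ = _ := by ring
  · have h3 : ∀ n ∈ Finset.range J, ∫ q, (2 : ℝ) ^ (n + 1) * (tentCount M n *
        ∑ l ∈ Finset.range (tentCount M n), P n l q ^ (6 / 5 : ℝ)) ∂(lam.prod circ) ≤
        D₁ * X * (8 * ρ₀ ^ 2 * (1 / 2) ^ n) := by
      intro n hn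
      rw [integral_const_mul, integral_const_mul, integral_finsetSum _ fun l _ => hPint n l]
      calc _ ≤ (2 : ℝ) ^ (n + 1) * (tentCount M n * ∑ l ∈ Finset.range (tentCount M n),
            D₁ * ((n + 1) * (4 ^ (4 * n))⁻¹) * X) := by
            gcongr with l hl
            exact hpiece n hn l hl
        _ = D₁ * X * ((2 : ℝ) ^ (n + 1) * (tentCount M n * (tentCount M n *
            ((n + 1) * (4 ^ (4 * n))⁻¹)))) := by
            rw [Finset.sum_const, Finset.card_range, nsmul_eq_mul]; ring
        _ ≤ _ := mul_le_mul_of_nonneg_left (ring_sum_le M n) (by positivity)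
    have h4 : ∑ n ∈ Finset.range J, D₁ * X * (8 * ρ₀ ^ 2 * (1 / 2) ^ n) ≤
        D₁ * X * (8 * ρ₀ ^ 2 * 2) := by
      rw [← Finset.mul_sum, ← Finset.mul_sum]
      gcongr
      exact sum_geometric_two_le J
    calc _ ≤ 2 * (2 ^ (6 / 5 : ℝ) * (D₁ * X * (8 * ρ₀ ^ 2 * 2))) := by
          gcongr
          exact (Finset.sum_le_sum h3).trans h4
      _ = _ := by ring

/-! ### The Fejér kernel -/

lemma normSq_sum_expo (N : ℕ) (s : ℝ) : ‖∑ j ∈ Finset.range N, expo j s‖ ^ 2 =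
    N + 2 * (∑ k ∈ Finset.range N, ((N : ℂ) - (k + 1)) * expo (k + 1) s).re := by
  induction N with
  | zero => simp
  | succ N ih =>
    have h1 : ∑ k ∈ Finset.range (N + 1), (((N + 1 : ℕ) : ℂ) - (k + 1)) * expo (k + 1) s =
        ∑ k ∈ Finset.range N, ((N : ℂ) - (k + 1)) * expo (k + 1) s +
          ∑ k ∈ Finset.range N, expo (k + 1) s := by
      rw [Finset.sum_range_succ, ← Finset.sum_add_distrib]
      push_cast
      rw [show ((N : ℂ) + 1 - (N + 1)) = 0 by ring, zero_mul, add_zero]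
      exact Finset.sum_congr rfl fun k _ => by ring
    have h2 : expo N s * (starRingEnd ℂ) (∑ j ∈ Finset.range N, expo j s) =
        ∑ k ∈ Finset.range N, expo (k + 1) s := by
      rw [map_sum, Finset.mul_sum, ← Finset.sum_range_reflect]
      refine Finset.sum_congr rfl fun k hk => ?_
      rw [Finset.mem_range] at hk
      rw [conj_expo, ← expo_add]
      congr 1
      omega
    rw [Finset.sum_range_succ, h1, ← Complex.normSq_eq_norm_sq, Complex.normSq_add,
      Complex.normSq_eq_norm_sq, Complex.normSq_eq_norm_sq, norm_expo, ih]
    have h3 : (∑ j ∈ Finset.range N, expo j s) * (starRingEnd ℂ) (expo N s) =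
        (starRingEnd ℂ) (∑ k ∈ Finset.range N, expo (k + 1) s) := by
      rw [← h2, map_mul, Complex.conj_conj, mul_comm]
    rw [h3, Complex.conj_re, Complex.add_re]
    push_cast
    ring

lemma fejer_eq {N : ℕ} (hN : 0 < N) (s : ℝ) :
    1 + 2 * (trig (Finset.Ioo 0 (N : ℤ)) (fun k => (ramp (1 - k / N) : ℂ)) s).re =
      ‖∑ j ∈ Finset.range N, expo j s‖ ^ 2 / N := by
  have hN0 : (N : ℝ) ≠ 0 := by exact_mod_cast hN.ne'
  have hNp : (0 : ℝ) < N := by exact_mod_cast hN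
  have h1 : trig (Finset.Ioo 0 (N : ℤ)) (fun k => (ramp (1 - k / N) : ℂ)) s =
      ((N : ℝ)⁻¹ : ℝ) * ∑ k ∈ Finset.range N, ((N : ℂ) - (k + 1)) * expo (k + 1) s := by
    obtain ⟨m, rfl⟩ : ∃ m, N = m + 1 := ⟨N - 1, by omega⟩
    rw [Finset.sum_range_succ, show (((m + 1 : ℕ) : ℂ) - (m + 1)) = 0 by push_cast; ring, zero_mul,
      add_zero, trig, Finset.mul_sum]
    refine Finset.sum_nbij' (fun k => k.toNat - 1) (fun j => (j : ℤ) + 1) ?_ ?_ ?_ ?_ ?_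
    · intro k hk; rw [Finset.mem_Ioo] at hk; rw [Finset.mem_range]; omega
    · intro j hj; rw [Finset.mem_range] at hj; rw [Finset.mem_Ioo]; omega
    · intro k hk; rw [Finset.mem_Ioo] at hk; omega
    · intro j _; simp
    · intro k hk
      rw [Finset.mem_Ioo] at hk
      obtain ⟨j, rfl⟩ : ∃ j : ℕ, k = j + 1 := ⟨k.toNat - 1, by omega⟩
      have hj : ((j : ℤ) + 1).toNat - 1 = j := by omega
      have hjm : (j : ℝ) + 1 ≤ (m + 1 : ℕ) := by exact_mod_cast hk.2.le
      have hr : ramp (1 - (((j : ℤ) + 1 : ℤ) : ℝ) / (m + 1 : ℕ)) = 1 - (j + 1) / (m + 1 : ℕ) := by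
        push_cast at hNp hjm ⊢
        have h0 : 0 ≤ ((j : ℝ) + 1) / (m + 1) := by positivity
        have h1 : ((j : ℝ) + 1) / (m + 1) ≤ 1 := (div_le_one hNp).2 hjm
        rw [ramp, min_eq_right (by linarith), max_eq_right (by linarith)]
      rw [hj, hr]
      have hm : ((m : ℂ) + 1) ≠ 0 := by exact_mod_cast hN.ne'
      push_cast
      field_simp
  rw [h1, Complex.re_ofReal_mul, normSq_sum_expo]
  field_simp

lemma fejer_nonneg {N : ℕ} (hN : 0 < N) (s : ℝ) :
    0 ≤ 1 + 2 * (trig (Finset.Ioo 0 (N : ℤ)) (fun k => (ramp (1 - k / N) : ℂ)) s).re := by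
  rw [fejer_eq hN]; positivity

lemma le_fejer {N : ℕ} (hN : 0 < N) {s : ℝ} (hs : |s| ≤ 1 / N) : (N : ℝ) / 4 ≤
    1 + 2 * (trig (Finset.Ioo 0 (N : ℤ)) (fun k => (ramp (1 - k / N) : ℂ)) s).re := by
  have hNp : (0 : ℝ) < N := by exact_mod_cast hN
  have h1 : (N : ℝ) / 2 ≤ (∑ j ∈ Finset.range N, expo j s).re := by
    rw [Complex.re_sum]
    calc (N : ℝ) / 2 = ∑ j ∈ Finset.range N, (1 / 2 : ℝ) := by simp; ring
      _ ≤ _ := by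
        refine Finset.sum_le_sum fun j hj => ?_
        rw [expo, Complex.exp_ofReal_mul_I_re]
        refine le_trans ?_ (Real.one_sub_sq_div_two_le_cos)
        have hjN : (j : ℝ) ≤ N := by exact_mod_cast (Finset.mem_range.1 hj).le
        have h2 : |((j : ℤ) : ℝ) * s| ≤ 1 := by
          rw [abs_mul, Int.cast_natCast, Nat.abs_cast]
          calc (j : ℝ) * |s| ≤ N * (1 / N) := by gcongr
            _ = 1 := by field_simp
        have h3 := (sq_le_one_iff_abs_le_one _).2 h2
        linarith
  rw [fejer_eq hN, le_div_iff₀ hNp]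
  have h2 := (h1.trans (Complex.re_le_norm _))
  nlinarith

lemma measureReal_strip_le (μ : Measure E3) [IsFiniteMeasure μ] {N : ℕ} (hN : 0 < N) (u : E3) (t : ℝ) :
    (N : ℝ) / 4 * μ.real {x | |t - ⟪x, u⟫| ≤ 1 / N} ≤ μ.real univ +
      2 * ‖projTrig μ (Finset.Ioo 0 (N : ℤ)) (fun k => (ramp (1 - k / N) : ℂ)) u t‖ := by
  set F : ℝ → ℂ := trig (Finset.Ioo 0 (N : ℤ)) (fun k => (ramp (1 - k / N) : ℂ)) with hF
  have hFc : Continuous F := continuous_trig _ _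
  have hin : Continuous fun x : E3 => t - ⟪x, u⟫ := by fun_prop
  have hms : MeasurableSet {x : E3 | |t - ⟪x, u⟫| ≤ 1 / N} :=
    measurableSet_le (hin.abs).measurable measurable_const
  have hInt : Integrable (fun x : E3 => F (t - ⟪x, u⟫)) μ := by
    obtain ⟨_, B, hB⟩ := isBddMeas_trig (Finset.Ioo 0 (N : ℤ)) (fun k => (ramp (1 - k / N) : ℂ))
    exact Integrable.of_bound (hFc.comp hin).aestronglyMeasurable B
      (Filter.Eventually.of_forall fun x => hB _)
  have hre : Integrable (fun x : E3 => (F (t - ⟪x, u⟫)).re) μ := hInt.re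
  have e : ∫ x, (1 + 2 * (F (t - ⟪x, u⟫)).re) ∂μ = μ.real univ + 2 *
      (projTrig μ (Finset.Ioo 0 (N : ℤ)) (fun k => (ramp (1 - k / N) : ℂ)) u t).re := by
    rw [integral_add (integrable_const _) (hre.const_mul 2), integral_const_mul]
    congr 1
    · simp
    · congr 1
      exact integral_re hInt
  calc (N : ℝ) / 4 * μ.real {x | |t - ⟪x, u⟫| ≤ 1 / N}
      = ∫ x, {x | |t - ⟪x, u⟫| ≤ 1 / N}.indicator (fun _ => (N : ℝ) / 4) x ∂μ := by
        rw [integral_indicator hms]; simp [mul_comm]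
    _ ≤ ∫ x, (1 + 2 * (F (t - ⟪x, u⟫)).re) ∂μ := by
        refine integral_mono ((integrable_const _).indicator hms)
          ((integrable_const _).add (hre.const_mul 2)) fun x => ?_
        by_cases hx : x ∈ {x : E3 | |t - ⟪x, u⟫| ≤ 1 / N}
        · rw [indicator_of_mem hx]; exact le_fejer hN hx
        · rw [indicator_of_notMem hx]; exact fejer_nonneg hN _
    _ ≤ _ := by rw [e]; gcongr; exact Complex.re_le_norm _

/-! ### From averages over small intervals to densities -/

lemma measure_le_liminf_lintegral_closedBall (ν : Measure ℝ) [IsFiniteMeasure ν] {r : ℕ → ℝ}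
    (hr : ∀ J, 0 < r J) (hr0 : Filter.Tendsto r Filter.atTop (nhds 0)) {O : Set ℝ} (hO : IsOpen O) :
    ν O ≤ Filter.liminf (fun J => ∫⁻ t in O, (ENNReal.ofReal (2 * r J))⁻¹ * ν (closedBall t (r J)))
      Filter.atTop := by
  set h : ℕ → ℝ × ℝ → ℝ≥0∞ := fun J =>
    {q : ℝ × ℝ | dist q.2 q.1 ≤ r J}.indicator fun _ => (ENNReal.ofReal (2 * r J))⁻¹ with hh
  have hhm : ∀ J, Measurable (h J) := fun J =>
    measurable_const.indicator (measurableSet_le (measurable_snd.dist measurable_fst)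
      measurable_const)
  have hx : ∀ J x, ∫⁻ t in O, h J (x, t) = (ENNReal.ofReal (2 * r J))⁻¹ *
      volume (closedBall x (r J) ∩ O) := by
    intro J x
    have e : ∀ t, h J (x, t) = (closedBall x (r J)).indicator
        (fun _ => (ENNReal.ofReal (2 * r J))⁻¹) t := fun t => rfl
    simp_rw [e]
    rw [lintegral_indicator_const measurableSet_closedBall,
      Measure.restrict_apply measurableSet_closedBall]
  have ht : ∀ J t, ∫⁻ x, h J (x, t) ∂ν = (ENNReal.ofReal (2 * r J))⁻¹ * ν (closedBall t (r J)) := by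
    intro J t
    have e : ∀ x, h J (x, t) = (closedBall t (r J)).indicator
        (fun _ => (ENNReal.ofReal (2 * r J))⁻¹) x := fun x => by
      change (if dist t x ≤ r J then _ else _) = if dist x t ≤ r J then _ else _
      rw [dist_comm]
    simp_rw [e]
    rw [lintegral_indicator_const measurableSet_closedBall]
  calc ν O = ∫⁻ x, O.indicator 1 x ∂ν := by rw [lintegral_indicator_one hO.measurableSet]
    _ ≤ ∫⁻ x, Filter.liminf (fun J => ∫⁻ t in O, h J (x, t)) Filter.atTop ∂ν := by
        refine lintegral_mono fun x => ?_
        by_cases hxO : x ∈ O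
        · rw [indicator_of_mem hxO]
          refine Filter.le_liminf_of_le (by isBoundedDefault) ?_
          obtain ⟨ε, hε, hsub⟩ := Metric.isOpen_iff.1 hO x hxO
          filter_upwards [hr0.eventually (gt_mem_nhds hε)] with J hJ
          rw [hx, inter_eq_left.2 ((closedBall_subset_ball hJ).trans hsub), Real.volume_closedBall,
            ENNReal.inv_mul_cancel]
          · rfl
          · simpa using hr J
          · exact ENNReal.ofReal_ne_top
        · rw [indicator_of_notMem hxO]; exact zero_le
    _ ≤ Filter.liminf (fun J => ∫⁻ x, ∫⁻ t in O, h J (x, t) ∂volume ∂ν) Filter.atTop :=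
        lintegral_liminf_le fun J => (hhm J).lintegral_prod_right'
    _ = _ := by
        congr 1
        ext J
        rw [lintegral_lintegral_swap (f := fun x t => h J (x, t)) (hhm J).aemeasurable]
        simp_rw [ht]

lemma absolutelyContinuous_of_liminf_ne_top (ν : Measure ℝ) [IsFiniteMeasure ν]
    (hν : ν (Icc (-1) 1)ᶜ = 0) {r : ℕ → ℝ}
    (hr : ∀ J, 0 < r J) (hr0 : Filter.Tendsto r Filter.atTop (nhds 0)) {g : ℕ → ℝ → ℝ≥0∞}
    (hg : ∀ J, Measurable (g J))
    (hνg : ∀ J t, (ENNReal.ofReal (2 * r J))⁻¹ * ν (closedBall t (r J)) ≤ g J t)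
    (hfin : Filter.liminf (fun J => ∫⁻ t, g J t ^ (6 / 5 : ℝ) ∂circ) Filter.atTop ≠ ∞) :
    ν ≪ volume := by
  have hsub : Icc (-1 : ℝ) 1 ⊆ Ioo (-Real.pi) Real.pi := fun t ht =>
    ⟨by linarith [ht.1, Real.pi_gt_three], by linarith [ht.2, Real.pi_gt_three]⟩
  obtain ⟨B, hB1, hB2⟩ := exists_between hfin.lt_top
  have hfreq := Filter.frequently_lt_of_liminf_lt (by isBoundedDefault) hB1
  have hopen : ∀ O : Set ℝ, IsOpen O → ν O ≤ B ^ (5 / 6 : ℝ) * volume O ^ (1 / 6 : ℝ) := by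
    intro O hO
    set O' := O ∩ Ioo (-Real.pi) Real.pi with hO'
    have hO'o : IsOpen O' := hO.inter isOpen_Ioo
    have h1 : ν O ≤ ν O' := by
      calc ν O ≤ ν (O' ∪ (Icc (-1) 1)ᶜ) := measure_mono fun t ht => by
            by_cases h : t ∈ Icc (-1 : ℝ) 1
            · exact Or.inl ⟨ht, hsub h⟩
            · exact Or.inr h
        _ ≤ ν O' + ν (Icc (-1) 1)ᶜ := measure_union_le _ _
        _ = ν O' := by rw [hν, add_zero]
    refine h1.trans ((measure_le_liminf_lintegral_closedBall ν hr hr0 hO'o).trans ?_)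
    refine Filter.liminf_le_of_frequently_le' (hfreq.mono fun J hJ => ?_)
    have hholder := ENNReal.lintegral_mul_le_Lp_mul_Lq (volume.restrict O') (p := 6 / 5) (q := 6)
      (by rw [Real.holderConjugate_iff]; norm_num) (hg J).aemeasurable
      (g := fun _ => 1) aemeasurable_const
    simp only [Pi.mul_apply, mul_one, ENNReal.one_rpow, lintegral_one, Measure.restrict_apply_univ]
      at hholder
    refine (lintegral_mono fun t => hνg J t).trans (hholder.trans ?_)
    rw [show (1 / (6 / 5) : ℝ) = 5 / 6 by norm_num]
    gcongr
    · refine le_trans ?_ hJ.le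
      exact lintegral_mono_set fun t ht => ⟨ht.2.1, ht.2.2.le⟩
    · exact inter_subset_left
  intro A hA
  have hlim : Filter.Tendsto (fun δ : ℝ≥0∞ => B ^ (5 / 6 : ℝ) * δ ^ (1 / 6 : ℝ)) (nhds 0)
      (nhds (B ^ (5 / 6 : ℝ) * 0 ^ (1 / 6 : ℝ))) :=
    ENNReal.Tendsto.const_mul (ENNReal.continuous_rpow_const.tendsto 0)
      (Or.inr (ENNReal.rpow_ne_top_of_nonneg (by norm_num) hB2.ne))
  rw [ENNReal.zero_rpow_of_pos (by norm_num), mul_zero] at hlim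
  refine le_antisymm (ge_of_tendsto (hlim.mono_left nhdsWithin_le_nhds : Filter.Tendsto _
    (nhdsWithin (0 : ℝ≥0∞) (Ioi 0)) _) ?_) zero_le
  filter_upwards [self_mem_nhdsWithin] with δ hδ
  obtain ⟨O, hAO, hO, hOδ⟩ := A.exists_isOpen_lt_of_lt (μ := volume) δ (by rw [hA]; exact hδ)
  refine (measure_mono hAO).trans ((hopen O hO).trans ?_)
  gcongr

lemma LpPowNorm_le_liminf (ν : Measure ℝ) [IsFiniteMeasure ν]
    (hν : ν (Icc (-1) 1)ᶜ = 0) {r : ℕ → ℝ}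
    (hr : ∀ J, 0 < r J) (hr0 : Filter.Tendsto r Filter.atTop (nhds 0)) {g : ℕ → ℝ → ℝ≥0∞}
    (hg : ∀ J, Measurable (g J))
    (hνg : ∀ J t, (ENNReal.ofReal (2 * r J))⁻¹ * ν (closedBall t (r J)) ≤ g J t) :
    LpPowNorm ν volume (6 / 5) ≤
      Filter.liminf (fun J => ∫⁻ t, g J t ^ (6 / 5 : ℝ) ∂circ) Filter.atTop := by
  by_cases hfin : Filter.liminf (fun J => ∫⁻ t, g J t ^ (6 / 5 : ℝ) ∂circ) Filter.atTop = ∞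
  · rw [hfin]; exact le_top
  have hac := absolutelyContinuous_of_liminf_ne_top ν hν hr hr0 hg hνg hfin
  rw [LpPowNorm, if_pos hac]
  have hsub : Icc (-1 : ℝ) 1 ⊆ Ioc (-Real.pi) Real.pi := fun t ht =>
    ⟨by linarith [ht.1, Real.pi_gt_three], by linarith [ht.2, Real.pi_gt_three]⟩
  have hrr : Filter.Tendsto r Filter.atTop (nhdsWithin 0 (Ioi 0)) :=
    tendsto_nhdsWithin_iff.2 ⟨hr0, Filter.Eventually.of_forall hr⟩
  calc ∫⁻ t, ν.rnDeriv volume t ^ (6 / 5 : ℝ)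
      ≤ ∫⁻ t, (Ioc (-Real.pi) Real.pi).indicator
          (fun t => Filter.liminf (fun J => g J t ^ (6 / 5 : ℝ)) Filter.atTop) t := by
        refine lintegral_mono_ae ?_
        filter_upwards [Besicovitch.ae_tendsto_rnDeriv ν volume] with t ht
        have ht' := ht.comp hrr
        by_cases htI : t ∈ Icc (-1 : ℝ) 1
        · rw [indicator_of_mem (hsub htI)]
          rw [← ((ENNReal.continuous_rpow_const.tendsto _).comp ht').liminf_eq]
          refine Filter.liminf_le_liminf (Filter.Eventually.of_forall fun J => ?_)
          refine ENNReal.rpow_le_rpow ?_ (by norm_num)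
          refine le_trans (le_of_eq ?_) (hνg J t)
          simp only [Function.comp_apply]
          rw [Real.volume_closedBall, ENNReal.div_eq_inv_mul]
        · have h0 : ν.rnDeriv volume t = 0 := by
            refine tendsto_nhds_unique ht' (tendsto_const_nhds.congr' ?_)
            obtain ⟨ε, hε, hεsub⟩ := Metric.isOpen_iff.1 isClosed_Icc.isOpen_compl t htI
            filter_upwards [hr0.eventually (gt_mem_nhds hε)] with J hJ
            simp only [Function.comp_apply]
            rw [measure_mono_null ((closedBall_subset_ball hJ).trans hεsub) hν, ENNReal.zero_div]
          rw [h0, ENNReal.zero_rpow_of_pos (by norm_num)]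
          exact zero_le
    _ = ∫⁻ t, Filter.liminf (fun J => g J t ^ (6 / 5 : ℝ)) Filter.atTop ∂circ := by
        rw [lintegral_indicator measurableSet_Ioc, circ]
    _ ≤ _ := lintegral_liminf_le fun J => (hg J).pow_const _

lemma LpPowNorm_map_le {X Y : Type} [MeasurableSpace X] [MeasurableSpace Y] {L : X → Y}
    (hL : MeasurableEmbedding L) (ν H : Measure X) [SigmaFinite ν] [SigmaFinite H] (p : ℝ) :
    LpPowNorm (ν.map L) (H.map L) p ≤ LpPowNorm ν H p := by
  by_cases h : ν ≪ H
  · rw [LpPowNorm, LpPowNorm, if_pos h, if_pos (hL.absolutelyContinuous_map h), hL.lintegral_map]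
    refine lintegral_mono_ae ?_
    filter_upwards [hL.rnDeriv_map ν H] with x hx
    rw [hx]
  · rw [LpPowNorm, LpPowNorm, if_neg h]; exact le_top

lemma LpPowNorm_lineProj_le {γ : ℝ → E3} {θ : ℝ} (hθ : ‖γ θ‖ = 1) (μ : Measure E3)
    [IsFiniteMeasure μ] (p : ℝ) :
    LpPowNorm (μ.map (lineProj γ θ))
      ((μH[1]).restrict (Submodule.span ℝ {γ θ} : Submodule ℝ E3)) p ≤
        LpPowNorm (μ.map fun x => ⟪x, γ θ⟫) volume p := by
  set L := LinearIsometry.toSpanSingleton ℝ E3 hθ with hL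
  have hLe : MeasurableEmbedding L := L.isometry.isClosedEmbedding.measurableEmbedding
  have hin : Measurable fun x : E3 => ⟪x, γ θ⟫ := by fun_prop
  have h1 : μ.map (lineProj γ θ) = (μ.map fun x => ⟪x, γ θ⟫).map L := by
    rw [Measure.map_map hLe.measurable hin]; rfl
  have h2 : (μH[1]).restrict ((Submodule.span ℝ {γ θ} : Submodule ℝ E3) : Set E3) =
      (volume : Measure ℝ).map L := by
    rw [← hausdorffMeasure_real, L.isometry.map_hausdorffMeasure (Or.inl zero_le_one)]
    congr 1
    rw [← LinearMap.range_toSpanSingleton]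
    rfl
  rw [h1, h2]
  exact LpPowNorm_map_le hLe _ _ p

/-! ### The estimate for the pushforward measures -/

lemma isFrostman_of_frostmanConst {X : Type} [PseudoMetricSpace X] [MeasurableSpace X]
    {μ : Measure X} {α : ℝ} (h : frostmanConst μ α ≠ ∞) :
    IsFrostman μ α (frostmanConst μ α).toReal := by
  intro x r hr
  have hle : μ (ball x r) / ENNReal.ofReal (r ^ α) ≤ frostmanConst μ α :=
    le_iSup_of_le x (le_iSup_of_le r (le_iSup_of_le hr le_rfl))
  have hpos : ENNReal.ofReal (r ^ α) ≠ 0 := by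
    simpa using Real.rpow_pos_of_pos hr α
  rw [ENNReal.ofReal_mul ENNReal.toReal_nonneg, ENNReal.ofReal_toReal h]
  exact (ENNReal.div_le_iff hpos ENNReal.ofReal_ne_top).1 hle

lemma IsFrostman.measure_univ_le {X : Type} [PseudoMetricSpace X] [MeasurableSpace X]
    {μ : Measure X} {α c : ℝ} (h : IsFrostman μ α c) {K : Set X} (hK : μ Kᶜ = 0) {x : X} {r : ℝ}
    (hr : 0 < r) (hsub : K ⊆ ball x r) : μ univ ≤ ENNReal.ofReal (c * r ^ α) := by
  calc μ univ ≤ μ (ball x r) + μ Kᶜ :=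
        (measure_mono fun y _ => (em (y ∈ K)).imp (fun hy => hsub hy) id).trans
          (measure_union_le _ _)
    _ ≤ _ := by rw [hK, add_zero]; exact h x r hr

lemma LpPowNorm_zero {X : Type} [MeasurableSpace X] (H : Measure X) {p : ℝ} (hp : 0 < p) :
    LpPowNorm 0 H p = 0 := by
  rw [LpPowNorm, if_pos (Measure.AbsolutelyContinuous.zero H)]
  refine (lintegral_congr_ae ?_).trans lintegral_zero
  filter_upwards [Measure.rnDeriv_zero H] with x hx
  rw [hx, Pi.zero_apply, ENNReal.zero_rpow_of_pos hp]

/-- The Fejér majorant of the density of the projection of `μ` in direction `γ θ`. -/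
def fejerMajorant (μ : Measure E3) (γ : ℝ → E3) (N : ℕ) (q : ℝ × ℝ) : ℝ :=
  μ.real univ + 2 * ‖projTrig μ (Finset.Ioo 0 (N : ℤ))
    (fun k => (ramp (1 - k / N) : ℂ)) (γ q.1) q.2‖

lemma fejerMajorant_nonneg (μ : Measure E3) (γ : ℝ → E3) (N : ℕ) (q : ℝ × ℝ) :
    0 ≤ fejerMajorant μ γ N q := by
  have : 0 ≤ μ.real univ := measureReal_nonneg
  unfold fejerMajorant
  positivity

lemma isBddMeas_fejerMajorant (μ : Measure E3) [IsFiniteMeasure μ] {γ : ℝ → E3}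
    (hγ : Continuous γ) (N : ℕ) : IsBddMeas fun q => (fejerMajorant μ γ N q : ℂ) := by
  obtain ⟨hm, B, hB⟩ := isBddMeas_projTrig_comp μ (Finset.Ioo 0 (N : ℤ))
    (κ := fun k => (ramp (1 - k / N) : ℂ)) (fun k => by
      rw [Complex.norm_real, Real.norm_of_nonneg (ramp_nonneg _)]; exact ramp_le_one _) hγ
  refine ⟨Complex.measurable_ofReal.comp (measurable_const.add (hm.norm.const_mul 2)),
    μ.real univ + 2 * B, fun q => ?_⟩
  rw [Complex.norm_real, Real.norm_of_nonneg (fejerMajorant_nonneg μ γ N q)]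
  have := hB q
  unfold fejerMajorant
  linarith

lemma measurable_fejerMajorant (μ : Measure E3) [IsFiniteMeasure μ] {γ : ℝ → E3}
    (hγ : Continuous γ) (N : ℕ) : Measurable (fejerMajorant μ γ N) :=
  Complex.measurable_re.comp (isBddMeas_fejerMajorant μ hγ N).1

lemma map_inner_closedBall_le (μ : Measure E3) [IsFiniteMeasure μ] (γ : ℝ → E3) {N : ℕ}
    (hN : 0 < N) (θ t : ℝ) :
    (ENNReal.ofReal (2 * (1 / N)))⁻¹ * (μ.map fun x => ⟪x, γ θ⟫) (closedBall t (1 / N)) ≤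
      ENNReal.ofReal (2 * fejerMajorant μ γ N (θ, t)) := by
  have hN' : (0 : ℝ) < N := by exact_mod_cast hN
  have hm : Measurable fun x : E3 => ⟪x, γ θ⟫ := by fun_prop
  have hset : (fun x : E3 => ⟪x, γ θ⟫) ⁻¹' closedBall t (1 / N) =
      {x | |t - ⟪x, γ θ⟫| ≤ 1 / N} := by
    ext x
    change dist ⟪x, γ θ⟫ t ≤ 1 / N ↔ |t - ⟪x, γ θ⟫| ≤ 1 / N
    rw [Real.dist_eq, abs_sub_comm]
  rw [Measure.map_apply hm measurableSet_closedBall, hset, ← ofReal_measureReal,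
    ← ENNReal.ofReal_inv_of_pos (by positivity), ← ENNReal.ofReal_mul (by positivity)]
  refine ENNReal.ofReal_le_ofReal ?_
  have h := measureReal_strip_le μ hN (γ θ) t
  have e : (2 * (1 / (N : ℝ)))⁻¹ = 2 * (N / 4) := by field_simp; norm_num
  rw [e, mul_assoc]
  exact mul_le_mul_of_nonneg_left h zero_le_two

lemma LpPowNorm_lineProj_le_liminf (μ : Measure E3) [IsFiniteMeasure μ]
    (hμ : μ (closedBall 0 1)ᶜ = 0) {γ : ℝ → E3} (hγ : Continuous γ) {θ : ℝ} (hθ : ‖γ θ‖ = 1)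
    {N : ℕ → ℕ} (hN : ∀ J, 0 < N J) (hN' : Filter.Tendsto N Filter.atTop Filter.atTop) :
    LpPowNorm (μ.map (lineProj γ θ))
      ((μH[1]).restrict (Submodule.span ℝ {γ θ} : Submodule ℝ E3)) (6 / 5) ≤
      Filter.liminf (fun J => ∫⁻ t, ENNReal.ofReal (2 * fejerMajorant μ γ (N J) (θ, t)) ^
        (6 / 5 : ℝ) ∂circ) Filter.atTop := by
  have hm : Measurable fun x : E3 => ⟪x, γ θ⟫ := by fun_prop
  refine (LpPowNorm_lineProj_le hθ μ _).trans (LpPowNorm_le_liminf _ ?_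
    (r := fun J => 1 / (N J : ℝ)) (fun J => by have := hN J; positivity)
    (tendsto_const_nhds.div_atTop (tendsto_natCast_atTop_atTop.comp hN')) (fun J => ?_)
    fun J t => map_inner_closedBall_le μ γ (hN J) θ t)
  · rw [Measure.map_apply hm measurableSet_Icc.compl]
    refine measure_mono_null (fun x hx => ?_) hμ
    contrapose! hx
    rw [notMem_compl_iff, mem_closedBall_zero_iff] at hx
    rw [mem_preimage, notMem_compl_iff, mem_Icc, ← abs_le]
    calc |⟪x, γ θ⟫| ≤ ‖x‖ * ‖γ θ‖ := abs_real_inner_le_norm _ _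
      _ ≤ 1 := by rw [hθ, mul_one]; exact hx
  · exact (((measurable_fejerMajorant μ hγ (N J)).comp measurable_prodMk_left).const_mul
      2).ennreal_ofReal

lemma lintegral_fejerMajorant_le (μ : Measure E3) [IsFiniteMeasure μ] (lam : Measure ℝ)
    [IsFiniteMeasure lam] {γ : ℝ → E3} (hγ : Continuous γ) {N : ℕ} {B : ℝ}
    (h : ∫ q, fejerMajorant μ γ N q ^ (6 / 5 : ℝ) ∂(lam.prod circ) ≤ B) :
    ∫⁻ θ, ∫⁻ t, ENNReal.ofReal (2 * fejerMajorant μ γ N (θ, t)) ^ (6 / 5 : ℝ) ∂circ ∂lam ≤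
      ENNReal.ofReal (2 ^ (6 / 5 : ℝ) * B) := by
  have hm : Measurable fun q => ENNReal.ofReal (2 * fejerMajorant μ γ N q) ^ (6 / 5 : ℝ) :=
    ((measurable_fejerMajorant μ hγ N).const_mul 2).ennreal_ofReal.pow_const _
  have hInt : Integrable (fun q => fejerMajorant μ γ N q ^ (6 / 5 : ℝ)) (lam.prod circ) := by
    refine (integrable_norm_rpow (isBddMeas_fejerMajorant μ hγ N) (p := 6 / 5)
      (by norm_num)).congr (Filter.Eventually.of_forall fun q => ?_)
    simp only [Complex.norm_real, Real.norm_of_nonneg (fejerMajorant_nonneg μ γ N q)]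
  have e : ∀ q, ENNReal.ofReal (2 * fejerMajorant μ γ N q) ^ (6 / 5 : ℝ) =
      ENNReal.ofReal (2 ^ (6 / 5 : ℝ) * fejerMajorant μ γ N q ^ (6 / 5 : ℝ)) := fun q => by
    have h0 := fejerMajorant_nonneg μ γ N q
    rw [ENNReal.ofReal_rpow_of_nonneg (by positivity) (by norm_num), Real.mul_rpow zero_le_two h0]
  rw [← lintegral_prod _ hm.aemeasurable, lintegral_congr e, ← ofReal_integral_eq_lintegral_ofReal
    (hInt.const_mul _) (Filter.Eventually.of_forall fun q => mul_nonneg (by positivity)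
      (Real.rpow_nonneg (fejerMajorant_nonneg μ γ N q) _)), integral_const_mul]
  exact ENNReal.ofReal_le_ofReal (mul_le_mul_of_nonneg_left h (by positivity))

lemma ofReal_massBound (μ : Measure E3) [IsFiniteMeasure μ] (lam : Measure ℝ)
    [IsFiniteMeasure lam] {cμ cl : ℝ≥0∞} (hcμ : cμ ≠ ∞) (hcl : cl ≠ ∞) :
    ENNReal.ofReal (massBound cμ.toReal (μ.real univ) (lam.real univ) cl.toReal) =
      cμ ^ (1 / 5 : ℝ) * μ univ * lam univ ^ (2 / 5 : ℝ) * cl ^ (3 / 5 : ℝ) := by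
  have h1 : 0 ≤ cμ.toReal := ENNReal.toReal_nonneg
  have h2 : 0 ≤ μ.real univ := measureReal_nonneg
  have h3 : 0 ≤ lam.real univ := measureReal_nonneg
  rw [massBound, ENNReal.ofReal_mul (by positivity), ENNReal.ofReal_mul (by positivity),
    ENNReal.ofReal_mul (by positivity),
    ← ENNReal.ofReal_rpow_of_nonneg h1 (by norm_num),
    ← ENNReal.ofReal_rpow_of_nonneg h3 (by norm_num),
    ← ENNReal.ofReal_rpow_of_nonneg ENNReal.toReal_nonneg (by norm_num),
    ENNReal.ofReal_toReal hcμ, ENNReal.ofReal_toReal hcl, ofReal_measureReal, ofReal_measureReal]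

theorem Lp_bound_for_projected_measures
    -- the compact interval `I = [a, b]`
    (a b : ℝ) (hab : a ≤ b)
    -- `γ : I → S²` is a `C²` curve with `det(γ, γ', γ'') ≠ 0` on `I`
    (γ : ℝ → E3) (hγC2 : ContDiff ℝ 2 γ)
    (hsphere : ∀ θ ∈ Icc a b, ‖γ θ‖ = 1)
    (hnondeg : ∀ θ ∈ Icc a b,
      LinearIndependent ℝ ![γ θ, deriv γ θ, deriv (deriv γ) θ])
    -- `1 < α ≤ 3`, `β > (3-α)/2`
    (α β : ℝ) (hα1 : 1 < α) (hα3 : α ≤ 3) (hβ : (3 - α) / 2 < β) :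
    ∃ p : ℝ, 1 < p ∧ p ≤ 2 ∧ ∃ C : ℝ≥0,
      ∀ μ : Measure E3, μ (Metric.closedBall (0 : E3) 1)ᶜ = 0 →
        frostmanConst μ α ≠ ∞ →
      ∀ lam : Measure ℝ, lam (Icc a b)ᶜ = 0 → frostmanConst lam β ≠ ∞ →
        ∫⁻ θ in Icc a b,
            LpPowNorm (μ.map (lineProj γ θ))
              ((μH[1]).restrict (Submodule.span ℝ {γ θ} : Submodule ℝ E3)) p
          ∂lam ≤
        (C : ℝ≥0∞) * frostmanConst μ α ^ (p - 1) * μ Set.univ *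
          lam Set.univ ^ ((2 - p) / 2) * frostmanConst lam β ^ (p / 2) := by
  obtain ⟨ρ, c, C, hγ⟩ := exists_curveNondeg hab hγC2 hsphere hnondeg
  have hγc : Continuous γ := hγC2.continuous
  have hδ : 0 < 2 * β - (3 - α) := by linarith
  obtain ⟨M, hM⟩ := exists_nat_ge (44 / (2 * β - (3 - α)))
  rw [div_le_iff₀ hδ] at hM
  have hM0 : M ≠ 0 := by rintro rfl; norm_num at hM
  obtain ⟨D, hD0, hD⟩ := hγ.exists_fejer_estimate hγc hab M hα1 hα3 hM
  refine ⟨6 / 5, by norm_num, by norm_num, (2 ^ (6 / 5 : ℝ) * D).toNNReal, ?_⟩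
  intro μ hμ hcμ lam hlam hcl
  have hFμ := isFrostman_of_frostmanConst hcμ
  have hFl := isFrostman_of_frostmanConst hcl
  have hμle := hFμ.measure_univ_le hμ (x := 0) (r := 2) (by norm_num)
    (closedBall_subset_ball (by norm_num))
  have hlamle := hFl.measure_univ_le hlam (x := a) (r := b - a + 1) (by linarith) fun t ht => by
    rw [mem_ball, Real.dist_eq, abs_of_nonneg (by linarith [ht.1])]; linarith [ht.2]
  have : IsFiniteMeasure μ := ⟨hμle.trans_lt ENNReal.ofReal_lt_top⟩
  have : IsFiniteMeasure lam := ⟨hlamle.trans_lt ENNReal.ofReal_lt_top⟩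
  rcases (ENNReal.toReal_nonneg (a := frostmanConst μ α)).eq_or_lt with h0 | hpos
  · have hμ0 : μ = 0 := by
      rw [← Measure.measure_univ_eq_zero]
      simpa [← h0] using hμle
    simp [hμ0, LpPowNorm_zero]
  set N : ℕ → ℕ := fun J => 4 ^ (J * M) with hN
  have hN' : Filter.Tendsto N Filter.atTop Filter.atTop :=
    (tendsto_pow_atTop_atTop_of_one_lt (by norm_num)).comp
      (Filter.tendsto_id.atTop_mul_const' (Nat.pos_of_ne_zero hM0))
  have hmeas : ∀ J, Measurable fun θ => ∫⁻ t, ENNReal.ofReal (2 * fejerMajorant μ γ (N J) (θ, t)) ^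
      (6 / 5 : ℝ) ∂circ := fun J =>
    (((measurable_fejerMajorant μ hγc (N J)).const_mul 2).ennreal_ofReal.pow_const
      _).lintegral_prod_right'
  calc ∫⁻ θ in Icc a b, LpPowNorm (μ.map (lineProj γ θ))
        ((μH[1]).restrict (Submodule.span ℝ {γ θ} : Submodule ℝ E3)) (6 / 5) ∂lam
      ≤ ∫⁻ θ in Icc a b, Filter.liminf (fun J => ∫⁻ t, ENNReal.ofReal
          (2 * fejerMajorant μ γ (N J) (θ, t)) ^ (6 / 5 : ℝ) ∂circ) Filter.atTop ∂lam :=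
        setLIntegral_mono' measurableSet_Icc fun θ hθ =>
          LpPowNorm_lineProj_le_liminf μ hμ hγc (hsphere θ hθ) (fun J => by positivity) hN'
    _ ≤ ∫⁻ θ, Filter.liminf (fun J => ∫⁻ t, ENNReal.ofReal
          (2 * fejerMajorant μ γ (N J) (θ, t)) ^ (6 / 5 : ℝ) ∂circ) Filter.atTop ∂lam :=
        setLIntegral_le_lintegral _ _
    _ ≤ Filter.liminf (fun J => ∫⁻ θ, ∫⁻ t, ENNReal.ofReal
          (2 * fejerMajorant μ γ (N J) (θ, t)) ^ (6 / 5 : ℝ) ∂circ ∂lam) Filter.atTop :=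
        lintegral_liminf_le hmeas
    _ ≤ Filter.liminf (fun _ : ℕ => ENNReal.ofReal (2 ^ (6 / 5 : ℝ) * (D * massBound
          (frostmanConst μ α).toReal (μ.real univ) (lam.real univ)
          (frostmanConst lam β).toReal))) Filter.atTop :=
        Filter.liminf_le_liminf (Filter.Eventually.of_forall fun J =>
          lintegral_fejerMajorant_le μ lam hγc (hD J (N J) _ _ μ lam rfl hμ hpos hFμ hlam
            ENNReal.toReal_nonneg hFl))
    _ = _ := by
        rw [Filter.liminf_const, ← mul_assoc, ENNReal.ofReal_mul (by positivity),
          ofReal_massBound μ lam hcμ hcl, ENNReal.ofReal]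
        norm_num [mul_assoc]
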